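/- arXiv:1702.06447 — 3 statements merged into one kernel-verified Lean document; each statement's English description precedes it below -/
import Mathlib

section
/- Let F be a C₁-field, A a finite-dimensional F-algebra of finite representation type, and K/F a field extension such that F is perfectly closed in K. Then every finitely generated A_K-module M has a minimal field of definition K₀ with F ⊆ K₀ ⊆ K and [K₀ : F] < ∞. -/
open TensorProduct

/-- `F` is a `C₁`-field. -/
def IsC1Field (F : Type) [Field F] : Prop :=
  ∀ (n d : ℕ) (f : MvPolynomial (Fin n) F), f.IsHomogeneous d → 0 < d → d < n →
    ∃ x : Fin n → F, x ≠ 0 ∧ MvPolynomial.eval x f = 0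

/-- A module is indecomposable. -/
def IsIndecomposableModule (A M : Type) [Ring A] [AddCommGroup M] [Module A M] : Prop :=
  Nontrivial M ∧ ∀ N P : Submodule A M, IsCompl N P → N = ⊥ ∨ P = ⊥

/-- The ring `A` has finite representation type. -/
def FiniteRepType (A : Type) [Ring A] : Prop :=
  ∃ S : Set (ModuleCat.{0} A), S.Finite ∧
    ∀ M : ModuleCat.{0} A, Module.Finite A M → IsIndecomposableModule A M →
      ∃ N ∈ S, Nonempty (M ≃ₗ[A] N)

/-- `F` is perfectly closed in `K`: every finite subextension of `K/F` is
separable over `F`. -/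
def PerfectlyClosedIn (F K : Type) [Field F] [Field K] [Algebra F K] : Prop :=
  ∀ E : IntermediateField F K, FiniteDimensional F E → Algebra.IsSeparable F E

/-- `M` descends to the intermediate field `E` of `K/F`. -/
def DescendsTo (F K A : Type) [Field F] [Field K] [Algebra F K]
    [Ring A] [Algebra F A]
    (M : Type) [AddCommGroup M] [Module F M] [Module K M] [Module A M]
    [IsScalarTower F K M] [IsScalarTower F A M] [SMulCommClass K A M]
    (E : IntermediateField F K) : Prop :=
  ∃ N : Submodule E M, (∀ (a : A) (x : M), x ∈ N → a • x ∈ N) ∧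
    IsBaseChange K N.subtype

section PartA
open MvPolynomial in
lemma top_mul_top {σ F : Type} [Field F] (g h : MvPolynomial σ F) :
    homogeneousComponent (g.totalDegree + h.totalDegree) (g * h) =
      homogeneousComponent g.totalDegree g * homogeneousComponent h.totalDegree h := by
  have hprod : g * h = ∑ a ∈ Finset.range (g.totalDegree + 1),
      ∑ b ∈ Finset.range (h.totalDegree + 1),
        homogeneousComponent a g * homogeneousComponent b h := by
    rw [← Finset.sum_mul_sum, sum_homogeneousComponent, sum_homogeneousComponent]
  have hmul : ∀ a b, (homogeneousComponent a g * homogeneousComponent b h).IsHomogeneous (a + b) :=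
    fun a b => (homogeneousComponent_isHomogeneous a g).mul (homogeneousComponent_isHomogeneous b h)
  have hc : ∀ a b n, homogeneousComponent n (homogeneousComponent a g * homogeneousComponent b h)
      = if n = a + b then homogeneousComponent a g * homogeneousComponent b h else 0 :=
    fun a b n => homogeneousComponent_of_mem (hmul a b)
  generalize hga : g.totalDegree = a0 at *
  generalize hhb : h.totalDegree = b0 at *
  conv_lhs => rw [hprod]
  rw [map_sum]
  simp_rw [map_sum, hc]
  rw [Finset.sum_eq_single a0]
  · rw [Finset.sum_eq_single b0]
    · simp
    · intro b hb hne
      rw [if_neg]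
      omega
    · simp
  · intro a ha hne
    refine Finset.sum_eq_zero fun b hb => ?_
    rw [if_neg]
    simp only [Finset.mem_range] at ha hb; omega
  · simp

open MvPolynomial in
lemma totalDegree_pos_of {σ F : Type} [Field F] (g : MvPolynomial σ F) (h0 : g ≠ 0)
    (h : constantCoeff g = 0) : 0 < g.totalDegree := by
  rw [Nat.pos_iff_ne_zero]
  intro h1
  rw [totalDegree_eq_zero_iff_eq_C] at h1
  rw [h1] at h h0
  simp at h h0
  exact h0 h

/-- A factorisation of a homogeneous polynomial of degree `d` in `d` variables
gives a nontrivial zero over a `C₁` field. -/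
lemma exists_zero_of_factor {F : Type} [Field F] (hC1 : IsC1Field F) (d : ℕ)
    (g h : MvPolynomial (Fin d) F) (hom : (g * h).IsHomogeneous d) (hne : g * h ≠ 0)
    (hg : MvPolynomial.constantCoeff g = 0) (hh : MvPolynomial.constantCoeff h = 0) :
    ∃ x : Fin d → F, x ≠ 0 ∧ MvPolynomial.eval x (g * h) = 0 := by
  have hg0 : g ≠ 0 := left_ne_zero_of_mul hne
  have hh0 : h ≠ 0 := right_ne_zero_of_mul hne
  have p1 := totalDegree_pos_of g hg0 hg
  have p2 := totalDegree_pos_of h hh0 hh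
  have hdeg : g.totalDegree + h.totalDegree = d := by
    rw [← MvPolynomial.totalDegree_mul_of_isDomain hg0 hh0, hom.totalDegree hne]
  have key := top_mul_top g h
  rw [hdeg, MvPolynomial.homogeneousComponent_eq_self hom] at key
  obtain ⟨x, hx, hx0⟩ := hC1 d g.totalDegree _
    (MvPolynomial.homogeneousComponent_isHomogeneous g.totalDegree g) p1 (by omega)
  refine ⟨x, hx, ?_⟩
  rw [key, map_mul, hx0, zero_mul]

open Polynomial in
lemma coeff_zero_const {F : Type} [Field F] (d : ℕ) (p q : Polynomial (MvPolynomial (Fin d) F))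
    (hp : p.Monic) (hpos : 0 < p.natDegree) (n : ℕ)
    (h : (p * q).map (MvPolynomial.constantCoeff) = Polynomial.X ^ n) :
    MvPolynomial.constantCoeff (p.coeff 0) = 0 := by
  have h1 : p.map (MvPolynomial.constantCoeff) ∣ Polynomial.X ^ n := by
    rw [← h, Polynomial.map_mul]; exact dvd_mul_right _ _
  rw [dvd_prime_pow Polynomial.prime_X] at h1
  obtain ⟨i, _, hi⟩ := h1
  have h2 : p.map (MvPolynomial.constantCoeff) = Polynomial.X ^ i :=
    Polynomial.eq_of_monic_of_associated (hp.map _) (Polynomial.monic_X_pow i) hi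
  have h3 : i = p.natDegree := by
    rw [← hp.natDegree_map (MvPolynomial.constantCoeff), h2, Polynomial.natDegree_X_pow]
  rw [← Polynomial.coeff_map, h2, Polynomial.coeff_X_pow, if_neg (by omega)]

open TensorProduct in
theorem commDivision_of_C1 {F : Type} [Field F] (hC1 : IsC1Field F) (D : Type) [DivisionRing D]
    [Algebra F D] [FiniteDimensional F D] (x y : D) : x * y = y * x := by
  classical
  let d := Module.finrank F D
  let b : Module.Basis (Fin d) F D := Module.finBasis F D
  let S := MvPolynomial (Fin d) F
  let k := FractionRing S
  let φ : D →ₗ[F] Module.End F D := LinearMap.mul F D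
  let χ := LinearMap.polyCharpoly φ b
  have hχm : χ.Monic := LinearMap.polyCharpoly_monic _ _
  have hχd : χ.natDegree = d := LinearMap.polyCharpoly_natDegree _ _
  let v : Fin d → k := fun i => algebraMap S k (MvPolynomial.X i)
  let ξ : k ⊗[F] D := (Algebra.TensorProduct.basis k b).repr.symm (Finsupp.equivFunOnFinite.symm v)
  have hae : (MvPolynomial.aeval v : S →ₐ[F] k).toRingHom = algebraMap S k := by
    have : (MvPolynomial.aeval v : S →ₐ[F] k) = IsScalarTower.toAlgHom F S k := by
      apply MvPolynomial.algHom_ext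
      intro i
      rw [MvPolynomial.aeval_X]; rfl
    rw [this]; rfl
  have hch : χ.map (algebraMap S k) = LinearMap.charpoly (Algebra.lmul k (k ⊗[F] D) ξ) := by
    rw [← hae]
    have := LinearMap.polyCharpolyAux_map_aeval φ b (Module.Free.chooseBasis F D) k v
    refine this.trans ?_
    congr 1
    have h2 : (LinearMap.tensorProduct F k D D).comp (LinearMap.baseChange k φ) =
        (Algebra.lmul k (k ⊗[F] D)).toLinearMap := by
      ext a c
      have h3 : LinearMap.tensorProduct F k D D (1 ⊗ₜ φ a) (1 ⊗ₜ c) = 1 ⊗ₜ (a * c) := by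
        simp [LinearMap.tensorProduct, φ]
      simpa using h3
    exact congrArg (fun f => f ξ) h2
  have hdvd : minpoly k ξ ∣ χ.map (algebraMap S k) := by
    apply minpoly.dvd
    have h1 := LinearMap.aeval_self_charpoly (Algebra.lmul k (k ⊗[F] D) ξ)
    rw [← hch, Polynomial.aeval_algHom_apply] at h1
    have h2 := congrArg (fun f => f 1) h1
    simpa using h2
  have hIsInt : IsIntegral k ξ := Algebra.IsIntegral.isIntegral ξ
  have hmm := minpoly.monic hIsInt
  obtain ⟨μ, hμ⟩ := IsIntegrallyClosed.eq_map_mul_C_of_dvd k hχm hdvd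
  rw [hmm.leadingCoeff, Polynomial.C_1, mul_one] at hμ
  have hinj : Function.Injective (algebraMap S k) := IsFractionRing.injective S k
  have hμm : μ.Monic := by
    apply Polynomial.monic_of_injective hinj
    rw [hμ]; exact hmm
  have hdvd' : μ ∣ χ := by
    rw [← hμ] at hdvd
    exact (Polynomial.map_dvd_map _ hinj hμm).mp hdvd
  obtain ⟨ν, hν⟩ := hdvd'
  have hνm : ν.Monic := hμm.of_mul_monic_left (hν ▸ hχm)
  have hμd : μ.natDegree = (minpoly k ξ).natDegree := by
    rw [← hμ, hμm.natDegree_map]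
  have hμpos : 0 < μ.natDegree := by rw [hμd]; exact minpoly.natDegree_pos hIsInt
  have hdeg : μ.natDegree + ν.natDegree = d := by
    rw [← hμm.natDegree_mul hνm, ← hν, hχd]
  have hconst : χ.map (MvPolynomial.constantCoeff) = Polynomial.X ^ d := by
    ext i
    rw [Polynomial.coeff_map, Polynomial.coeff_X_pow]
    by_cases hi : i = d
    · have h1 : χ.coeff i = 1 := by
        have h1 := hχm.coeff_natDegree
        rw [hχd] at h1
        rw [hi]; exact h1
      rw [if_pos hi, h1, map_one]
    · rw [if_neg hi]
      by_cases hi2 : i < d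
      · have h1 : (χ.coeff i).IsHomogeneous (d - i) :=
          LinearMap.polyCharpoly_coeff_isHomogeneous φ b i (d - i) (by omega)
        rw [MvPolynomial.constantCoeff_eq]
        apply h1.coeff_eq_zero
        simp; omega
      · rw [Polynomial.coeff_eq_zero_of_natDegree_lt (by omega), map_zero]
  have hν0 : ν.natDegree = 0 := by
    by_contra hcon
    have hc1 := coeff_zero_const d μ ν hμm hμpos d (by rw [← hν, hconst])
    have hc2 := coeff_zero_const d ν μ hνm (by omega) d (by rw [mul_comm, ← hν, hconst])
    have hN : χ.coeff 0 = μ.coeff 0 * ν.coeff 0 := by rw [hν, Polynomial.mul_coeff_zero]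
    have hhom : (χ.coeff 0).IsHomogeneous d :=
      LinearMap.polyCharpoly_coeff_isHomogeneous φ b 0 d (by simp [d])
    have hev : ∀ z : D, z ≠ 0 → MvPolynomial.eval (b.repr z) (χ.coeff 0) ≠ 0 := by
      intro z hz h0
      have h1 : MvPolynomial.eval (b.repr z) (χ.coeff 0) = (φ z).charpoly.coeff 0 :=
        LinearMap.polyCharpoly_coeff_eval φ b z 0
      rw [h1] at h0
      have h2 : LinearMap.det (φ z) = 0 := by
        rw [LinearMap.det_eq_sign_charpoly_coeff, h0, mul_zero]
      have h3 := LinearMap.bot_lt_ker_of_det_eq_zero h2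
      obtain ⟨w, hw, hw0⟩ := Submodule.exists_mem_ne_zero_of_ne_bot h3.ne'
      rw [LinearMap.mem_ker] at hw
      have : z * w = 0 := hw
      rcases mul_eq_zero.mp this with h | h
      · exact hz h
      · exact hw0 h
    have hne : χ.coeff 0 ≠ 0 := by
      intro h0
      apply hev 1 one_ne_zero
      rw [h0, map_zero]
    obtain ⟨z, hz, hz0⟩ := exists_zero_of_factor hC1 d (μ.coeff 0) (ν.coeff 0)
      (hN ▸ hhom) (hN ▸ hne) hc1 hc2
    rw [← hN] at hz0
    apply hev (b.equivFun.symm z)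
    · intro h0
      apply hz
      exact b.equivFun.symm.map_eq_zero_iff.mp h0
    · have h1 : ⇑(b.repr (b.equivFun.symm z)) = z := b.equivFun.apply_symm_apply z
      rw [h1]; exact hz0
  have hdim : (minpoly k ξ).natDegree = Module.finrank k (k ⊗[F] D) := by
    rw [Module.finrank_baseChange, ← hμd]; omega
  have hli := linearIndependent_pow (K := k) ξ
  have hspan : Submodule.span k (Set.range fun i : Fin (minpoly k ξ).natDegree => ξ ^ (i : ℕ)) = ⊤ := by
    apply hli.span_eq_top_of_card_eq_finrank'
    simp [hdim]
  have hcomm : ∀ z : k ⊗[F] D, Commute ξ z := by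
    intro z
    have hz : z ∈ Submodule.span k
      (Set.range fun i : Fin (minpoly k ξ).natDegree => ξ ^ (i : ℕ)) := hspan ▸ Submodule.mem_top
    induction hz using Submodule.span_induction with
    | mem x h => obtain ⟨i, rfl⟩ := h; exact (Commute.refl ξ).pow_right _
    | zero => exact Commute.zero_right _
    | add x y _ _ hx hy => exact hx.add_right hy
    | smul a x _ hx => exact hx.smul_right a
  have hcomm2 : ∀ w z : k ⊗[F] D, Commute w z := by
    intro w z
    have hz : z ∈ Submodule.span k
      (Set.range fun i : Fin (minpoly k ξ).natDegree => ξ ^ (i : ℕ)) := hspan ▸ Submodule.mem_top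
    induction hz using Submodule.span_induction with
    | mem x h => obtain ⟨i, rfl⟩ := h; exact ((hcomm w).symm).pow_right _
    | zero => exact Commute.zero_right _
    | add x y _ _ hx hy => exact hx.add_right hy
    | smul a x _ hx => exact hx.smul_right a
  have hfin := hcomm2 (1 ⊗ₜ x) (1 ⊗ₜ y)
  have hfin2 : (1 : k) ⊗ₜ[F] (x * y) = 1 ⊗ₜ (y * x) := by
    have := hfin.eq
    simpa using this
  exact Algebra.TensorProduct.includeRight_injective (R := F) (A := k) (B := D)
    (FaithfulSMul.algebraMap_injective F k) hfin2
end PartA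

section PartB

lemma pth_indep {k : Type} [Field k] (p : ℕ) [Fact p.Prime] [CharP k p] (b : k)
    (hb : ∀ c : k, c ^ p ≠ b) (y : Fin p → k) (h : ∑ j, y j ^ p * b ^ (j : ℕ) = 0) : y = 0 := by
  have hp : p.Prime := Fact.out
  have hirr := X_pow_sub_C_irreducible_of_prime hp hb
  have : Fact (Irreducible (Polynomial.X ^ p - Polynomial.C b)) := ⟨hirr⟩
  let E := AdjoinRoot (Polynomial.X ^ p - Polynomial.C b)
  have : CharP E p := charP_of_injective_algebraMap (algebraMap k E).injective p
  let q : Polynomial k := ∑ j : Fin p, Polynomial.C (y j) * Polynomial.X ^ (j : ℕ)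
  have hroot : (AdjoinRoot.root (Polynomial.X ^ p - Polynomial.C b)) ^ p =
      AdjoinRoot.of _ b := by
    have := AdjoinRoot.eval₂_root (Polynomial.X ^ p - Polynomial.C b)
    simpa [sub_eq_zero] using this
  have h1 : (AdjoinRoot.mk (Polynomial.X ^ p - Polynomial.C b) q) ^ p = 0 := by
    have e1 : AdjoinRoot.mk (Polynomial.X ^ p - Polynomial.C b) q =
      ∑ j : Fin p, AdjoinRoot.of _ (y j) *
        (AdjoinRoot.root (Polynomial.X ^ p - Polynomial.C b)) ^ (j : ℕ) := by
      simp [q, map_sum]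
    rw [e1]
    have e2 := sum_pow_char (R := E) p Finset.univ (fun j : Fin p => AdjoinRoot.of _ (y j) *
        (AdjoinRoot.root (Polynomial.X ^ p - Polynomial.C b)) ^ (j : ℕ))
    refine e2.trans ?_
    have e3 := congrArg (AdjoinRoot.of (Polynomial.X ^ p - Polynomial.C b)) h
    rw [map_sum, map_zero] at e3
    rw [← e3]
    refine Finset.sum_congr rfl fun j _ => ?_
    rw [mul_pow, ← pow_mul, mul_comm (j : ℕ) p, pow_mul, hroot, map_mul, map_pow, map_pow]
  have h2 := pow_eq_zero_iff hp.ne_zero |>.mp h1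
  rw [AdjoinRoot.mk_eq_zero] at h2
  have hdeg : q.degree < p := by
    refine (Polynomial.degree_sum_le _ _).trans_lt ?_
    rw [Finset.sup_lt_iff (by exact WithBot.bot_lt_coe p)]
    intro j _
    refine (Polynomial.degree_C_mul_X_pow_le _ _).trans_lt ?_
    exact_mod_cast j.2
  have h3 : q = 0 := by
    apply Polynomial.eq_zero_of_dvd_of_degree_lt h2
    rwa [Polynomial.degree_X_pow_sub_C hp.pos]
  funext j
  have := congrArg (fun r => Polynomial.coeff r (j : ℕ)) h3
  simp only [q, Polynomial.finsetSum_coeff, Polynomial.coeff_C_mul, Polynomial.coeff_X_pow,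
    Polynomial.coeff_zero] at this
  rw [Finset.sum_eq_single j] at this
  · simpa using this
  · intro i _ hij
    rw [if_neg (fun h => hij (Fin.ext h.symm)), mul_zero]
  · simp

lemma pth_expand {F : Type} [Field F] (hC1 : IsC1Field F) (p : ℕ) [Fact p.Prime] [CharP F p] (b : F)
    (hb : ∀ c : F, c ^ p ≠ b) (c : F) : ∃ d : Fin p → F, c = ∑ j, d j ^ p * b ^ (j : ℕ) := by
  have hp : p.Prime := Fact.out
  let f : MvPolynomial (Fin (p + 1)) F :=
    (∑ j : Fin p, MvPolynomial.C (b ^ (j : ℕ)) * MvPolynomial.X j.castSucc ^ p)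
      - MvPolynomial.C c * MvPolynomial.X (Fin.last p) ^ p
  have hf : f.IsHomogeneous p := by
    apply MvPolynomial.IsHomogeneous.sub
    · apply MvPolynomial.IsHomogeneous.sum
      intro j _
      exact MvPolynomial.isHomogeneous_C_mul_X_pow _ _ _
    · exact MvPolynomial.isHomogeneous_C_mul_X_pow _ _ _
  obtain ⟨x, hx, hx0⟩ := hC1 (p + 1) p f hf hp.pos (Nat.lt_succ_self p)
  have hx1 : ∑ j : Fin p, x j.castSucc ^ p * b ^ (j : ℕ) = c * x (Fin.last p) ^ p := by
    have : ∑ j : Fin p, b ^ (j : ℕ) * x j.castSucc ^ p - c * x (Fin.last p) ^ p = 0 := by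
      simpa [f, map_sum] using hx0
    rw [sub_eq_zero] at this
    rw [← this]
    exact Finset.sum_congr rfl fun j _ => mul_comm _ _
  have hl : x (Fin.last p) ≠ 0 := by
    intro hl
    rw [hl, zero_pow hp.ne_zero, mul_zero] at hx1
    have := pth_indep p b hb _ hx1
    apply hx
    funext i
    refine Fin.lastCases hl (fun j => congrFun this j) i
  refine ⟨fun j => x j.castSucc / x (Fin.last p), ?_⟩
  simp_rw [div_pow, div_mul_eq_mul_div]
  rw [← Finset.sum_div, hx1, mul_div_assoc, div_self (pow_ne_zero _ hl), mul_one]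

lemma not_pth {F K : Type} [Field F] [Field K] [Algebra F K] (hpc : PerfectlyClosedIn F K)
    (p : ℕ) [Fact p.Prime] [CharP F p] (b : F)
    (hb : ∀ c : F, c ^ p ≠ b) (c : K) : c ^ p ≠ algebraMap F K b := by
  intro hc
  have hp : p.Prime := Fact.out
  have : ExpChar F p := ExpChar.prime hp
  have hIsInt : IsIntegral F c := by
    apply IsIntegral.of_pow hp.pos
    rw [hc]; exact isIntegral_algebraMap
  have : FiniteDimensional F (IntermediateField.adjoin F {c}) :=
    IntermediateField.adjoin.finiteDimensional hIsInt
  have hsep := hpc (IntermediateField.adjoin F {c}) inferInstance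
  have h1 : c ∈ separableClosure F K := by
    apply (le_separableClosure_iff F K _).mpr hsep
    exact IntermediateField.mem_adjoin_simple_self F c
  have h2 : c ∈ perfectClosure F K := by
    rw [mem_perfectClosure_iff_pow_mem p]
    exact ⟨1, b, by rw [pow_one, hc]⟩
  have h3 : c ∈ separableClosure F K ⊓ perfectClosure F K := ⟨h1, h2⟩
  rw [separableClosure_inf_perfectClosure, IntermediateField.mem_bot] at h3
  obtain ⟨c', rfl⟩ := h3
  apply hb c'
  apply (algebraMap F K).injective
  rw [map_pow, hc]

lemma pth_pow_indep {F K : Type} [Field F] [Field K] [Algebra F K] (hC1 : IsC1Field F)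
    (hpc : PerfectlyClosedIn F K)
    (p : ℕ) [Fact p.Prime] [CharP F p] {ι : Type} (k : ι → K) (hk : LinearIndependent F k) :
    LinearIndependent F (fun i => k i ^ p) := by
  have hp : p.Prime := Fact.out
  have : CharP K p := charP_of_injective_algebraMap (algebraMap F K).injective p
  rw [linearIndependent_iff'] at hk ⊢
  intro s g hg i hi
  by_cases hperf : ∀ b : F, ∃ c : F, c ^ p = b
  · choose r hr using hperf
    have h1 : (∑ i ∈ s, r (g i) • k i) ^ p = 0 := by
      rw [sum_pow_char, ← hg]
      refine Finset.sum_congr rfl fun j _ => ?_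
      rw [smul_pow, hr]
    have h2 := hk s (fun i => r (g i)) (pow_eq_zero_iff hp.ne_zero |>.mp h1) i hi
    rw [← hr (g i), h2, zero_pow hp.ne_zero]
  · push Not at hperf
    obtain ⟨b, hb⟩ := hperf
    choose d hd using pth_expand hC1 p b hb
    have h1 : ∑ j : Fin p, (∑ i ∈ s, d (g i) j • k i) ^ p * (algebraMap F K b) ^ (j : ℕ) = 0 := by
      rw [← hg]
      simp_rw [sum_pow_char, Finset.sum_mul]
      rw [Finset.sum_comm]
      refine Finset.sum_congr rfl fun i _ => ?_
      conv_rhs => rw [hd (g i), Finset.sum_smul]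
      refine Finset.sum_congr rfl fun j _ => ?_
      rw [smul_pow, Algebra.smul_def, Algebra.smul_def, map_mul, map_pow, map_pow]
      ring
    have h2 := pth_indep p _ (not_pth hpc p b hb) _ h1
    rw [hd (g i)]
    refine Finset.sum_eq_zero fun j _ => ?_
    rw [hk s (fun i => d (g i) j) (congrFun h2 j) i hi, zero_pow hp.ne_zero, zero_mul]

lemma isReduced_charP {F K C : Type} [Field F] [Field K] [Algebra F K] (hC1 : IsC1Field F)
    (hpc : PerfectlyClosedIn F K) [CommRing C] [Algebra F C] [IsReduced C]
    (p : ℕ) [Fact p.Prime] [CharP F p] : IsReduced (K ⊗[F] C) := by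
  have hp : p.Prime := Fact.out
  rcases subsingleton_or_nontrivial (K ⊗[F] C) with hs | hs
  · infer_instance
  have : CharP (K ⊗[F] C) p :=
    charP_of_injective_algebraMap (algebraMap F (K ⊗[F] C)).injective p
  rw [isReduced_iff_pow_one_lt p hp.one_lt]
  intro z hz
  let B := Module.Basis.ofVectorSpace F K
  obtain ⟨c, rfl⟩ := TensorProduct.eq_repr_basis_left B z
  have hli := pth_pow_indep hC1 hpc p B B.linearIndependent
  rw [Finsupp.sum, sum_pow_char] at hz
  simp_rw [Algebra.TensorProduct.tmul_pow] at hz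
  have hc : ∀ i ∈ c.support, c i = 0 := by
    intro i hi
    have h1 : c i ^ p = 0 := by
      rw [← Module.forall_dual_apply_eq_zero_iff F]
      intro φ
      have h2 := congrArg ((TensorProduct.rid F K).toLinearMap ∘ₗ (LinearMap.lTensor K φ)) hz
      rw [map_sum, map_zero] at h2
      simp only [LinearMap.comp_apply, LinearMap.lTensor_tmul, LinearEquiv.coe_coe,
        TensorProduct.rid_tmul] at h2
      exact linearIndependent_iff'.mp hli c.support (fun i => φ (c i ^ p)) h2 i hi
    exact pow_eq_zero_iff hp.ne_zero |>.mp h1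
  exact Finset.sum_eq_zero fun i hi => by
    simp [hc i hi]

attribute [local instance] Ideal.Quotient.field in
lemma isReduced_charZero {F K C : Type} [Field F] [Field K] [Algebra F K] [CharZero F]
    [CommRing C] [Algebra F C] [FiniteDimensional F C] [IsReduced C] : IsReduced (K ⊗[F] C) := by
  have : IsArtinianRing C := .of_finite F C
  have (I : MaximalSpectrum C) : Algebra.FormallyEtale F (C ⧸ I.asIdeal) := by
    rw [Algebra.FormallyEtale.iff_isSeparable]
    infer_instance
  have : Algebra.FormallyEtale F C :=
    .of_equiv ((IsArtinianRing.equivPi C).restrictScalars F).symm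
  exact Algebra.FormallyUnramified.isReduced_of_field K (K ⊗[F] C)

theorem isReduced_baseChange {F K C : Type} [Field F] [Field K] [Algebra F K] (hC1 : IsC1Field F)
    (hpc : PerfectlyClosedIn F K) [CommRing C] [Algebra F C] [FiniteDimensional F C]
    [IsReduced C] : IsReduced (K ⊗[F] C) := by
  obtain ⟨p, hp⟩ := CharP.exists F
  rcases CharP.char_is_prime_or_zero F p with h | h
  · have : Fact p.Prime := ⟨h⟩
    exact isReduced_charP hC1 hpc p
  · subst h
    have : CharZero F := CharP.charP_to_charZero F
    exact isReduced_charZero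

end PartB

section PartC

lemma partC_gen {R W : Type} [CommRing R] [IsArtinianRing R] [IsReduced R]
    [AddCommGroup W] [Module R W] :
    ∃ (e : R) (w : W), e * e = e ∧ e • w = w ∧ (∀ r : R, r • w = 0 → r * e = 0) ∧
      (∀ r : R, (∀ x : W, r • x = 0) → r * e = 0) ∧ (∀ x : W, (1 - e) • x = 0) := by
  have := IsArtinianRing.isSemisimpleRing_of_isReduced R
  obtain ⟨I, ⟨w, hw⟩, hmin⟩ := WellFounded.has_min (IsWellFounded.wf (α := Ideal R) (r := (· < ·)))
    (Set.range fun w : W => LinearMap.ker (LinearMap.toSpanSingleton R W w)) ⟨_, ⟨0, rfl⟩⟩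
  have hI : ∀ r : R, r ∈ I ↔ r • w = 0 := by
    intro r; rw [← hw]; simp
  obtain ⟨f, hf, hIf⟩ := IsSemisimpleRing.ideal_eq_span_idempotent I
  have hff : f * f = f := hf
  have hfw : f • w = 0 := by
    rw [← hI, hIf]; exact Ideal.mem_span_singleton_self f
  have hmem : ∀ r : R, r • w = 0 → r * (1 - f) = 0 := by
    intro r hr
    rw [← hI, hIf, Ideal.mem_span_singleton'] at hr
    obtain ⟨a, rfl⟩ := hr
    rw [mul_sub, mul_one, mul_assoc, hff, sub_self]
  refine ⟨1 - f, w, ?_, ?_, hmem, fun r hr => hmem r (hr w), ?_⟩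
  · rw [mul_sub, mul_one, sub_mul, one_mul, hff]; ring
  · rw [sub_smul, one_smul, hfw, sub_zero]
  · intro v
    have hle : LinearMap.ker (LinearMap.toSpanSingleton R W (w + f • v)) ≤ I := by
      intro r hr
      have hr' : r • (w + f • v) = 0 := by simpa using hr
      rw [hI]
      have h1 : (1 - f) • r • (w + f • v) = r • w := by
        rw [smul_smul, mul_comm, ← smul_smul, smul_add, smul_smul, sub_mul, one_mul, hff, sub_self,
          zero_smul, sub_smul, one_smul, hfw, sub_zero, add_zero]
      rw [← h1, hr', smul_zero]
    have heq : LinearMap.ker (LinearMap.toSpanSingleton R W (w + f • v)) = I := by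
      by_contra hne
      exact hmin _ ⟨_, rfl⟩ (lt_of_le_of_ne hle hne)
    have hfI : f ∈ I := by rw [hI, hfw]
    rw [← heq] at hfI
    have h2 : f • (w + f • v) = 0 := by simpa using hfI
    rw [smul_add, hfw, zero_add, smul_smul, hff] at h2
    rw [sub_sub_cancel, h2]

theorem partC (K R : Type) [Field K] [CommRing R] [Algebra K R] [IsArtinianRing R] [IsReduced R]
    (W : Type) [AddCommGroup W] [Module R W] [Module K W] [IsScalarTower K R W]
    [FiniteDimensional K W] :
    ∃ (n : ℕ) (ε : ℕ → R) (w : ℕ → W), (∀ k, ε k * ε k = ε k) ∧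
      (∀ k, ε (k + 1) * ε k = ε (k + 1)) ∧ (∀ k, n ≤ k → ε k = 0) ∧ (∀ k, ε k • w k = w k) ∧
      (∀ x, ∃ c : ℕ → R, x = ∑ k ∈ Finset.range n, c k • w k) ∧
      (∀ c : ℕ → R, ∑ k ∈ Finset.range n, c k • w k = 0 → ∀ k < n, c k * ε k = 0) ∧
      (∀ r : R, (∀ x : W, r • x = 0) → r * ε 0 = 0) := by
  have := IsArtinianRing.isSemisimpleRing_of_isReduced R
  induction hd : Module.finrank K W using Nat.strong_induction_on generalizing W with
  | _ d ih =>
  by_cases hW : Subsingleton W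
  · refine ⟨0, 0, 0, ?_, ?_, ?_, ?_, ?_, ?_, ?_⟩ <;> simp
    intro x; exact Subsingleton.elim _ _
  rw [not_subsingleton_iff_nontrivial] at hW
  obtain ⟨e, w, hee, hew, hann, hann2, hkill⟩ := partC_gen (R := R) (W := W)
  have hw0 : w ≠ 0 := by
    rintro rfl
    have he : e = 0 := by simpa using hann 1 (smul_zero _)
    obtain ⟨x, hx⟩ := exists_ne (0 : W)
    apply hx
    simpa [he] using hkill x
  obtain ⟨W', hW'⟩ := exists_isCompl (Submodule.span R {w})
  have hfd : FiniteDimensional K W' :=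
    inferInstanceAs (FiniteDimensional K (W'.restrictScalars K))
  have hlt : Module.finrank K W' < d := by
    rw [← hd]
    have h1 : W'.restrictScalars K < ⊤ := by
      rw [lt_top_iff_ne_top]
      intro h
      have h2 : w ∈ W'.restrictScalars K := h ▸ Submodule.mem_top
      have h3 := Submodule.disjoint_def.mp hW'.disjoint w (Submodule.mem_span_singleton_self w) h2
      exact hw0 h3
    exact Submodule.finrank_lt h1.ne
  obtain ⟨n, ε, u, h1, h2, h3, h4, h5, h6, h7⟩ := ih _ hlt W' rfl
  have hcons : ∀ c : ℕ → R, ∑ k ∈ Finset.range (n + 1),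
      c k • (fun k : ℕ => Nat.casesOn k w (fun j => (u j : W)) : ℕ → W) k =
      c 0 • w + ((∑ k ∈ Finset.range n, c (k + 1) • u k : W') : W) := by
    intro c
    rw [Finset.sum_range_succ', add_comm]
    simp
  refine ⟨n + 1, fun k => Nat.casesOn k e ε, fun k => Nat.casesOn k w (fun j => (u j : W)),
    ?_, ?_, ?_, ?_, ?_, ?_, ?_⟩
  · rintro (_ | k)
    · exact hee
    · exact h1 k
  · rintro (_ | k)
    · have h8 := h7 (1 - e) (fun x => Subtype.ext (hkill x))
      show ε 0 * e = ε 0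
      rw [sub_mul, one_mul, sub_eq_zero] at h8
      rw [mul_comm, ← h8]
    · exact h2 k
  · rintro (_ | k) hk
    · omega
    · exact h3 k (by omega)
  · rintro (_ | k)
    · exact hew
    · exact congrArg Subtype.val (h4 k)
  · intro x
    have hx : x ∈ Submodule.span R {w} ⊔ W' := hW'.sup_eq_top ▸ Submodule.mem_top
    obtain ⟨y, hy, z, hz, rfl⟩ := Submodule.mem_sup.mp hx
    obtain ⟨r, rfl⟩ := Submodule.mem_span_singleton.mp hy
    obtain ⟨c, hc⟩ := h5 ⟨z, hz⟩
    refine ⟨fun k => Nat.casesOn k r c, ?_⟩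
    rw [hcons]
    simp only
    rw [← hc]
    rfl
  · intro c hc
    rw [hcons] at hc
    have h8 : c 0 • w = 0 := by
      apply Submodule.disjoint_def.mp hW'.disjoint
      · exact Submodule.smul_mem _ _ (Submodule.mem_span_singleton_self w)
      · rw [eq_neg_of_add_eq_zero_left hc]
        exact W'.neg_mem (Subtype.prop _)
    rw [h8, zero_add] at hc
    rintro (_ | k) hk
    · exact hann _ h8
    · exact h6 (fun k => c (k + 1)) (Subtype.ext hc) k (by omega)
  · exact hann2

end PartC

section PartC2

open Finset in
lemma decomp_le {R W : Type} [CommRing R] [AddCommGroup W] [Module R W]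
    (n n' : ℕ) (ε ε' : ℕ → R) (w w' : ℕ → W)
    (h2 : ∀ k, ε (k + 1) * ε k = ε (k + 1)) (h1 : ∀ k, ε k * ε k = ε k)
    (h3 : ∀ k, n ≤ k → ε k = 0)
    (h6 : ∀ c : ℕ → R, ∑ k ∈ range n, c k • w k = 0 → ∀ k < n, c k * ε k = 0)
    (h5 : ∀ x, ∃ c : ℕ → R, x = ∑ k ∈ range n, c k • w k)
    (h1' : ∀ k, ε' k * ε' k = ε' k)
    (h2' : ∀ k, ε' (k + 1) * ε' k = ε' (k + 1))
    (h4' : ∀ k, ε' k • w' k = w' k)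
    (h5' : ∀ x, ∃ c : ℕ → R, x = ∑ k ∈ range n', c k • w' k) (k : ℕ) :
    ε k * ε' k = ε k := by
  have hmono : ∀ l, l ≤ k → ε k * ε l = ε k := by
    intro l hl
    induction k, hl using Nat.le_induction with
    | base => exact h1 l
    | succ k _ ih => rw [← h2 k, mul_assoc, ih]
  have hmono' : ∀ l, k ≤ l → ε' l * ε' k = ε' l := by
    intro l hl
    induction l, hl using Nat.le_induction with
    | base => exact h1' k
    | succ k _ ih => rw [← h2' k, mul_assoc, ih]
  by_cases hk : n ≤ k
  · rw [h3 k hk, zero_mul]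
  push Not at hk
  set e := 1 - ε' k with he
  set f := e * ε k with hf
  have hee : e * e = e := by rw [he]; linear_combination (h1' k)
  have hff : f * f = f := by
    rw [hf]; linear_combination (ε k * ε k) * hee + e * h1 k
  have hew : ∀ j, k ≤ j → e • w' j = 0 := by
    intro j hj
    rw [← h4' j, ← mul_smul, he, sub_mul, one_mul, mul_comm, hmono' j hj, sub_self, zero_smul]
  choose a ha using h5
  choose b hb using h5'
  let B : W → ℕ → R := fun x j => if j < n' then b x j else 0
  have hex : ∀ x, e • x = ∑ j ∈ range k, (B x j) • (e • w' j) := by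
    intro x
    conv_lhs => rw [hb x]
    rw [smul_sum]
    have h7 : ∀ j ∈ range n', e • b x j • w' j = if j < k then b x j • e • w' j else 0 := by
      intro j _
      rw [smul_comm]
      split_ifs with h
      · rfl
      · rw [hew j (by omega), smul_zero]
    have h8 : ∀ j ∈ range k, B x j • e • w' j = if j < n' then b x j • e • w' j else 0 := by
      intro j _
      simp only [B]
      split_ifs with h
      · rfl
      · rw [zero_smul]
    rw [sum_congr rfl h7, sum_congr rfl h8, ← sum_filter, ← sum_filter]
    congr 1
    ext j; simp; omega
  have hfx : ∀ x, f • x = ∑ l ∈ range n, (f * ∑ j ∈ range k, B x j * a (w' j) l) • w l := by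
    intro x
    rw [hf, mul_comm e, mul_smul, hex, smul_sum]
    have h9 : ∀ j ∈ range k, ε k • B x j • e • w' j =
        ∑ l ∈ range n, (ε k * e * (B x j * a (w' j) l)) • w l := by
      intro j _
      conv_lhs => rw [ha (w' j)]
      rw [smul_sum, smul_sum, smul_sum]
      refine sum_congr rfl fun l _ => ?_
      rw [← mul_smul, ← mul_smul, ← mul_smul]
      congr 1; ring
    rw [sum_congr rfl h9, sum_comm]
    refine sum_congr rfl fun l _ => ?_
    rw [mul_sum, sum_smul]
  have hil : ∀ i < k + 1, ∀ l < k + 1, f * ∑ j ∈ range k, B (w i) j * a (w' j) l =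
      f * (if i = l then 1 else 0) := by
    intro i hi l hl
    have h10 : ∑ l ∈ range n, (f * ∑ j ∈ range k, B (w i) j * a (w' j) l
        - f * (if i = l then 1 else 0)) • w l = 0 := by
      simp only [sub_smul, sum_sub_distrib]
      rw [← hfx, sub_eq_zero]
      simp only [mul_ite, mul_one, mul_zero, ite_smul, zero_smul]
      rw [sum_ite_eq, if_pos (by rw [mem_range]; omega)]
    have h11 := h6 _ h10 l (by omega)
    have h12 : f * ε l = f := by rw [hf, mul_assoc, hmono l (by omega)]
    linear_combination h11 - (∑ j ∈ range k, B (w i) j * a (w' j) l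
        - (if i = l then 1 else 0)) * h12
  let MB : Matrix (Fin (k + 1)) (Fin (k + 1)) R := fun i j => if j.1 < k then B (w i) j else 0
  let MA : Matrix (Fin (k + 1)) (Fin (k + 1)) R := fun j l => a (w' j) l
  have hmat : f • (MB * MA) = f • (1 : Matrix (Fin (k + 1)) (Fin (k + 1)) R) := by
    ext i l
    rw [Matrix.smul_apply, Matrix.smul_apply, Matrix.mul_apply, Matrix.one_apply, smul_eq_mul,
      smul_eq_mul]
    have h13 := hil i i.2 l l.2
    rw [Fin.sum_univ_castSucc]
    simp only [MB, MA, Fin.val_castSucc, Fin.is_lt, if_true, Fin.val_last, lt_irrefl, if_false,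
      zero_mul, add_zero]
    rw [Fin.sum_univ_eq_sum_range (fun j => B (w i) j * a (w' j) l) k, h13]
    simp only [Fin.ext_iff]
  have hdet := congrArg Matrix.det hmat
  rw [Matrix.det_smul, Matrix.det_smul, Matrix.det_mul, Matrix.det_one,
    Matrix.det_eq_zero_of_column_eq_zero (A := MB) (Fin.last k) (fun i => by simp [MB]),
    zero_mul, mul_zero, mul_one, Fintype.card_fin] at hdet
  have hfp : ∀ m, f ^ (m + 1) = f := by
    intro m
    induction m with
    | zero => rw [zero_add, pow_one]
    | succ m ih => rw [pow_succ, ih, hff]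
  rw [hfp, hf, he] at hdet
  linear_combination hdet

/-- two decompositions have the same idempotents. -/
theorem decomp_unique {R W : Type} [CommRing R] [AddCommGroup W] [Module R W]
    (n n' : ℕ) (ε ε' : ℕ → R) (w w' : ℕ → W)
    (h1 : ∀ k, ε k * ε k = ε k)
    (h2 : ∀ k, ε (k + 1) * ε k = ε (k + 1))
    (h3 : ∀ k, n ≤ k → ε k = 0)
    (h4 : ∀ k, ε k • w k = w k)
    (h5 : ∀ x, ∃ c : ℕ → R, x = ∑ k ∈ Finset.range n, c k • w k)
    (h6 : ∀ c : ℕ → R, ∑ k ∈ Finset.range n, c k • w k = 0 → ∀ k < n, c k * ε k = 0)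
    (h1' : ∀ k, ε' k * ε' k = ε' k)
    (h2' : ∀ k, ε' (k + 1) * ε' k = ε' (k + 1))
    (h3' : ∀ k, n' ≤ k → ε' k = 0)
    (h4' : ∀ k, ε' k • w' k = w' k)
    (h5' : ∀ x, ∃ c : ℕ → R, x = ∑ k ∈ Finset.range n', c k • w' k)
    (h6' : ∀ c : ℕ → R, ∑ k ∈ Finset.range n', c k • w' k = 0 → ∀ k < n', c k * ε' k = 0)
    (k : ℕ) : ε k = ε' k := by
  rw [← decomp_le n n' ε ε' w w' h2 h1 h3 h6 h5 h1' h2' h4' h5' k, mul_comm]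
  exact decomp_le n' n ε' ε w' w h2' h1' h3' h6' h5' h1 h2 h4 h5 k

end PartC2

section PartS

/-- Every finite dimensional module is a summand of a power of `X`. -/
def Gens (F A X : Type) [Field F] [Ring A] [Algebra F A] [AddCommGroup X] [Module A X] : Prop :=
  ∀ (Z : Type) [AddCommGroup Z] [Module F Z] [Module A Z] [IsScalarTower F A Z]
    [FiniteDimensional F Z], ∃ (T : Type) (_ : Fintype T) (i : T → Z →ₗ[A] X) (r : T → X →ₗ[A] Z),
      ∑ t, r t ∘ₗ i t = LinearMap.id

lemma gens_of {F A X : Type} [Field F] [Ring A] [Algebra F A] [AddCommGroup X] [Module A X]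
    (h : ∀ (Z : Type) [AddCommGroup Z] [Module A Z], Module.Finite A Z →
      IsIndecomposableModule A Z → ∃ (i : Z →ₗ[A] X) (r : X →ₗ[A] Z), r ∘ₗ i = LinearMap.id) :
    Gens F A X := by
  intro Z _ _ _ _ _
  induction hd : Module.finrank F Z using Nat.strong_induction_on generalizing Z with
  | _ d ih =>
  by_cases hZ : Subsingleton Z
  · refine ⟨Empty, inferInstance, fun t => t.elim, fun t => t.elim, ?_⟩
    ext x
    exact Subsingleton.elim _ _
  rw [not_subsingleton_iff_nontrivial] at hZ
  have hfin : Module.Finite A Z := Module.Finite.of_restrictScalars_finite F A Z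
  by_cases hind : IsIndecomposableModule A Z
  · obtain ⟨i, r, hir⟩ := h Z hfin hind
    exact ⟨Unit, inferInstance, fun _ => i, fun _ => r, by simpa using hir⟩
  have hex : ∃ N P : Submodule A Z, IsCompl N P ∧ N ≠ ⊥ ∧ P ≠ ⊥ := by
    by_contra hcon
    push Not at hcon
    refine hind ⟨hZ, fun N P hNP => ?_⟩
    by_cases hN : N = ⊥
    · exact Or.inl hN
    · exact Or.inr (hcon N P hNP hN)
  obtain ⟨N, P, hNP, hN, hP⟩ := hex
  have key : ∀ N P : Submodule A Z, IsCompl N P → P ≠ ⊥ → Module.finrank F N < d := by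
    intro N P hNP hP
    rw [← hd]
    have h1 : N.restrictScalars F ≠ ⊤ := by
      intro h
      apply hP
      have h2 : N = ⊤ := by
        rw [← Submodule.restrictScalars_eq_top_iff F A Z]; exact h
      have := hNP.disjoint
      rw [h2] at this
      exact top_disjoint.mp this
    exact Submodule.finrank_lt h1
  have hN1 : FiniteDimensional F N :=
    inferInstanceAs (FiniteDimensional F (N.restrictScalars F))
  have hP1 : FiniteDimensional F P :=
    inferInstanceAs (FiniteDimensional F (P.restrictScalars F))
  obtain ⟨T1, _, i1, r1, h1⟩ := ih _ (key N P hNP hP) N rfl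
  obtain ⟨T2, _, i2, r2, h2⟩ := ih _ (key P N hNP.symm hN) P rfl
  let pN := N.projectionOnto P hNP
  let pP := P.projectionOnto N hNP.symm
  refine ⟨T1 ⊕ T2, inferInstance, Sum.elim (fun t => i1 t ∘ₗ pN) (fun t => i2 t ∘ₗ pP),
    Sum.elim (fun t => N.subtype ∘ₗ r1 t) (fun t => P.subtype ∘ₗ r2 t), ?_⟩
  rw [Fintype.sum_sum_type]
  ext x
  have e1 := congrArg (fun f => (f (pN x) : Z)) h1
  have e2 := congrArg (fun f => (f (pP x) : Z)) h2
  simp only [LinearMap.coe_sum, Finset.sum_apply, LinearMap.comp_apply, LinearMap.id_apply,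
    AddSubmonoidClass.coe_finsetSum] at e1 e2
  simp only [LinearMap.add_apply, LinearMap.coe_sum, Finset.sum_apply, Sum.elim_inl, Sum.elim_inr,
    LinearMap.comp_apply, Submodule.subtype_apply, LinearMap.id_apply]
  rw [e1, e2]
  exact Submodule.projection_add_projection_eq_self hNP x

theorem exists_gens (F A : Type) [Field F] [Ring A] [Algebra F A] [FiniteDimensional F A]
    (hfrt : FiniteRepType A) :
    ∃ (X : Type) (_ : AddCommGroup X) (_ : Module F X) (_ : Module A X) (_ : IsScalarTower F A X)
      (_ : FiniteDimensional F X), Gens F A X := by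
  classical
  obtain ⟨S, hS, hS2⟩ := hfrt
  let S' : Set (ModuleCat.{0} A) := {N ∈ S | Module.Finite A N}
  have hS' : S'.Finite := hS.subset (fun N hN => hN.1)
  obtain ⟨n, f, hf⟩ : ∃ (n : ℕ) (f : Fin n → ModuleCat.{0} A), Set.range f = S' := by
    have := hS'.to_subtype
    obtain ⟨n, ⟨e⟩⟩ := Finite.exists_equiv_fin S'
    refine ⟨n, fun i => (e.symm i).1, ?_⟩
    ext N
    constructor
    · rintro ⟨i, rfl⟩; exact (e.symm i).2
    · intro h; exact ⟨e ⟨N, h⟩, by simp⟩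
  let X := (i : Fin n) → f i
  let _ : Module F X := Module.compHom X (algebraMap F A)
  have htow : IsScalarTower F A X := ⟨fun r a x => by
    show (r • a) • x = algebraMap F A r • a • x
    rw [Algebra.smul_def, mul_smul]⟩
  have hfin : ∀ i, Module.Finite A (f i) := by
    intro i
    have : f i ∈ S' := hf ▸ ⟨i, rfl⟩
    exact this.2
  have hX : Module.Finite A X := inferInstance
  have hXF : FiniteDimensional F X := Module.Finite.trans A X
  refine ⟨X, inferInstance, inferInstance, inferInstance, htow, hXF, ?_⟩
  apply gens_of
  intro Z _ _ hZ hind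
  obtain ⟨N, hN, ⟨e⟩⟩ := hS2 (ModuleCat.of A Z) hZ hind
  have hN' : N ∈ S' := ⟨hN, Module.Finite.equiv e⟩
  rw [← hf] at hN'
  obtain ⟨j, rfl⟩ := hN'
  refine ⟨LinearMap.single A (fun i => (f i : Type)) j ∘ₗ e.toLinearMap,
    e.symm.toLinearMap ∘ₗ LinearMap.proj j, ?_⟩
  ext x
  have h1 : ∀ y : f j, LinearMap.proj (R := A) (φ := fun i => (f i : Type)) j
      (LinearMap.single A (fun i => (f i : Type)) j y) = y := fun y => by simp
  exact (congrArg e.symm (h1 (e x))).trans (e.symm_apply_apply x)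

end PartS

section PartR

theorem ring_basic {F : Type} [Field F] (hC1 : IsC1Field F) (Γ : Type) [Ring Γ] [Algebra F Γ]
    [FiniteDimensional F Γ] :
    ∃ (e : Γ) (C : Type) (_ : CommRing C) (_ : Algebra F C) (_ : FiniteDimensional F C)
      (_ : IsReduced C) (q : Γ →ₗ[F] C) (J : Ideal Γ) (n : ℕ) (T : Type) (_ : Fintype T)
      (a b : T → Γ),
      e * e = e ∧ q e = 1 ∧ (∀ x y, q ((e * x * e) * (e * y * e)) = q (e * x * e) * q (e * y * e)) ∧
      (∀ c, ∃ x, q (e * x * e) = c) ∧ (∀ x, q (e * x * e) = 0 → e * x * e ∈ J) ∧ J ^ n = ⊥ ∧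
      ∑ t, a t * e * b t = 1 := by
  classical
  have : IsArtinianRing Γ := .of_finite F Γ
  let J := Ring.jacobson Γ
  obtain ⟨N, hN⟩ := IsSemiprimaryRing.isNilpotent (R := Γ)
  have hfin : Module.Finite F (Γ ⧸ J) :=
    Module.Finite.of_surjective (Ideal.Quotient.mkₐ F J).toLinearMap Ideal.Quotient.mk_surjective
  obtain ⟨n, D, d, _, _, hDf, hd, ⟨E⟩⟩ :=
    IsSemisimpleRing.exists_algEquiv_pi_matrix_divisionRing_finite F (Γ ⧸ J)
  let Φ : Γ →ₐ[F] ((i : Fin n) → Matrix (Fin (d i)) (Fin (d i)) (D i)) :=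
    E.toAlgHom.comp (Ideal.Quotient.mkₐ F J)
  have hΦs : Function.Surjective Φ := E.surjective.comp Ideal.Quotient.mk_surjective
  have hΦk : ∀ x, Φ x = 0 ↔ x ∈ J := by
    intro x
    have : Φ x = E (Ideal.Quotient.mk J x) := rfl
    rw [this, map_eq_zero_iff E E.injective, Ideal.Quotient.eq_zero_iff_mem]
  have hnil : ∀ x ∈ RingHom.ker Φ.toRingHom, IsNilpotent x := by
    intro x hx
    refine ⟨N, ?_⟩
    have hx' : x ∈ J := (hΦk x).mp hx
    have : x ^ N ∈ J ^ N := Ideal.pow_mem_pow hx' N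
    rw [show J ^ N = ⊥ from hN] at this
    simpa using this
  let eb : (i : Fin n) → Matrix (Fin (d i)) (Fin (d i)) (D i) := fun i => Matrix.single 0 0 1
  have heb : IsIdempotentElem eb := by
    funext i
    show eb i * eb i = eb i
    simp only [eb]
    rw [Matrix.single_mul_single_same, one_mul]
  obtain ⟨e, hee, hΦe⟩ := exists_isIdempotentElem_eq_of_ker_isNilpotent Φ.toRingHom hnil eb
    (hΦs eb) heb
  have hΦe' : Φ e = eb := hΦe
  let _ : ∀ i, CommRing (D i) := fun i =>
    { (inferInstance : DivisionRing (D i)) with mul_comm := commDivision_of_C1 hC1 (D i) }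
  have hred : ∀ i, IsReduced (D i) := fun i => inferInstance
  let q : Γ →ₗ[F] ((i : Fin n) → D i) :=
    LinearMap.pi fun i => (Matrix.entryLinearMap F (D i) 0 0) ∘ₗ (LinearMap.proj i) ∘ₗ Φ.toLinearMap
  have hq : ∀ x i, q x i = Φ x i 0 0 := fun x i => rfl
  have hform : ∀ x, Φ (e * x * e) = fun i => Matrix.single 0 0 (Φ x i 0 0) := by
    intro x
    rw [map_mul, map_mul, hΦe']
    funext i
    show Matrix.single 0 0 1 * Φ x i * Matrix.single 0 0 1 = _
    rw [Matrix.single_mul_mul_single, one_mul, mul_one]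
  have hq' : ∀ x i, q (e * x * e) i = Φ x i 0 0 := by
    intro x i
    rw [hq, hform]; exact Matrix.single_apply_same _ _ _
  -- the sum
  let T := (i : Fin n) × Fin (d i)
  let ab : T → ((i : Fin n) → Matrix (Fin (d i)) (Fin (d i)) (D i)) :=
    fun t => Pi.single t.1 (Matrix.single t.2 0 1)
  let bb : T → ((i : Fin n) → Matrix (Fin (d i)) (Fin (d i)) (D i)) :=
    fun t => Pi.single t.1 (Matrix.single 0 t.2 1)
  choose a ha using fun t => hΦs (ab t)
  choose b hb using fun t => hΦs (bb t)
  have hsum : Φ (∑ t, a t * e * b t) = 1 := by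
    rw [map_sum]
    simp_rw [map_mul, ha, hb, hΦe']
    have h1 : ∀ t : T, ab t * eb * bb t = Pi.single t.1 (Matrix.single t.2 t.2 1) := by
      intro t
      funext i
      show ab t i * eb i * bb t i = _
      by_cases hi : i = t.1
      · subst hi
        simp only [ab, bb, eb, Pi.single_eq_same]
        rw [Matrix.single_mul_single_same, Matrix.single_mul_single_same, one_mul, one_mul]
      · simp only [ab, bb, Pi.single_eq_of_ne hi, zero_mul]
    simp_rw [h1]
    rw [Fintype.sum_sigma]
    funext i
    rw [Finset.sum_apply, Finset.sum_eq_single i]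
    · rw [Finset.sum_apply]
      simp only [Pi.single_eq_same]
      exact Matrix.sum_single_one
    · intro j _ hj
      rw [Finset.sum_apply]
      refine Finset.sum_eq_zero fun t _ => ?_
      exact Pi.single_eq_of_ne hj.symm _
    · simp
  have hunit : IsUnit (∑ t, a t * e * b t) := by
    have h2 : IsNilpotent (1 - ∑ t, a t * e * b t) := by
      apply hnil
      show Φ _ = 0
      rw [map_sub, hsum, map_one, sub_self]
    have := h2.isUnit_one_sub
    rwa [sub_sub_cancel] at this
  obtain ⟨u, hu⟩ := hunit
  refine ⟨e, (i : Fin n) → D i, inferInstance, inferInstance, inferInstance, inferInstance, q, J, N,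
    T, inferInstance, fun t => ↑u⁻¹ * a t, b, hee, ?_, ?_, ?_, ?_, hN, ?_⟩
  · funext i
    rw [hq, hΦe']
    exact Matrix.single_apply_same _ _ _
  · intro x y
    have h3 : (e * x * e) * (e * y * e) = e * (x * e * y) * e := by
      rw [show (e * x * e) * (e * y * e) = e * x * (e * e) * y * e by noncomm_ring, hee.eq]
      noncomm_ring
    rw [h3]
    funext i
    rw [Pi.mul_apply, hq', hq', hq', map_mul, map_mul, hΦe']
    show ((Φ x i * Matrix.single 0 0 1 * Φ y i : Matrix (Fin (d i)) (Fin (d i)) (D i)) 0 0) = _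
    rw [Matrix.mul_apply, Finset.sum_eq_single 0]
    · simp
    · intro j _ hj
      rw [Matrix.mul_single_apply_of_ne _ _ _ _ _ hj, zero_mul]
    · simp
  · intro c
    obtain ⟨x, hx⟩ := hΦs (fun i => Matrix.single 0 0 (c i))
    refine ⟨x, ?_⟩
    funext i
    rw [hq', hx]; exact Matrix.single_apply_same _ _ _
  · intro x hx
    rw [← hΦk, hform]
    funext i
    rw [← hq', hx]
    simp
  · have : ∀ t, ↑u⁻¹ * a t * e * b t = ↑u⁻¹ * (a t * e * b t) := fun t => by noncomm_ring
    simp_rw [this]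
    rw [← Finset.mul_sum, ← hu, Units.inv_mul]

end PartR

section PartU

lemma finite_end (F A X : Type) [Field F] [Ring A] [Algebra F A] [AddCommGroup X] [Module F X]
    [Module A X] [IsScalarTower F A X] [FiniteDimensional F X] :
    FiniteDimensional F (Module.End A X) :=
  Module.Finite.of_injective (LinearMap.restrictScalarsₗ F A X X F)
    (LinearMap.restrictScalars_injective F)

theorem exists_setup (F A : Type) [Field F] [Ring A] [Algebra F A] [FiniteDimensional F A]
    (hC1 : IsC1Field F) (hfrt : FiniteRepType A) :
    ∃ (X : Type) (_ : AddCommGroup X) (_ : Module F X) (_ : Module A X) (_ : IsScalarTower F A X)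
      (_ : FiniteDimensional F X) (C : Type) (_ : CommRing C) (_ : Algebra F C)
      (_ : FiniteDimensional F C) (_ : IsReduced C) (π : Module.End A X →ₐ[F] C) (N : ℕ),
      Gens F A X ∧ Function.Surjective π ∧
      (LinearMap.ker π.toLinearMap : Submodule F (Module.End A X)) ^ N = ⊥ := by
  obtain ⟨X, _, _, _, _, _, hX⟩ := exists_gens F A hfrt
  have := finite_end F A X
  obtain ⟨e, C, _, _, _, _, q, J, N, T, _, a, b, hee, hqe, hqm, hqs, hqk, hJ, hab⟩ :=
    ring_basic hC1 (Module.End A X)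
  let X' : Submodule A X := LinearMap.range e
  let ι : X' →ₗ[A] X := X'.subtype
  let ρ : X →ₗ[A] X' := e.rangeRestrict
  have hιρ : ι ∘ₗ ρ = e := by ext x; rfl
  have hρι : ρ ∘ₗ ι = LinearMap.id := by
    ext x
    obtain ⟨y, hy⟩ := x.2
    show e x = x
    rw [← hy]
    exact congrArg (fun f => f y) hee
  have hρι' : ∀ x, ρ (ι x) = x := fun x => congrArg (fun f => f x) hρι
  have hιρ' : ∀ x, ι (ρ x) = e x := fun x => congrArg (fun f => f x) hιρ
  have hfd : FiniteDimensional F X' :=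
    inferInstanceAs (FiniteDimensional F (X'.restrictScalars F))
  let α : Module.End A X' →ₗ[F] Module.End A X :=
    { toFun := fun g => ι ∘ₗ g ∘ₗ ρ
      map_add' := fun g h => by ext x; simp
      map_smul' := fun c g => by ext x; simp }
  have hαm : ∀ g h, α (g * h) = α g * α h := by
    intro g h
    ext x
    show ι (g (h (ρ x))) = ι (g (ρ (ι (h (ρ x)))))
    rw [hρι']
  have hα1 : α 1 = e := hιρ
  have hαe : ∀ g, e * α g * e = α g := by
    intro g
    rw [← hα1, ← hαm, ← hαm, one_mul, mul_one]
  have hαi : ∀ g, α g = 0 → g = 0 := by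
    intro g hg
    ext x
    have h1 : ι (g (ρ (ι x))) = 0 := congrArg (fun f => f (ι x)) hg
    rw [hρι'] at h1
    exact h1
  have hαs : ∀ x, ∃ g, α g = e * x * e := by
    intro x
    refine ⟨ρ ∘ₗ x ∘ₗ ι, ?_⟩
    ext y
    show ι (ρ (x (ι (ρ y)))) = e (x (e y))
    rw [hιρ', hιρ']
  let π : Module.End A X' →ₐ[F] C := AlgHom.ofLinearMap (q ∘ₗ α)
    (by rw [LinearMap.comp_apply, hα1, hqe])
    (by
      intro g h
      simp only [LinearMap.comp_apply]
      rw [hαm, ← hαe g, ← hαe h, hqm])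
  have hπ : ∀ g, π g = q (α g) := fun g => rfl
  refine ⟨X', inferInstance, inferInstance, inferInstance, inferInstance, hfd, C, inferInstance,
    inferInstance, inferInstance, inferInstance, π, N, ?_, ?_, ?_⟩
  · intro Z _ _ _ _ _
    obtain ⟨S, _, i, r, hir⟩ := hX Z
    refine ⟨S × T, inferInstance, fun t => ρ ∘ₗ b t.2 ∘ₗ i t.1, fun t => r t.1 ∘ₗ a t.2 ∘ₗ ι, ?_⟩
    rw [Fintype.sum_prod_type]
    rw [← hir]
    refine Finset.sum_congr rfl fun s _ => ?_
    ext z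
    have h1 := congrArg (fun f => f (i s z)) hab
    simp only [LinearMap.coe_sum, Finset.sum_apply, Module.End.one_apply] at h1
    simp only [LinearMap.coe_sum, Finset.sum_apply, LinearMap.comp_apply, hιρ']
    rw [← map_sum]
    exact congrArg _ h1
  · intro c
    obtain ⟨x, hx⟩ := hqs c
    obtain ⟨g, hg⟩ := hαs x
    exact ⟨g, by rw [hπ, hg, hx]⟩
  · have hk : ∀ m (x : Module.End A X'),
        x ∈ (LinearMap.ker π.toLinearMap : Submodule F (Module.End A X')) ^ m → α x ∈ J ^ m := by
      intro m
      induction m with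
      | zero => intro x _; rw [Submodule.pow_zero, Ideal.one_eq_top]; trivial
      | succ m ih =>
        intro x hx
        rw [pow_succ] at hx
        rw [Submodule.pow_succ]
        induction hx using Submodule.mul_induction_on' with
        | mem_mul_mem y hy z hz =>
          rw [hαm]
          apply Ideal.mul_mem_mul (ih y hy)
          have hz' : q (α z) = 0 := hz
          rw [← hαe] at hz' ⊢
          exact hqk _ hz'
        | add y _ z _ hy hz => rw [map_add]; exact add_mem hy hz
    rw [eq_bot_iff]
    intro x hx
    have := hk N x hx
    rw [hJ] at this
    exact hαi x this

end PartU

section PartD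

variable {F L A X N C : Type} [Field F] [Field L] [Algebra F L] [Ring A] [Algebra F A]
  [AddCommGroup X] [Module F X] [Module A X] [IsScalarTower F A X]
  [AddCommGroup N] [Module F N] [Module L N] [Module A N]
  [IsScalarTower F L N] [IsScalarTower F A N] [SMulCommClass A L N]
  [CommRing C] [Algebra F C] (π : Module.End A X →ₐ[F] C)

/-- precomposition -/
def precomp (F L A X N : Type) [Field F] [Field L] [Algebra F L] [Ring A] [Algebra F A]
    [AddCommGroup X] [Module F X] [Module A X] [IsScalarTower F A X]
    [AddCommGroup N] [Module F N] [Module L N] [Module A N]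
    [IsScalarTower F L N] [IsScalarTower F A N] [SMulCommClass A L N] :
    Module.End A X →ₗ[F] ((X →ₗ[A] N) →ₗ[L] (X →ₗ[A] N)) where
  toFun γ :=
    { toFun := fun p => p ∘ₗ γ
      map_add' := fun p q => by ext x; rfl
      map_smul' := fun c p => by ext x; rfl }
  map_add' γ δ := by ext p x; simp
  map_smul' c γ := by ext p x; simp

/-- the (right) action of `L ⊗ End X` on `Hom (X, N)` -/
noncomputable def act (F L A X N : Type) [Field F] [Field L] [Algebra F L] [Ring A] [Algebra F A]
    [AddCommGroup X] [Module F X] [Module A X] [IsScalarTower F A X]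
    [AddCommGroup N] [Module F N] [Module L N] [Module A N]
    [IsScalarTower F L N] [IsScalarTower F A N] [SMulCommClass A L N] :
    (L ⊗[F] Module.End A X) →ₗ[L] ((X →ₗ[A] N) →ₗ[L] (X →ₗ[A] N)) :=
  LinearMap.liftBaseChange L (precomp F L A X N)

lemma act_tmul (l : L) (γ : Module.End A X) (p : X →ₗ[A] N) :
    act F L A X N (l ⊗ₜ γ) p = l • (p ∘ₗ γ) := by
  simp [act, precomp]

lemma act_mul (z w : L ⊗[F] Module.End A X) (p : X →ₗ[A] N) :
    act F L A X N (z * w) p = act F L A X N w (act F L A X N z p) := by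
  induction z using TensorProduct.induction_on with
  | zero => simp
  | add z z' hz hz' => rw [add_mul, map_add, map_add, LinearMap.add_apply, LinearMap.add_apply,
      map_add, hz, hz']
  | tmul l γ =>
    induction w using TensorProduct.induction_on with
    | zero => simp
    | add w w' hw hw' => rw [mul_add, map_add, map_add, LinearMap.add_apply, LinearMap.add_apply,
        hw, hw']
    | tmul l' γ' =>
      rw [Algebra.TensorProduct.tmul_mul_tmul, act_tmul, act_tmul, act_tmul]
      ext x
      simp [mul_smul]
      rw [smul_comm]

lemma act_one (p : X →ₗ[A] N) : act F L A X N 1 p = p := by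
  rw [Algebra.TensorProduct.one_def, act_tmul, one_smul]; rfl

/-- `Hom (X, N) J` -/
def PJ (L : Type) (N : Type) [Field L]
    [AddCommGroup N] [Module L N] [Module A N] [SMulCommClass A L N] : Submodule L (X →ₗ[A] N) :=
  Submodule.span L {q | ∃ (p : X →ₗ[A] N) (j : Module.End A X), π j = 0 ∧ q = p ∘ₗ j}

lemma mem_PJ (p : X →ₗ[A] N) (j : Module.End A X) (hj : π j = 0) : p ∘ₗ j ∈ PJ π L N :=
  Submodule.subset_span ⟨p, j, hj, rfl⟩

lemma act_PJ (z : L ⊗[F] Module.End A X) (p : X →ₗ[A] N) (hp : p ∈ PJ π L N) :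
    act F L A X N z p ∈ PJ π L N := by
  induction z using TensorProduct.induction_on with
  | zero => simp
  | add z z' hz hz' => rw [map_add, LinearMap.add_apply]; exact add_mem hz hz'
  | tmul l γ =>
    rw [act_tmul]
    apply Submodule.smul_mem
    induction hp using Submodule.span_induction with
    | mem x h =>
      obtain ⟨q, j, hj, rfl⟩ := h
      rw [LinearMap.comp_assoc]
      exact mem_PJ π q (j * γ) (by rw [map_mul, hj, zero_mul])
    | zero => simp
    | add x y _ _ hx hy => rw [LinearMap.add_comp]; exact add_mem hx hy
    | smul a x _ hx => rw [LinearMap.smul_comp]; exact Submodule.smul_mem _ _ hx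

/-- base change of `π` -/
noncomputable def piL (L : Type) [Field L] [Algebra F L] :
    (L ⊗[F] Module.End A X) →ₐ[L] (L ⊗[F] C) :=
  Algebra.TensorProduct.map (AlgHom.id L L) π

lemma piL_tmul (l : L) (γ : Module.End A X) : piL π L (l ⊗ₜ γ) = l ⊗ₜ π γ := by simp [piL]

variable (hπ : Function.Surjective π)

include hπ in
lemma exists_sec : ∃ s : C →ₗ[F] Module.End A X, ∀ c, π (s c) = c := by
  obtain ⟨s, hs⟩ := π.toLinearMap.exists_rightInverse_of_surjective
    (LinearMap.range_eq_top.mpr hπ)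
  exact ⟨s, fun c => congrArg (fun f => f c) hs⟩

include hπ in
lemma piL_surj : Function.Surjective (piL π L) := by
  obtain ⟨s, hs⟩ := exists_sec π hπ
  intro z
  refine ⟨LinearMap.baseChange L s z, ?_⟩
  induction z using TensorProduct.induction_on with
  | zero => simp
  | add z z' hz hz' => rw [map_add, map_add, hz, hz']
  | tmul l c => rw [LinearMap.baseChange_tmul, piL_tmul, hs]

include hπ in
/-- the kernel of `piL` is generated by the kernel of `π`. -/
lemma piL_ker (z : L ⊗[F] Module.End A X) (hz : piL π L z = 0) :
    z ∈ Submodule.span L {w | ∃ j, π j = 0 ∧ w = (1 : L) ⊗ₜ[F] j} := by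
  obtain ⟨s, hs⟩ := exists_sec π hπ
  have h1 : ∀ z : L ⊗[F] Module.End A X, z - LinearMap.baseChange L s (piL π L z) ∈
      Submodule.span L {w | ∃ j, π j = 0 ∧ w = (1 : L) ⊗ₜ[F] j} := by
    intro z
    induction z using TensorProduct.induction_on with
    | zero => simp
    | add z z' hz hz' =>
      rw [map_add, map_add, add_sub_add_comm]; exact add_mem hz hz'
    | tmul l γ =>
      rw [piL_tmul, LinearMap.baseChange_tmul, ← TensorProduct.tmul_sub]
      have : l ⊗ₜ[F] (γ - s (π γ)) = l • ((1 : L) ⊗ₜ[F] (γ - s (π γ))) := by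
        rw [TensorProduct.smul_tmul', smul_eq_mul, mul_one]
      rw [this]
      apply Submodule.smul_mem
      exact Submodule.subset_span ⟨_, by rw [map_sub, hs, sub_self], rfl⟩
  have := h1 z
  rwa [hz, map_zero, sub_zero] at this

include hπ in
lemma act_mem_PJ (z : L ⊗[F] Module.End A X) (hz : piL π L z = 0) (p : X →ₗ[A] N) :
    act F L A X N z p ∈ PJ π L N := by
  have := piL_ker π hπ z hz
  clear hz
  induction this using Submodule.span_induction with
  | mem x h =>
    obtain ⟨j, hj, rfl⟩ := h
    rw [act_tmul]
    exact Submodule.smul_mem _ _ (mem_PJ π p j hj)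
  | zero => simp
  | add x y _ _ hx hy => rw [map_add]; exact add_mem hx hy
  | smul a x _ hx => rw [map_smul]; exact Submodule.smul_mem _ _ hx

include hπ in
/-- the kernel of `piL` is nil -/
lemma piL_nil (n : ℕ) (hJ : (LinearMap.ker π.toLinearMap : Submodule F (Module.End A X)) ^ n = ⊥)
    (z : L ⊗[F] Module.End A X) (hz : piL π L z = 0) : z ^ n = 0 := by
  have key : ∀ m, z ^ m ∈ Submodule.span L
      {w | ∃ j ∈ (LinearMap.ker π.toLinearMap : Submodule F (Module.End A X)) ^ m,
        w = (1 : L) ⊗ₜ[F] j} := by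
    intro m
    induction m with
    | zero =>
      apply Submodule.subset_span
      exact ⟨1, by rw [pow_zero]; exact Submodule.one_le.mp le_rfl,
        by rw [pow_zero, Algebra.TensorProduct.one_def]⟩
    | succ m ih =>
      rw [pow_succ]
      have h1 := piL_ker π hπ z hz
      have h2 : z ^ m * z ∈ Submodule.span L
        {w | ∃ j ∈ (LinearMap.ker π.toLinearMap : Submodule F (Module.End A X)) ^ m,
          w = (1 : L) ⊗ₜ[F] j} * Submodule.span L {w | ∃ j, π j = 0 ∧ w = (1 : L) ⊗ₜ[F] j} :=
        Submodule.mul_mem_mul ih h1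
      rw [Submodule.span_mul_span] at h2
      refine Submodule.span_mono ?_ h2
      rintro _ ⟨_, ⟨j, hj, rfl⟩, _, ⟨j', hj', rfl⟩, rfl⟩
      refine ⟨j * j', ?_, by simp⟩
      exact Submodule.mul_mem_mul hj hj'
  have := key n
  rw [hJ] at this
  have h3 : {w | ∃ j ∈ (⊥ : Submodule F (Module.End A X)), w = (1 : L) ⊗ₜ[F] j} ⊆ {0} := by
    rintro _ ⟨j, hj, rfl⟩
    rw [Submodule.mem_bot] at hj
    rw [hj, TensorProduct.tmul_zero]; rfl
  have h4 := Submodule.span_mono h3 this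
  simpa using h4

include hπ in
/-- A model for `Hom (X, N) / Hom (X, N) J` as module over `L ⊗ C`. -/
theorem exists_W [FiniteDimensional F X] [FiniteDimensional L N] :
    ∃ (W : Type) (_ : AddCommGroup W) (_ : Module (L ⊗[F] C) W) (_ : Module L W)
      (_ : IsScalarTower L (L ⊗[F] C) W) (_ : FiniteDimensional L W) (κ : (X →ₗ[A] N) →+ W),
      Function.Surjective κ ∧ (∀ p, κ p = 0 ↔ p ∈ PJ π L N) ∧
      ∀ g p, κ (act F L A X N g p) = piL π L g • κ p := by
  obtain ⟨s, hs⟩ := exists_sec π hπ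
  let sL := LinearMap.baseChange L s
  have hsL : ∀ z, piL π L (sL z) = z := by
    intro z
    induction z using TensorProduct.induction_on with
    | zero => simp
    | add z z' hz hz' => rw [map_add, map_add, hz, hz']
    | tmul l c => rw [LinearMap.baseChange_tmul, piL_tmul, hs]
  let W := (X →ₗ[A] N) ⧸ PJ (X := X) (A := A) π L N
  have hWf : FiniteDimensional L (X →ₗ[A] N) := by
    let b := Module.finBasis F X
    let ev : (X →ₗ[A] N) →ₗ[L] (Fin (Module.finrank F X) → N) :=
      { toFun := fun p i => p (b i)
        map_add' := fun p q => rfl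
        map_smul' := fun c p => rfl }
    refine Module.Finite.of_injective ev ?_
    intro p q h
    apply LinearMap.restrictScalars_injective F
    exact b.ext fun i => congrFun h i
  let mk : (X →ₗ[A] N) →ₗ[L] W := (PJ π L N).mkQ
  have hmk : ∀ p, mk p = 0 ↔ p ∈ PJ π L N := fun p => Submodule.Quotient.mk_eq_zero _
  let ρ0 : (L ⊗[F] C) →ₗ[L] (W →ₗ[L] W) :=
    { toFun := fun z => (PJ π L N).mapQ (PJ π L N) (act F L A X N (sL z))
        (fun p hp => act_PJ π _ p hp)
      map_add' := fun z z' => by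
        ext p; simp
      map_smul' := fun c z => by
        ext p; simp }
  have hρ0 : ∀ z p, ρ0 z (mk p) = mk (act F L A X N (sL z) p) := fun z p => rfl
  have hact : ∀ g p, mk (act F L A X N g p) = ρ0 (piL π L g) (mk p) := by
    intro g p
    rw [hρ0, ← sub_eq_zero, ← map_sub, hmk, ← LinearMap.sub_apply, ← map_sub]
    apply act_mem_PJ π hπ
    rw [map_sub, hsL, sub_self]
  have hmks : Function.Surjective mk := Submodule.mkQ_surjective _
  let ρ : (L ⊗[F] C) →ₐ[L] Module.End L W := AlgHom.ofLinearMap ρ0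
    (by
      ext p
      show ρ0 1 (mk p) = mk p
      rw [← map_one (piL π L), ← hact, act_one])
    (by
      intro z z'
      ext p
      show ρ0 (z * z') (mk p) = ρ0 z (ρ0 z' (mk p))
      rw [mul_comm]
      conv_lhs => rw [← hsL z, ← hsL z', ← map_mul, ← hact, act_mul]
      rw [hact, hact, hsL, hsL])
  let iW : Module (L ⊗[F] C) W := Module.compHom W ρ.toRingHom
  have hsm : ∀ (z : L ⊗[F] C) (w : W), z • w = ρ0 z w := fun z w => rfl
  refine ⟨W, inferInstance, iW, inferInstance, ⟨fun l z w => ?_⟩, inferInstance,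
    mk.toAddMonoidHom, hmks, hmk, ?_⟩
  · rw [hsm, hsm, map_smul]; rfl
  · intro g p
    rw [hsm]
    exact hact g p

end PartD

section PartD1

variable {F L A X N C : Type} [Field F] [Field L] [Algebra F L] [Ring A] [Algebra F A]
  [AddCommGroup X] [Module F X] [Module A X] [IsScalarTower F A X]
  [AddCommGroup N] [Module F N] [Module L N] [Module A N]
  [IsScalarTower F L N] [IsScalarTower F A N] [SMulCommClass A L N]
  [CommRing C] [Algebra F C] (π : Module.End A X →ₐ[F] C)

/-- A decomposition of the top of `Hom (X, N)`. -/
structure Decomp (n : ℕ) (ε : ℕ → L ⊗[F] C) (p : ℕ → (X →ₗ[A] N)) : Prop where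
  idem : ∀ k, ε k * ε k = ε k
  chain : ∀ k, ε (k + 1) * ε k = ε (k + 1)
  vanish : ∀ k, n ≤ k → ε k = 0
  fix : ∀ k g, piL π L g = ε k → act F L A X N g (p k) - p k ∈ PJ π L N
  span : ∀ q, ∃ c : ℕ → L ⊗[F] Module.End A X,
    q - ∑ k ∈ Finset.range n, act F L A X N (c k) (p k) ∈ PJ π L N
  indep : ∀ c : ℕ → L ⊗[F] Module.End A X,
    ∑ k ∈ Finset.range n, act F L A X N (c k) (p k) ∈ PJ π L N →
      ∀ k < n, piL π L (c k) * ε k = 0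

theorem exists_decomp (hπ : Function.Surjective π) [FiniteDimensional F X] [FiniteDimensional L N]
    [FiniteDimensional F C] [IsReduced (L ⊗[F] C)] :
    ∃ n ε p, Decomp (L := L) (N := N) π n ε p := by
  obtain ⟨W, _, _, _, _, _, κ, hκ, hker, hact⟩ := exists_W (L := L) (N := N) π hπ
  have hart : IsArtinianRing (L ⊗[F] C) := IsArtinianRing.of_finite L _
  obtain ⟨n, ε, w, h1, h2, h3, h4, h5, h6, -⟩ := partC L (L ⊗[F] C) W
  choose p hp using fun k => hκ (w k)
  refine ⟨n, ε, p, h1, h2, h3, ?_, ?_, ?_⟩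
  · intro k g hg
    rw [← hker, map_sub, hact, hg, hp, h4, sub_self]
  · intro q
    obtain ⟨c, hc⟩ := h5 (κ q)
    choose g hg using fun k => piL_surj (L := L) π hπ (c k)
    refine ⟨g, ?_⟩
    rw [← hker, map_sub, hc, map_sum, sub_eq_zero]
    refine Finset.sum_congr rfl fun k _ => ?_
    rw [hact, hg, hp]
  · intro c hc
    rw [← hker, map_sum] at hc
    apply h6
    rw [← hc]
    refine Finset.sum_congr rfl fun k _ => ?_
    rw [hact, hp]

theorem Decomp.unique (hπ : Function.Surjective π) [FiniteDimensional F X] [FiniteDimensional L N]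
    {n n' : ℕ} {ε ε' : ℕ → L ⊗[F] C} {p p' : ℕ → (X →ₗ[A] N)}
    (h : Decomp π n ε p) (h' : Decomp π n' ε' p') (k : ℕ) : ε k = ε' k := by
  obtain ⟨W, _, _, _, _, _, κ, hκ, hker, hact⟩ := exists_W (L := L) (N := N) π hπ
  have key : ∀ {n : ℕ} {ε : ℕ → L ⊗[F] C} {p : ℕ → (X →ₗ[A] N)}, Decomp π n ε p →
      (∀ k, ε k • κ (p k) = κ (p k)) ∧
      (∀ x, ∃ c : ℕ → L ⊗[F] C, x = ∑ k ∈ Finset.range n, c k • κ (p k)) ∧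
      (∀ c : ℕ → L ⊗[F] C, ∑ k ∈ Finset.range n, c k • κ (p k) = 0 → ∀ k < n, c k * ε k = 0) := by
    intro n ε p h
    refine ⟨?_, ?_, ?_⟩
    · intro k
      obtain ⟨g, hg⟩ := piL_surj (L := L) π hπ (ε k)
      have := h.fix k g hg
      rwa [← hker, map_sub, hact, hg, sub_eq_zero] at this
    · intro x
      obtain ⟨q, rfl⟩ := hκ x
      obtain ⟨c, hc⟩ := h.span q
      refine ⟨fun k => piL π L (c k), ?_⟩
      rw [← hker, map_sub, map_sum, sub_eq_zero] at hc
      rw [hc]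
      exact Finset.sum_congr rfl fun k _ => hact _ _
    · intro c hc
      choose g hg using fun k => piL_surj (L := L) π hπ (c k)
      intro k hk
      rw [← hg k]
      apply h.indep g _ k hk
      rw [← hker, map_sum, ← hc]
      refine Finset.sum_congr rfl fun k _ => ?_
      rw [hact, hg]
  obtain ⟨a4, a5, a6⟩ := key h
  obtain ⟨b4, b5, b6⟩ := key h'
  exact decomp_unique n n' ε ε' _ _ h.idem h.chain h.vanish a4 a5 a6
    h'.idem h'.chain h'.vanish b4 b5 b6 k

end PartD1

section PartF1

lemma PJ_induction {F L A X N C : Type} [Field F] [Field L] [Ring A] [Algebra F A]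
    [AddCommGroup X] [Module F X] [Module A X] [IsScalarTower F A X]
    [AddCommGroup N] [Module L N] [Module A N] [SMulCommClass A L N]
    [CommRing C] [Algebra F C] (π : Module.End A X →ₐ[F] C)
    (P : (X →ₗ[A] N) → Prop) (h0 : P 0) (hadd : ∀ p q, P p → P q → P (p + q))
    (hj : ∀ (q : X →ₗ[A] N) (j : Module.End A X), π j = 0 → P (q ∘ₗ j))
    (p : X →ₗ[A] N) (hp : p ∈ PJ π L N) : P p := by
  have : ∀ l : L, P (l • p) := by
    induction hp using Submodule.span_induction with
    | mem x h =>
      obtain ⟨q, j, hj', rfl⟩ := h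
      intro l
      rw [← LinearMap.smul_comp]
      exact hj _ _ hj'
    | zero => intro l; rwa [smul_zero]
    | add x y _ _ hx hy => intro l; rw [smul_add]; exact hadd _ _ (hx l) (hy l)
    | smul a x _ hx => intro l; rw [← mul_smul]; exact hx _
  simpa using this 1

variable {F L K A X N M C : Type} [Field F] [Field L] [Algebra F L] [Field K] [Algebra F K]
  [Algebra L K] [IsScalarTower F L K] [Ring A] [Algebra F A]
  [AddCommGroup X] [Module F X] [Module A X] [IsScalarTower F A X]
  [AddCommGroup N] [Module F N] [Module L N] [Module A N]
  [IsScalarTower F L N] [IsScalarTower F A N] [SMulCommClass A L N]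
  [AddCommGroup M] [Module F M] [Module L M] [Module K M] [Module A M]
  [IsScalarTower F K M] [IsScalarTower L K M] [IsScalarTower F A M] [SMulCommClass A K M]
  [CommRing C] [Algebra F C] (π : Module.End A X →ₐ[F] C)

/-- scalar extension -/
noncomputable def up (F L K D : Type) [Field F] [Field L] [Algebra F L] [Field K] [Algebra F K]
    [Algebra L K] [IsScalarTower F L K] [Ring D] [Algebra F D] :
    L ⊗[F] D →ₐ[F] K ⊗[F] D :=
  Algebra.TensorProduct.map (IsScalarTower.toAlgHom F L K) (AlgHom.id F D)

lemma up_tmul {D : Type} [Ring D] [Algebra F D] (l : L) (d : D) :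
    up F L K D (l ⊗ₜ d) = (algebraMap L K l) ⊗ₜ d := by
  simp [up]

lemma up_inj {D : Type} [Ring D] [Algebra F D] : Function.Injective (up F L K D) := by
  have := Module.Flat.rTensor_preserves_injective_linearMap (M := D)
    (IsScalarTower.toAlgHom F L K).toLinearMap (IsScalarTower.toAlgHom F L K).toRingHom.injective
  intro x y h
  exact this h

lemma piL_up (g : L ⊗[F] Module.End A X) : piL π K (up F L K _ g) = up F L K C (piL π L g) := by
  induction g using TensorProduct.induction_on with
  | zero => simp
  | add z z' hz hz' => simp only [map_add, hz, hz']
  | tmul l γ => rw [up_tmul, piL_tmul, piL_tmul, up_tmul]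

/-- contraction along a functional -/
noncomputable def down (F : Type) {L K : Type} (D : Type) [Field F] [Field L] [Algebra F L]
    [Field K] [Algebra F K]
    [Algebra L K] [IsScalarTower F L K] [Ring D] [Algebra F D] (φ : K →ₗ[L] L) :
    K ⊗[F] D →ₗ[F] L ⊗[F] D :=
  LinearMap.rTensor D (φ.restrictScalars F)

lemma down_tmul {D : Type} [Ring D] [Algebra F D] (φ : K →ₗ[L] L) (k : K) (d : D) :
    down F D φ (k ⊗ₜ d) = φ k ⊗ₜ d := by
  simp [down]

lemma piL_down (φ : K →ₗ[L] L) (g : K ⊗[F] Module.End A X) :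
    piL π L (down F _ φ g) = down F C φ (piL π K g) := by
  induction g using TensorProduct.induction_on with
  | zero => simp
  | add z z' hz hz' => simp only [map_add, hz, hz']
  | tmul l γ => rw [down_tmul, piL_tmul, piL_tmul, down_tmul]

lemma down_mul_up (φ : K →ₗ[L] L) (z : K ⊗[F] C) (y : L ⊗[F] C) :
    down F C φ (z * up F L K C y) = down F C φ z * y := by
  induction z using TensorProduct.induction_on with
  | zero => simp
  | add z z' hz hz' => simp only [map_add, add_mul, hz, hz']
  | tmul k c =>
    induction y using TensorProduct.induction_on with
    | zero => simp
    | add z z' hz hz' => simp only [map_add, mul_add, hz, hz']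
    | tmul l c' =>
      rw [up_tmul, Algebra.TensorProduct.tmul_mul_tmul, down_tmul, down_tmul,
        Algebra.TensorProduct.tmul_mul_tmul, mul_comm k, ← Algebra.smul_def, map_smul,
        smul_eq_mul, mul_comm l]

lemma down_sep (z : K ⊗[F] C) (hz : ∀ φ : K →ₗ[L] L, down F C φ z = 0) : z = 0 := by
  obtain ⟨c, rfl⟩ := TensorProduct.eq_repr_basis_right (Module.Basis.ofVectorSpace F C) z
  have : ∀ i, c i = 0 := by
    intro i
    rw [← Module.forall_dual_apply_eq_zero_iff L]
    intro φ
    have h := hz φ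
    rw [Finsupp.sum, map_sum] at h
    simp only [down_tmul] at h
    have h2 := TensorProduct.sum_tmul_basis_right_eq_zero (Module.Basis.ofVectorSpace F C)
      (c.mapRange φ (map_zero φ)) (by
        rw [Finsupp.sum_mapRange_index (by simp), Finsupp.sum]; exact h)
    exact congrArg (fun f => f i) h2
  rw [Finsupp.sum]
  exact Finset.sum_eq_zero fun i _ => by rw [this, TensorProduct.zero_tmul]

variable (ι : N →ₗ[L] M) (hb : IsBaseChange K ι) (ιA : N →ₗ[A] M) (hι : ∀ x, ιA x = ι x)

include hb hι in
lemma exists_contract (φ : K →ₗ[L] L) : ∃ h : M →ₗ[A] N, (∀ (l : L) m, h (l • m) = l • h m) ∧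
    ∀ (k : K) n, h (k • ιA n) = φ k • n := by
  let h0 : M →ₗ[L] N := (TensorProduct.lid L N).toLinearMap ∘ₗ (LinearMap.rTensor N φ) ∘ₗ
    (hb.equiv.symm.toLinearMap.restrictScalars L)
  have h1 : ∀ (k : K) n, h0 (k • ιA n) = φ k • n := by
    intro k n
    have : hb.equiv.symm (k • ιA n) = k ⊗ₜ n := by
      rw [LinearEquiv.symm_apply_eq, IsBaseChange.equiv_tmul, hι]
    simp [h0, this]
  refine ⟨{ toFun := h0, map_add' := map_add h0, map_smul' := ?_ }, map_smul h0, h1⟩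
  intro a m
  obtain ⟨z, rfl⟩ := hb.equiv.surjective m
  induction z using TensorProduct.induction_on with
  | zero => simp
  | add z z' hz hz' => simp only [map_add, smul_add, hz, hz']
  | tmul k n =>
    rw [IsBaseChange.equiv_tmul, ← hι, smul_comm a k, ← map_smul, h1, h1, ← smul_comm a]
    rfl

include hb hι in
lemma hom_span [FiniteDimensional F X] (p : X →ₗ[A] M) :
    p ∈ Submodule.span K (Set.range fun q : X →ₗ[A] N => ιA ∘ₗ q) := by
  classical
  let B := Module.Basis.ofVectorSpace L K
  choose h hL h1 using fun i => exists_contract ι hb ιA hι (B.coord i)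
  have key : ∀ m : M, ∃ s : Finset _, ∀ s', s ⊆ s' → m = ∑ i ∈ s', B i • ιA (h i m) := by
    intro m
    obtain ⟨z, rfl⟩ := hb.equiv.surjective m
    induction z using TensorProduct.induction_on with
    | zero => exact ⟨∅, fun s' _ => by simp⟩
    | add z z' hz hz' =>
      obtain ⟨s, hs⟩ := hz
      obtain ⟨s', hs'⟩ := hz'
      refine ⟨s ∪ s', fun t ht => ?_⟩
      simp only [map_add, smul_add, Finset.sum_add_distrib]
      rw [← hs t (Finset.union_subset_left ht), ← hs' t (Finset.union_subset_right ht)]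
    | tmul k n =>
      refine ⟨(B.repr k).support, fun t ht => ?_⟩
      rw [IsBaseChange.equiv_tmul, ← hι]
      have : ∀ i ∈ t, B i • ιA (h i (k • ιA n)) = (B.repr k i • B i) • ιA n := by
        intro i _
        rw [h1, hι, map_smul, hι, smul_comm, smul_assoc]; rfl
      rw [Finset.sum_congr rfl this, ← Finset.sum_smul]
      congr 1
      conv_lhs => rw [← B.linearCombination_repr k, Finsupp.linearCombination_apply, Finsupp.sum]
      refine Finset.sum_subset ht fun i _ hi => ?_
      rw [Finsupp.notMem_support_iff] at hi
      rw [hi, zero_smul]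
  choose s hs using key
  let b := Module.finBasis F X
  let S := Finset.univ.biUnion fun i => s (p (b i))
  have hp : p = ∑ i ∈ S, B i • (ιA ∘ₗ (h i ∘ₗ p)) := by
    apply LinearMap.restrictScalars_injective F
    refine b.ext fun i => ?_
    simp only [LinearMap.restrictScalars_apply, LinearMap.sum_apply, LinearMap.smul_apply,
      LinearMap.comp_apply]
    exact hs (p (b i)) S (Finset.subset_biUnion_of_mem (fun i => s (p (b i))) (Finset.mem_univ i))
  rw [hp]
  exact Submodule.sum_mem _ fun i _ => Submodule.smul_mem _ _ (Submodule.subset_span ⟨_, rfl⟩)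

include hι in
lemma act_up (g : L ⊗[F] Module.End A X) (p : X →ₗ[A] N) :
    act F K A X M (up F L K _ g) (ιA ∘ₗ p) = ιA ∘ₗ act F L A X N g p := by
  induction g using TensorProduct.induction_on with
  | zero => simp
  | add z z' hz hz' => simp only [map_add, LinearMap.add_apply, hz, hz', LinearMap.comp_add]
  | tmul l γ =>
    rw [up_tmul, act_tmul, act_tmul]
    ext x
    simp [hι]

theorem Decomp.baseChange (hπ : Function.Surjective π) [FiniteDimensional F X]
    (hb : IsBaseChange K ι) (hι : ∀ x, ιA x = ι x)
    {n : ℕ} {ε : ℕ → L ⊗[F] C} {p : ℕ → (X →ₗ[A] N)} (hd : Decomp π n ε p) :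
    Decomp π n (fun k => up F L K C (ε k)) (fun k => ιA ∘ₗ p k) := by
  have hPJ : ∀ q ∈ PJ π L N, ιA ∘ₗ q ∈ PJ (X := X) π K M := by
    intro q hq
    refine PJ_induction π (fun q => ιA ∘ₗ q ∈ PJ π K M) ?_ ?_ ?_ q hq
    · simp
    · intro p q hp hq
      rw [LinearMap.comp_add]; exact add_mem hp hq
    · intro q j hj
      rw [← LinearMap.comp_assoc]
      exact Submodule.subset_span ⟨_, j, hj, rfl⟩
  refine ⟨?_, ?_, ?_, ?_, ?_, ?_⟩
  · intro k; rw [← map_mul, hd.idem]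
  · intro k; rw [← map_mul, hd.chain]
  · intro k hk; rw [hd.vanish k hk, map_zero]
  · intro k g hg
    obtain ⟨g', hg'⟩ := piL_surj (L := L) π hπ (ε k)
    have h1 := act_mem_PJ (N := M) π hπ (g - up F L K _ g')
      (by rw [map_sub, hg, piL_up, hg', sub_self]) (ιA ∘ₗ p k)
    have h2 := hPJ _ (hd.fix k g' hg')
    have := add_mem h1 h2
    rw [map_sub, LinearMap.sub_apply, act_up ι ιA hι, LinearMap.comp_sub, sub_add_sub_cancel] at this
    exact this
  · intro q
    have hq := hom_span (F := F) ι hb ιA hι q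
    induction hq using Submodule.span_induction with
    | mem x h =>
      obtain ⟨q, rfl⟩ := h
      obtain ⟨c, hc⟩ := hd.span q
      refine ⟨fun k => up F L K _ (c k), ?_⟩
      have := hPJ _ hc
      rw [LinearMap.comp_sub] at this
      convert this using 2
      ext x
      simp only [LinearMap.sum_apply, act_up ι ιA hι, LinearMap.comp_apply, map_sum]
    | zero => exact ⟨0, by simp⟩
    | add x y _ _ hx hy =>
      obtain ⟨c, hc⟩ := hx
      obtain ⟨c', hc'⟩ := hy
      refine ⟨c + c', ?_⟩
      have := add_mem hc hc'
      simp only [Pi.add_apply, map_add, LinearMap.add_apply, Finset.sum_add_distrib]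
      rwa [sub_add_sub_comm] at this
    | smul a x _ hx =>
      obtain ⟨c, hc⟩ := hx
      refine ⟨a • c, ?_⟩
      have := Submodule.smul_mem _ a hc
      simp only [Pi.smul_apply, map_smul, LinearMap.smul_apply]
      rwa [smul_sub, Finset.smul_sum] at this
  · intro c hc k hk
    apply down_sep (L := L)
    intro φ
    rw [down_mul_up, ← piL_down]
    refine hd.indep (fun k => down F _ φ (c k)) ?_ k hk
    obtain ⟨h, hL, h1⟩ := exists_contract ι hb ιA hι φ
    have h2 : ∀ (g : K ⊗[F] Module.End A X) (p : X →ₗ[A] N),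
        h ∘ₗ act F K A X M g (ιA ∘ₗ p) = act F L A X N (down F _ φ g) p := by
      intro g p
      induction g using TensorProduct.induction_on with
      | zero => ext x; simp
      | add z z' hz hz' => simp only [map_add, LinearMap.add_apply, hz, hz', LinearMap.comp_add]
      | tmul l γ =>
        rw [down_tmul, act_tmul, act_tmul]
        ext x
        simp [h1]
    have h3 : ∀ q ∈ PJ π K M, h ∘ₗ q ∈ PJ (X := X) π L N := by
      intro q hq
      refine PJ_induction π (fun q => h ∘ₗ q ∈ PJ π L N) ?_ ?_ ?_ q hq
      · simp
      · intro p q hp hq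
        rw [LinearMap.comp_add]; exact add_mem hp hq
      · intro q j hj
        rw [← LinearMap.comp_assoc]
        exact Submodule.subset_span ⟨_, j, hj, rfl⟩
    have h4 := h3 _ hc
    convert h4 using 1
    simp only [← h2]
    ext x
    simp

end PartF1

section PartD2

variable {F K A X Y M C : Type} [Field F] [Field K] [Algebra F K] [Ring A] [Algebra F A]
  [AddCommGroup X] [Module F X] [Module A X] [IsScalarTower F A X]
  [AddCommGroup Y] [Module K Y] [Module A Y] [SMulCommClass A K Y]
  [AddCommGroup M] [Module K M] [Module A M] [SMulCommClass A K M]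
  [CommRing C] [Algebra F C] (π : Module.End A X →ₐ[F] C) (n : ℕ)
  (hJ : (LinearMap.ker π.toLinearMap : Submodule F (Module.End A X)) ^ n = ⊥)

include hJ in
lemma nakayama1 (Q : AddSubgroup (X →ₗ[A] M))
    (hQ : ∀ q ∈ Q, ∀ γ : Module.End A X, q ∘ₗ γ ∈ Q)
    (h : ∀ p, ∃ q ∈ Q, p - q ∈ PJ π K M) (p : X →ₗ[A] M) : p ∈ Q := by
  have key : ∀ m, m ≤ n → ∀ j ∈ (LinearMap.ker π.toLinearMap : Submodule F (Module.End A X)) ^ (n - m),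
      ∀ p : X →ₗ[A] M, p ∘ₗ j ∈ Q := by
    intro m
    induction m with
    | zero =>
      intro _ j hj p
      rw [Nat.sub_zero, hJ, Submodule.mem_bot] at hj
      rw [hj, LinearMap.comp_zero]; exact zero_mem _
    | succ m ih =>
      intro hm j hj p
      obtain ⟨q, hq, hpq⟩ := h p
      have h1 : (p - q) ∘ₗ j ∈ Q := by
        refine PJ_induction π (fun r => r ∘ₗ j ∈ Q) ?_ ?_ ?_ _ hpq
        · rw [LinearMap.zero_comp]; exact zero_mem _
        · intro a b ha hb
          rw [LinearMap.add_comp]; exact add_mem ha hb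
        · intro q j' hj'
          rw [LinearMap.comp_assoc]
          refine ih (by omega) (j' * j) ?_ q
          have : n - m = (n - (m + 1)) + 1 := by omega
          rw [this, pow_succ']
          exact Submodule.mul_mem_mul hj' hj
      have h2 := add_mem h1 (hQ q hq j)
      rwa [← LinearMap.add_comp, sub_add_cancel] at h2
  have := key n le_rfl 1 (by rw [Nat.sub_self, pow_zero]; exact Submodule.one_le.mp le_rfl) p
  exact this

include hJ in
lemma nakayama2 (Q : AddSubgroup (X →ₗ[A] Y))
    (h : ∀ q ∈ Q, q ∈ AddSubgroup.closure
      {g | ∃ h ∈ Q, ∃ j : Module.End A X, π j = 0 ∧ g = h ∘ₗ j}) (q : X →ₗ[A] Y) (hq : q ∈ Q) :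
    q = 0 := by
  have key : ∀ m, m ≤ n → ∀ j ∈ (LinearMap.ker π.toLinearMap : Submodule F (Module.End A X)) ^ (n - m),
      ∀ q ∈ Q, q ∘ₗ j = 0 := by
    intro m
    induction m with
    | zero =>
      intro _ j hj p _
      rw [Nat.sub_zero, hJ, Submodule.mem_bot] at hj
      rw [hj, LinearMap.comp_zero]
    | succ m ih =>
      intro hm j hj q hq
      have h1 := h q hq
      clear hq
      induction h1 using AddSubgroup.closure_induction with
      | mem x hx =>
        obtain ⟨h', hh', j', hj', rfl⟩ := hx
        rw [LinearMap.comp_assoc]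
        refine ih (by omega) (j' * j) ?_ h' hh'
        have : n - m = (n - (m + 1)) + 1 := by omega
        rw [this, pow_succ']
        exact Submodule.mul_mem_mul hj' hj
      | zero => rw [LinearMap.zero_comp]
      | add a b _ _ ha hb => rw [LinearMap.add_comp, ha, hb, add_zero]
      | neg a _ ha => rw [LinearMap.neg_comp, ha, neg_zero]
  exact key n le_rfl 1 (by rw [Nat.sub_self, pow_zero]; exact Submodule.one_le.mp le_rfl) q hq

lemma PJ_repr (p : X →ₗ[A] Y) (hp : p ∈ PJ π K Y) :
    ∃ (T : Type) (_ : Fintype T) (h : T → (X →ₗ[A] Y)) (j : T → Module.End A X),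
      (∀ t, π (j t) = 0) ∧ p = ∑ t, h t ∘ₗ j t := by
  refine PJ_induction π (fun p => ∃ (T : Type) (_ : Fintype T) (h : T → (X →ₗ[A] Y))
    (j : T → Module.End A X), (∀ t, π (j t) = 0) ∧ p = ∑ t, h t ∘ₗ j t) ?_ ?_ ?_ p hp
  · exact ⟨Empty, inferInstance, Empty.elim, Empty.elim, fun t => t.elim, by simp⟩
  · rintro p q ⟨T, _, h, j, hj, rfl⟩ ⟨T', _, h', j', hj', rfl⟩
    refine ⟨T ⊕ T', inferInstance, Sum.elim h h', Sum.elim j j', ?_, ?_⟩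
    · rintro (t | t)
      · exact hj t
      · exact hj' t
    · simp
  · intro q j hj
    exact ⟨Unit, inferInstance, fun _ => q, fun _ => j, fun _ => hj, by simp⟩

lemma exists_coker {F A X P M : Type} [Field F] [Ring A] [Algebra F A]
    [AddCommGroup X] [Module A X] [AddCommGroup P] [Module F P] [Module A P] [IsScalarTower F A P]
    [FiniteDimensional F P] [AddCommGroup M] [Module A M] (Jm : X →ₗ[A] P) (g : P →ₗ[A] M)
    (hg : ∀ x, g (Jm x) = 0) :
    ∃ (Z : Type) (_ : AddCommGroup Z) (_ : Module F Z)
        (_ : Module A Z) (_ : IsScalarTower F A Z) (_ : FiniteDimensional F Z)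
        (mk : P →ₗ[A] Z) (φ : Z →ₗ[A] M), (∀ v, φ (mk v) = g v) ∧ ∀ x, mk (Jm x) = 0 := by
  refine ⟨P ⧸ LinearMap.range Jm, inferInstance, inferInstance, inferInstance,
    inferInstance, ?_, (LinearMap.range Jm).mkQ,
    (LinearMap.range Jm).liftQ g ?_, fun v => rfl, ?_⟩
  · let q : P →ₗ[F] (P ⧸ LinearMap.range Jm) :=
      { toFun := Submodule.Quotient.mk
        map_add' := fun _ _ => rfl
        map_smul' := fun _ _ => rfl }
    exact Module.Finite.of_surjective q (Submodule.Quotient.mk_surjective _)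
  · rintro _ ⟨x, rfl⟩
    exact hg x
  · intro x
    rw [Submodule.mkQ_apply, Submodule.Quotient.mk_eq_zero]; exact ⟨x, rfl⟩

include hJ in
theorem key_lemma [FiniteDimensional F X] (hG : Gens F A X) [FiniteDimensional F A]
    (f : Y →ₗ[A] M) (θ : Y →ₗ[A] Y) (hθ : ∀ y, θ (θ y) = θ y) (hfθ : ∀ y, f (θ y) = f y)
    (H1 : ∀ p : X →ₗ[A] M, ∃ v : X →ₗ[A] Y, f ∘ₗ v = p)
    (H2 : ∀ g : X →ₗ[A] Y, f ∘ₗ g = 0 → θ ∘ₗ g = g → g ∈ PJ π K Y) :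
    Function.Surjective f ∧ ∀ y, θ y = y → f y = 0 → y = 0 := by
  classical
  let Q : AddSubgroup (X →ₗ[A] Y) :=
    { carrier := {g | f ∘ₗ g = 0 ∧ θ ∘ₗ g = g}
      zero_mem' := by constructor <;> simp
      add_mem' := by
        rintro a b ⟨h1, h2⟩ ⟨h3, h4⟩
        constructor
        · rw [LinearMap.comp_add, h1, h3, add_zero]
        · rw [LinearMap.comp_add, h2, h4]
      neg_mem' := by
        rintro a ⟨h1, h2⟩
        constructor
        · rw [LinearMap.comp_neg, h1, neg_zero]
        · rw [LinearMap.comp_neg, h2] }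
  have H1' : ∀ p : X →ₗ[A] M, ∃ v : X →ₗ[A] Y, f ∘ₗ v = p ∧ θ ∘ₗ v = v := by
    intro p
    obtain ⟨v, hv⟩ := H1 p
    refine ⟨θ ∘ₗ v, ?_, ?_⟩
    · rw [← hv]; ext x; simp [hfθ]
    · ext x; simp [hθ]
  have hQ : ∀ q ∈ Q, q = 0 := by
    refine nakayama2 π n hJ Q ?_
    rintro g ⟨hg1, hg2⟩
    obtain ⟨T, _, h, j, hj, hg⟩ := PJ_repr π g (H2 g hg1 hg2)
    let Jm : X →ₗ[A] (T → X) := LinearMap.pi j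
    let H : (T → X) →ₗ[A] Y := ∑ t, (θ ∘ₗ h t) ∘ₗ LinearMap.proj t
    have hH : ∀ x, H (Jm x) = g x := by
      intro x
      rw [← hg2]
      conv_rhs => rw [hg]
      simp [H, Jm]
    have hHθ : ∀ v, θ (H v) = H v := by
      intro v
      simp [H, hθ]
    obtain ⟨Z, _, _, _, _, _, mk, φ, hφ, hmk⟩ : ∃ (Z : Type) (_ : AddCommGroup Z) (_ : Module F Z)
        (_ : Module A Z) (_ : IsScalarTower F A Z) (_ : FiniteDimensional F Z)
        (mk : (T → X) →ₗ[A] Z) (φ : Z →ₗ[A] M), (∀ v, φ (mk v) = f (H v)) ∧ ∀ x, mk (Jm x) = 0 := by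
      refine exists_coker (F := F) Jm (f ∘ₗ H) ?_
      intro x
      rw [LinearMap.comp_apply, hH]
      exact congrArg (fun f => f x) hg1
    obtain ⟨T', _, i, r, hir⟩ := hG Z
    choose v hv1 hv2 using fun t => H1' (φ ∘ₗ r t)
    let H' : (T → X) →ₗ[A] Y := H - ∑ t, v t ∘ₗ i t ∘ₗ mk
    have h1 : ∀ x, f (H' x) = 0 := by
      intro x
      have h3 : ∀ t, f (v t (i t (mk x))) =
          φ (r t (i t (mk x))) :=
        fun t => congrArg (fun q => q (i t (mk x))) (hv1 t)
      simp only [H', LinearMap.sub_apply, LinearMap.sum_apply, LinearMap.comp_apply, map_sub,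
        map_sum, h3]
      rw [← map_sum]
      have h4 : ∑ t, r t (i t (mk x)) = mk x := by
        have := congrArg (fun q => q (mk x)) hir
        simpa only [LinearMap.sum_apply, LinearMap.comp_apply, LinearMap.id_apply] using this
      rw [h4, hφ, sub_self]
    have h2 : ∀ x, θ (H' x) = H' x := by
      intro x
      have h3 : ∀ t, θ (v t (i t (mk x))) =
          v t (i t (mk x)) :=
        fun t => congrArg (fun q => q (i t (mk x))) (hv2 t)
      simp only [H', LinearMap.sub_apply, LinearMap.sum_apply, LinearMap.comp_apply, map_sub,
        map_sum, h3, hHθ]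
    have h5 : ∀ x, H' (Jm x) = g x := by
      intro x
      have := hmk x
      simp only [H', LinearMap.sub_apply, LinearMap.sum_apply, LinearMap.comp_apply, this, map_zero,
        Finset.sum_const_zero, sub_zero, hH]
    have h6 : g = ∑ t, (H' ∘ₗ LinearMap.single A (fun _ : T => X) t) ∘ₗ j t := by
      ext x
      rw [← h5]
      simp only [LinearMap.sum_apply, LinearMap.comp_apply, LinearMap.coe_single]
      rw [← map_sum]
      congr 1
      ext t
      simp [Jm, Finset.sum_apply]
    rw [h6]
    refine AddSubgroup.sum_mem _ fun t _ => AddSubgroup.subset_closure ⟨_, ⟨?_, ?_⟩, j t, hj t, rfl⟩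
    · ext x; exact h1 _
    · ext x; exact h2 _
  obtain ⟨T, _, i, r, hir⟩ := hG A
  have h1 : ∑ t, r t (i t 1) = 1 := by
    have := congrArg (fun q => q (1 : A)) hir
    simpa only [LinearMap.sum_apply, LinearMap.comp_apply, LinearMap.id_apply] using this
  constructor
  · intro m
    choose v hv using fun t => H1 (LinearMap.toSpanSingleton A M m ∘ₗ r t)
    refine ⟨∑ t, v t (i t 1), ?_⟩
    rw [map_sum]
    have h3 : ∀ t, f (v t (i t 1)) = LinearMap.toSpanSingleton A M m (r t (i t 1)) :=
      fun t => congrArg (fun q => q (i t 1)) (hv t)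
    simp only [h3]
    rw [← map_sum, h1, LinearMap.toSpanSingleton_apply, one_smul]
  · intro y hy1 hy2
    have h3 : ∀ t, LinearMap.toSpanSingleton A Y y ∘ₗ r t = 0 := by
      intro t
      apply hQ
      constructor
      · ext x; simp [hy2]
      · ext x; simp [hy1]
    have h4 : y = LinearMap.toSpanSingleton A Y y (∑ t, r t (i t 1)) := by
      rw [h1, LinearMap.toSpanSingleton_apply, one_smul]
    rw [h4, map_sum]
    exact Finset.sum_eq_zero fun t _ => congrArg (fun q => q (i t 1)) (h3 t)

end PartD2

section PartE1

theorem descent {L K Y0 Y M : Type} [Field L] [Field K] [Algebra L K]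
    [AddCommGroup Y0] [Module L Y0] [AddCommGroup Y] [Module L Y] [Module K Y] [IsScalarTower L K Y]
    [AddCommGroup M] [Module L M] [Module K M] [IsScalarTower L K M]
    (j : Y0 →ₗ[L] Y) (hj : IsBaseChange K j) (θ0 : Y0 → Y0) (θ : Y →ₗ[K] Y)
    (hθj : ∀ x, θ (j x) = j (θ0 x)) (hθ : ∀ y, θ (θ y) = θ y)
    (f : Y →ₗ[K] M) (hf : Function.Surjective f) (hfθ : ∀ y, f (θ y) = f y)
    (hinj : ∀ y, θ y = y → f y = 0 → y = 0) :
    IsBaseChange K (LinearMap.range ((f.restrictScalars L) ∘ₗ j)).subtype := by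
  apply IsBaseChange.of_lift_unique
  intro Q _ _ _ _ g
  let r : Y0 →ₗ[L] LinearMap.range ((f.restrictScalars L) ∘ₗ j) :=
    LinearMap.rangeRestrict _
  let G : Y →ₗ[K] Q := hj.lift (g ∘ₗ r)
  have hG : ∀ x, G (j x) = g (r x) := fun x => hj.lift_eq _ x
  have hr : ∀ x, r (θ0 x) = r x := by
    intro x
    apply Subtype.ext
    show f (j (θ0 x)) = f (j x)
    rw [← hθj, hfθ]
  have hGθ : G ∘ₗ θ = G := by
    apply hj.algHom_ext
    intro x
    rw [LinearMap.comp_apply, hθj, hG, hG, hr]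
  have hker : ∀ y, f y = 0 → G y = 0 := by
    intro y hy
    have : θ y = 0 := hinj _ (hθ y) (by rw [hfθ, hy])
    rw [← hGθ, LinearMap.comp_apply, this, map_zero]
  have hfac : ∀ y y', f y = f y' → G y = G y' := by
    intro y y' h
    have h1 : G (y - y') = 0 := hker _ (by rw [map_sub, h, sub_self])
    rw [← sub_add_cancel y y', map_add, h1, zero_add]
  choose s hs using hf
  refine ⟨{ toFun := fun m => G (s m), map_add' := ?_, map_smul' := ?_ }, ?_, ?_⟩
  · intro m m'
    rw [← map_add]
    exact hfac _ _ (by rw [map_add, hs, hs, hs])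
  · intro k m
    rw [← map_smul]
    exact hfac _ _ (by rw [map_smul, hs, hs]; rfl)
  · ext x
    obtain ⟨_, y, rfl⟩ := x
    show G (s (f (j y))) = g (r y)
    rw [← hG]
    exact hfac _ _ (hs _)
  · intro h hh
    have h1 : h ∘ₗ f = G := by
      apply hj.algHom_ext
      intro x
      rw [hG, ← hh]; rfl
    ext m
    show h m = G (s m)
    rw [← h1, LinearMap.comp_apply, hs]

lemma exists_XL (F L A X : Type) [Field F] [Field L] [Algebra F L] [Ring A] [Algebra F A]
    [AddCommGroup X] [Module F X] [Module A X] [IsScalarTower F A X] :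
    ∃ (XL : Type) (_ : AddCommGroup XL) (_ : Module F XL) (_ : Module L XL) (_ : Module A XL)
      (_ : IsScalarTower F L XL) (_ : IsScalarTower F A XL) (_ : SMulCommClass A L XL)
      (u : X →ₗ[A] XL), IsBaseChange L (u.restrictScalars F) := by
  let ρ : A →ₐ[F] Module.End L (L ⊗[F] X) :=
    (Module.End.baseChangeHom F L X).comp (Algebra.lsmul F F X)
  let iA : Module A (L ⊗[F] X) := Module.compHom _ ρ.toRingHom
  have hsm : ∀ (a : A) (y : L ⊗[F] X), a • y = ρ a y := fun _ _ => rfl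
  have h1 : ∀ (a : A) (l : L) (x : X), a • (l ⊗ₜ[F] x) = l ⊗ₜ[F] (a • x) := by
    intro a l x
    rw [hsm]
    show LinearMap.baseChange L (Algebra.lsmul F F X a) (l ⊗ₜ[F] x) = _
    rw [LinearMap.baseChange_tmul]; rfl
  have t1 : IsScalarTower F A (L ⊗[F] X) := ⟨fun c a y => by
    rw [hsm, hsm, map_smul]; rfl⟩
  have t2 : SMulCommClass A L (L ⊗[F] X) := ⟨fun a l y => by
    rw [hsm, hsm, map_smul]⟩
  let u : X →ₗ[A] L ⊗[F] X :=
    { toFun := fun x => 1 ⊗ₜ x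
      map_add' := fun x y => TensorProduct.tmul_add _ _ _
      map_smul' := fun a x => (h1 a 1 x).symm }
  exact ⟨L ⊗[F] X, inferInstance, inferInstance, inferInstance, iA, inferInstance, t1, t2, u,
    TensorProduct.isBaseChange F X L⟩

variable {F L A X XL N : Type} [Field F] [Field L] [Algebra F L] [Ring A] [Algebra F A]
  [AddCommGroup X] [Module F X] [Module A X] [IsScalarTower F A X]
  [AddCommGroup XL] [Module F XL] [Module L XL] [Module A XL]
  [IsScalarTower F L XL] [IsScalarTower F A XL] [SMulCommClass A L XL]
  [AddCommGroup N] [Module F N] [Module L N] [Module A N]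
  [IsScalarTower F L N] [IsScalarTower F A N] [SMulCommClass A L N]

/-- extension of a homomorphism -/
lemma exists_tilde (u : X →ₗ[A] XL) (hu : IsBaseChange L (u.restrictScalars F)) :
    ∃ tA : (X →ₗ[A] N) → (XL →ₗ[A] N), (∀ p (l : L) y, tA p (l • y) = l • tA p y) ∧
      ∀ p x, tA p (u x) = p x := by
  have : ∀ p : X →ₗ[A] N, ∃ t : XL →ₗ[A] N, (∀ (l : L) y, t (l • y) = l • t y) ∧
      ∀ x, t (u x) = p x := by
    intro p
    let t := hu.lift (p.restrictScalars F)
    have ht : ∀ x, t (u x) = p x := fun x => hu.lift_eq _ x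
    refine ⟨{ toFun := t, map_add' := map_add t, map_smul' := ?_ }, map_smul t, ht⟩
    intro a y
    refine hu.inductionOn y (fun y => t (a • y) = a • t y) (by simp) ?_ ?_ ?_
    · intro x
      show t (a • u x) = a • t (u x)
      rw [← map_smul, ht, ht, map_smul]
    · intro l y h
      rw [smul_comm a l y, t.map_smul, t.map_smul, h, ← smul_comm a l]
    · intro y y' h h'
      rw [smul_add, map_add, map_add, smul_add, h, h']
  choose tA h1 h2 using this
  exact ⟨tA, h1, h2⟩

lemma tilde_act (u : X →ₗ[A] XL) (t : XL →ₗ[A] N) (p : X →ₗ[A] N)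
    (ht : ∀ (l : L) y, t (l • y) = l • t y) (htp : ∀ x, t (u x) = p x)
    (c : L ⊗[F] Module.End A X) : t ∘ₗ act F L A X XL c u = act F L A X N c p := by
  induction c using TensorProduct.induction_on with
  | zero => ext x; simp
  | add z z' hz hz' => simp only [map_add, LinearMap.add_apply, hz, hz', LinearMap.comp_add]
  | tmul l γ =>
    rw [act_tmul, act_tmul]
    ext x
    simp [ht, htp]

lemma exists_act_eq [FiniteDimensional F X] (u : X →ₗ[A] XL)
    (hu : IsBaseChange L (u.restrictScalars F)) (q : X →ₗ[A] XL) :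
    ∃ c, q = act F L A X XL c u := by
  have hq := hom_span (F := F) (L := F) (K := L) (u.restrictScalars F) hu u (fun _ => rfl) q
  induction hq using Submodule.span_induction with
  | mem x h =>
    obtain ⟨γ, rfl⟩ := h
    exact ⟨1 ⊗ₜ γ, by rw [act_tmul, one_smul]⟩
  | zero => exact ⟨0, by simp⟩
  | add x y _ _ hx hy =>
    obtain ⟨c, rfl⟩ := hx
    obtain ⟨c', rfl⟩ := hy
    exact ⟨c + c', by rw [map_add]; rfl⟩
  | smul a x _ hx =>
    obtain ⟨c, rfl⟩ := hx
    exact ⟨a • c, by rw [map_smul]; rfl⟩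

lemma ext_u (u : X →ₗ[A] XL) (hu : IsBaseChange L (u.restrictScalars F))
    (t t' : XL →ₗ[A] N) (ht : ∀ (l : L) y, t (l • y) = l • t y)
    (ht' : ∀ (l : L) y, t' (l • y) = l • t' y) (h : ∀ x, t (u x) = t' (u x)) : t = t' := by
  ext y
  refine hu.inductionOn y (fun y => t y = t' y) (by simp) h ?_ ?_
  · intro l y h
    rw [ht, ht', h]
  · intro y y' h h'
    rw [map_add, map_add, h, h']

end PartE1

section PartE2

variable {F L K A X M C : Type} [Field F] [Field L] [Algebra F L] [Field K] [Algebra F K]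
  [Algebra L K] [IsScalarTower F L K] [Ring A] [Algebra F A]
  [AddCommGroup X] [Module F X] [Module A X] [IsScalarTower F A X]
  [AddCommGroup M] [Module F M] [Module L M] [Module K M] [Module A M]
  [IsScalarTower F K M] [IsScalarTower L K M] [IsScalarTower F A M] [SMulCommClass A K M]
  [CommRing C] [Algebra F C] (π : Module.End A X →ₐ[F] C)

/-- `M` is `f` of a summand of `Y = (X_K) ^ n`. -/
theorem key_decomp (hπ : Function.Surjective π) [FiniteDimensional F X] [FiniteDimensional F A]
    (hG : Gens F A X) (m : ℕ)
    (hJ : (LinearMap.ker π.toLinearMap : Submodule F (Module.End A X)) ^ m = ⊥)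
    {n : ℕ} {ε : ℕ → K ⊗[F] C} {p : ℕ → (X →ₗ[A] M)} (hd : Decomp π n ε p)
    (γ : ℕ → K ⊗[F] Module.End A X) (hγ : ∀ k, γ k * γ k = γ k) (hγε : ∀ k, piL π K (γ k) = ε k)
    {XK : Type} [AddCommGroup XK] [Module F XK] [Module K XK] [Module A XK]
    [IsScalarTower F K XK] [IsScalarTower F A XK] [SMulCommClass A K XK]
    (u : X →ₗ[A] XK) (hu : IsBaseChange K (u.restrictScalars F))
    (T : ℕ → (XK →ₗ[A] XK)) (hTK : ∀ k (l : K) y, T k (l • y) = l • T k y)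
    (hT : ∀ k x, T k (u x) = act F K A X XK (γ k) u x) :
    ∃ f : (Fin n → XK) →ₗ[A] M, (∀ (l : K) y, f (l • y) = l • f y) ∧
      Function.Surjective f ∧ (∀ y, f (fun k => T k (y k)) = f y) ∧
      ∀ y : Fin n → XK, (fun k : Fin n => T k (y k)) = y → f y = 0 → y = 0 := by
  obtain ⟨tA, htK, htu⟩ := exists_tilde (N := M) u hu
  let p' : ℕ → (X →ₗ[A] M) := fun k => act F K A X M (γ k) (p k)
  have hp' : ∀ k, p' k - p k ∈ PJ π K M := fun k => hd.fix k (γ k) (hγε k)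
  have hγp' : ∀ k, act F K A X M (γ k) (p' k) = p' k := by
    intro k
    simp only [p']
    rw [← act_mul, hγ]
  have R1 : ∀ (q : X →ₗ[A] M) c, tA q ∘ₗ act F K A X XK c u = act F K A X M c q :=
    fun q c => tilde_act u (tA q) q (htK q) (htu q) c
  have R2 : ∀ k c, T k ∘ₗ act F K A X XK c u = act F K A X XK (γ k * c) u := by
    intro k c
    rw [act_mul]
    exact tilde_act u (T k) _ (hTK k) (hT k) c
  have hTT : ∀ k y, T k (T k y) = T k y := by
    intro k y
    have : T k ∘ₗ T k = T k := by
      refine ext_u (F := F) (L := K) u hu _ _ ?_ (hTK k) ?_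
      · intro l y
        rw [LinearMap.comp_apply, LinearMap.comp_apply, hTK, hTK]
      · intro x
        rw [LinearMap.comp_apply, hT]
        have := congrArg (fun q => q x) (R2 k (γ k))
        rw [hγ] at this
        exact this
    exact congrArg (fun q => q y) this
  have htT : ∀ k y, tA (p' k) (T k y) = tA (p' k) y := by
    intro k y
    have : tA (p' k) ∘ₗ T k = tA (p' k) := by
      refine ext_u (F := F) (L := K) u hu _ _ ?_ (htK _) ?_
      · intro l y
        rw [LinearMap.comp_apply, LinearMap.comp_apply, hTK, htK]
      · intro x
        rw [LinearMap.comp_apply, hT]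
        have := congrArg (fun q => q x) (R1 (p' k) (γ k))
        rw [hγp'] at this
        rw [htu]
        exact this
    exact congrArg (fun q => q y) this
  let f : (Fin n → XK) →ₗ[A] M := ∑ k : Fin n, tA (p' k) ∘ₗ LinearMap.proj k
  have hf : ∀ y, f y = ∑ k : Fin n, tA (p' k) (y k) := by
    intro y; simp [f]
  let θ : (Fin n → XK) →ₗ[A] (Fin n → XK) := LinearMap.pi fun k => T k ∘ₗ LinearMap.proj k
  have hθ : ∀ y, θ y = fun k : Fin n => T k (y k) := fun y => rfl
  have hfθ : ∀ y, f (θ y) = f y := by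
    intro y
    rw [hf, hf]
    exact Finset.sum_congr rfl fun k _ => htT k _
  have hfcomp : ∀ c : ℕ → K ⊗[F] Module.End A X,
      f ∘ₗ LinearMap.pi (fun k : Fin n => act F K A X XK (c k) u) =
        ∑ k ∈ Finset.range n, act F K A X M (c k) (p' k) := by
    intro c
    rw [← Fin.sum_univ_eq_sum_range (fun k => act F K A X M (c k) (p' k))]
    ext x
    rw [LinearMap.comp_apply, hf, LinearMap.sum_apply]
    refine Finset.sum_congr rfl fun k _ => ?_
    exact congrArg (fun q => q x) (R1 (p' k) (c k))
  have H1 : ∀ q : X →ₗ[A] M, ∃ v : X →ₗ[A] (Fin n → XK), f ∘ₗ v = q := by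
    let Q : AddSubgroup (X →ₗ[A] M) :=
      { carrier := {q | ∃ v : X →ₗ[A] (Fin n → XK), f ∘ₗ v = q}
        zero_mem' := ⟨0, by simp⟩
        add_mem' := by
          rintro a b ⟨v, rfl⟩ ⟨w, rfl⟩
          exact ⟨v + w, by rw [LinearMap.comp_add]⟩
        neg_mem' := by
          rintro a ⟨v, rfl⟩
          exact ⟨-v, by rw [LinearMap.comp_neg]⟩ }
    refine nakayama1 (K := K) π m hJ Q ?_ ?_
    · rintro q ⟨v, rfl⟩ γ
      exact ⟨v ∘ₗ γ, by rw [LinearMap.comp_assoc]⟩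
    · intro q
      obtain ⟨c, hc⟩ := hd.span q
      refine ⟨_, ⟨_, hfcomp c⟩, ?_⟩
      have h1 : ∑ k ∈ Finset.range n, act F K A X M (c k) (p' k - p k) ∈ PJ π K M :=
        Submodule.sum_mem _ fun k _ => act_PJ π _ _ (hp' k)
      have h2 := sub_mem hc h1
      simp only [map_sub, Finset.sum_sub_distrib] at h2
      convert h2 using 1
      abel
  have H2 : ∀ g : X →ₗ[A] (Fin n → XK), f ∘ₗ g = 0 → θ ∘ₗ g = g → g ∈ PJ π K (Fin n → XK) := by
    intro g hg1 hg2
    have h1 : ∀ k : ℕ, ∃ c : K ⊗[F] Module.End A X, ∀ h : k < n,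
        LinearMap.proj (R := A) (φ := fun _ : Fin n => XK) ⟨k, h⟩ ∘ₗ g = act F K A X XK c u := by
      intro k
      by_cases h : k < n
      · obtain ⟨c, hc⟩ := exists_act_eq u hu
          (LinearMap.proj (R := A) (φ := fun _ : Fin n => XK) ⟨k, h⟩ ∘ₗ g)
        exact ⟨c, fun _ => hc⟩
      · exact ⟨0, fun h' => absurd h' h⟩
    choose c hc using h1
    have hg3 : g = LinearMap.pi (fun k : Fin n => act F K A X XK (c k) u) := by
      ext x k
      exact congrArg (fun q => q x) (hc k k.2)
    have hcom : ∀ k : Fin n, LinearMap.proj (R := A) (φ := fun _ : Fin n => XK) k ∘ₗ g =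
        act F K A X XK (γ k * c k) u := by
      intro k
      rw [← R2, ← hc k k.2]
      conv_lhs => rw [← hg2]
      rfl
    have h2 : ∑ k ∈ Finset.range n, act F K A X M (γ k * c k) (p k) = 0 := by
      rw [← hg1, hg3, hfcomp]
      exact Finset.sum_congr rfl fun k _ => act_mul _ _ _
    have h3 := hd.indep (fun k => γ k * c k) (by rw [h2]; exact zero_mem _)
    have h4 : ∀ k : Fin n, LinearMap.proj (R := A) (φ := fun _ : Fin n => XK) k ∘ₗ g ∈
        PJ π K XK := by
      intro k
      rw [hcom]
      apply act_mem_PJ π hπ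
      have h5 := h3 k k.2
      rw [map_mul, hγε] at h5 ⊢
      rw [← hd.idem k, ← h5]
      ring
    have h6 : g = ∑ k : Fin n, LinearMap.single A (fun _ : Fin n => XK) k ∘ₗ
        (LinearMap.proj (R := A) (φ := fun _ : Fin n => XK) k ∘ₗ g) := by
      ext x i
      simp [Finset.sum_apply, Pi.single_apply]
    rw [h6]
    refine Submodule.sum_mem _ fun k _ => ?_
    refine PJ_induction π (fun q => LinearMap.single A (fun _ : Fin n => XK) k ∘ₗ q ∈
      PJ π K (Fin n → XK)) ?_ ?_ ?_ _ (h4 k)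
    · simp
    · intro p q hp hq
      rw [LinearMap.comp_add]; exact add_mem hp hq
    · intro q j hj
      rw [← LinearMap.comp_assoc]
      exact Submodule.subset_span ⟨_, j, hj, rfl⟩
  obtain ⟨hs, hi⟩ := key_lemma (K := K) π m hJ hG f θ
    (fun y => by ext k; exact hTT k _) hfθ H1 H2
  refine ⟨f, ?_, hs, hfθ, hi⟩
  intro l y
  rw [hf, hf, Finset.smul_sum]
  exact Finset.sum_congr rfl fun k _ => htK _ _ _

theorem descends_of_decomp (hπ : Function.Surjective π) [FiniteDimensional F X]
    [FiniteDimensional F A] (hG : Gens F A X) (m : ℕ)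
    (hJ : (LinearMap.ker π.toLinearMap : Submodule F (Module.End A X)) ^ m = ⊥)
    {n : ℕ} {ε : ℕ → K ⊗[F] C} {p : ℕ → (X →ₗ[A] M)} (hd : Decomp π n ε p)
    (ε0 : ℕ → L ⊗[F] C) (hε : ∀ k, up F L K C (ε0 k) = ε k) :
    ∃ N : Submodule L M, (∀ (a : A) (x : M), x ∈ N → a • x ∈ N) ∧
      IsBaseChange K N.subtype := by
  have hε0 : ∀ k, ε0 k * ε0 k = ε0 k := fun k => up_inj (K := K) (by rw [map_mul, hε, hd.idem])
  have hlift : ∀ k, ∃ γ : L ⊗[F] Module.End A X, γ * γ = γ ∧ piL π L γ = ε0 k := by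
    intro k
    obtain ⟨e, he, he'⟩ := exists_isIdempotentElem_eq_of_ker_isNilpotent (piL π L).toRingHom
      (fun x hx => ⟨m, piL_nil π hπ m hJ x hx⟩) (ε0 k)
      (by obtain ⟨g, hg⟩ := piL_surj (L := L) π hπ (ε0 k); exact ⟨g, hg⟩) (hε0 k)
    exact ⟨e, he, he'⟩
  choose γ hγ hγε using hlift
  obtain ⟨XL, _, _, _, _, _, _, _, v, hv⟩ := exists_XL F L A X
  obtain ⟨XK, _, _, _, _, _, _, _, u, hu⟩ := exists_XL F K A X
  let iL : Module L XK := Module.compHom XK (algebraMap L K)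
  have hiL : ∀ (l : L) (y : XK), l • y = (algebraMap L K l) • y := fun _ _ => rfl
  have t1 : IsScalarTower L K XK := ⟨fun l k y => by
    rw [hiL, Algebra.smul_def, mul_smul]⟩
  have t2 : IsScalarTower F L XK := ⟨fun c l y => by
    rw [hiL, hiL, ← algebraMap_smul K c (_ : XK), Algebra.smul_def, map_mul, mul_smul,
      ← IsScalarTower.algebraMap_apply]⟩
  have t3 : SMulCommClass A L XK := ⟨fun a l y => by rw [hiL, hiL, smul_comm]⟩
  obtain ⟨b', hb'L, hb'⟩ := exists_tilde (N := XK) v hv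
  let b : XL →ₗ[L] XK := { toFun := b' u, map_add' := map_add _, map_smul' := hb'L u }
  have hbv : ∀ x, b (v x) = u x := hb' u
  have hbB : IsBaseChange K b := by
    refine IsBaseChange.of_comp (R := F) hv ?_
    convert hu using 1
    ext x
    exact hbv x
  obtain ⟨TL, hTL, hTLv⟩ := exists_tilde (N := XL) v hv
  obtain ⟨TK, hTK, hTKu⟩ := exists_tilde (N := XK) u hu
  let S : ℕ → (XL →ₗ[A] XL) := fun k => TL (act F L A X XL (γ k) v)
  let T : ℕ → (XK →ₗ[A] XK) := fun k => TK (act F K A X XK (up F L K _ (γ k)) u)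
  have hTS : ∀ k y, T k (b y) = b (S k y) := by
    intro k y
    have : T k ∘ₗ b' u = b' u ∘ₗ S k := by
      refine ext_u (F := F) (L := L) v hv _ _ ?_ ?_ ?_
      · intro l y
        rw [LinearMap.comp_apply, LinearMap.comp_apply, hb'L, hiL, hiL]
        exact hTK _ _ _
      · intro l y
        rw [LinearMap.comp_apply, LinearMap.comp_apply, ← hb'L]
        exact congrArg _ (hTL _ _ _)
      · intro x
        rw [LinearMap.comp_apply, LinearMap.comp_apply, hb']
        simp only [T, S]
        rw [hTKu, hTLv]
        have h1 := act_up (F := F) (K := K) b (b' u) (fun _ => rfl) (γ k) v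
        have h2 : b' u ∘ₗ v = u := by ext x; exact hb' u x
        rw [h2] at h1
        rw [h1]; rfl
    exact congrArg (fun q => q y) this
  obtain ⟨f, hfK, hfs, hfθ, hfi⟩ := key_decomp π hπ hG m hJ hd (fun k => up F L K _ (γ k))
    (fun k => by rw [← map_mul, hγ]) (fun k => by rw [piL_up, hγε, hε]) u hu T
    (fun k l y => hTK _ l y) (fun k x => hTKu _ x)
  let fK : (Fin n → XK) →ₗ[K] M := { toFun := f, map_add' := map_add f, map_smul' := hfK }
  let θ : (Fin n → XK) →ₗ[K] (Fin n → XK) :=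
    { toFun := fun y k => T k (y k)
      map_add' := fun y y' => by ext k; simp
      map_smul' := fun l y => by ext k; exact hTK _ l _ }
  have hTT : ∀ k y, T k (T k y) = T k y := by
    intro k y
    have R : T k ∘ₗ act F K A X XK (up F L K _ (γ k)) u = act F K A X XK (up F L K _ (γ k)) u := by
      have := tilde_act u (T k) _ (fun l y => hTK _ l y) (fun x => hTKu _ x) (up F L K _ (γ k))
      rw [← act_mul, ← map_mul, hγ] at this
      exact this
    have : T k ∘ₗ T k = T k := by
      refine ext_u (F := F) (L := K) u hu _ _ ?_ (fun l y => hTK _ l y) ?_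
      · intro l y
        rw [LinearMap.comp_apply, LinearMap.comp_apply]
        simp only [T]
        rw [hTK, hTK]
      · intro x
        have h1 : T k (u x) = act F K A X XK (up F L K _ (γ k)) u x := hTKu _ x
        rw [LinearMap.comp_apply, h1]
        exact congrArg (fun q => q x) R
    exact congrArg (fun q => q y) this
  have hdes := descent (b.compLeft (Fin n)) (hbB.finitePow (Fin n)) (fun y k => S k (y k)) θ
    (fun y => by ext k; exact hTS k _) (fun y => by ext k; exact hTT k _) fK hfs hfθ hfi
  refine ⟨_, ?_, hdes⟩
  rintro a _ ⟨y, rfl⟩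
  refine ⟨a • y, ?_⟩
  show f (fun k => b' u (a • y k)) = a • f (fun k => b' u (y k))
  rw [← map_smul]
  congr 1
  ext k
  simp

end PartE2

section PartG

variable {F K C ι : Type} [Field F] [Field K] [Algebra F K] [CommRing C] [Algebra F C]
  [Fintype ι] (B : Module.Basis ι F C)

lemma coord_mem (E : IntermediateField F K) (z : E ⊗[F] C) (i : ι) :
    (Algebra.TensorProduct.basis K B).repr (up F E K C z) i ∈ E := by
  induction z using TensorProduct.induction_on with
  | zero => simp
  | add z z' hz hz' =>
    rw [map_add, map_add, Finsupp.add_apply]; exact add_mem hz hz'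
  | tmul l c =>
    rw [up_tmul, Algebra.TensorProduct.basis_repr_tmul, Finsupp.smul_apply,
      Finsupp.mapRange_apply, smul_eq_mul]
    exact mul_mem l.2 (E.algebraMap_mem _)

lemma exists_up_eq (E : IntermediateField F K) (z : K ⊗[F] C)
    (h : ∀ i, (Algebra.TensorProduct.basis K B).repr z i ∈ E) :
    up F E K C (∑ i, (⟨_, h i⟩ : E) ⊗ₜ[F] B i) = z := by
  rw [map_sum]
  simp only [up_tmul]
  conv_rhs => rw [← (Algebra.TensorProduct.basis K B).sum_repr z]
  refine Finset.sum_congr rfl fun i _ => ?_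
  rw [Algebra.TensorProduct.basis_apply, TensorProduct.smul_tmul', smul_eq_mul, mul_one]
  rfl

theorem finite_adjoin (n : ℕ) (ε : ℕ → K ⊗[F] C) (hε : ∀ k, ε k * ε k = ε k) :
    FiniteDimensional F (IntermediateField.adjoin F (Set.range fun x : Fin n × ι =>
      (Algebra.TensorProduct.basis K B).repr (ε x.1) x.2)) := by
  set S := Set.range fun x : Fin n × ι => (Algebra.TensorProduct.basis K B).repr (ε x.1) x.2
    with hS
  set K0 := IntermediateField.adjoin F S with hK0
  have hmem : ∀ (k : Fin n) (i : ι), (Algebra.TensorProduct.basis K B).repr (ε k) i ∈ K0 :=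
    fun k i => IntermediateField.subset_adjoin F S ⟨(k, i), rfl⟩
  have hess : Algebra.EssFiniteType F K0 :=
    IntermediateField.essFiniteType_iff.mpr
      (IntermediateField.fg_adjoin_of_finite (Set.finite_range _))
  have hunr : Algebra.FormallyUnramified F K0 := by
    rw [Algebra.FormallyUnramified.iff_comp_injective]
    intro R _ _ I hI f g hfg
    have hfg' : ∀ a, f a - g a ∈ I := by
      intro a
      have := congrArg (fun q => q a) hfg
      exact (Ideal.Quotient.eq).mp this
    have hII : ∀ a ∈ I, ∀ b ∈ I, a * b = 0 := by
      intro a ha b hb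
      have : a * b ∈ I ^ 2 := by rw [pow_two]; exact Ideal.mul_mem_mul ha hb
      rwa [hI] at this
    have hgen : ∀ (k : Fin n) (i : ι), f ⟨_, hmem k i⟩ = g ⟨_, hmem k i⟩ := by
      intro k
      let e0 : K0 ⊗[F] C := ∑ i, (⟨_, hmem k i⟩ : K0) ⊗ₜ[F] B i
      have he0 : e0 * e0 = e0 := up_inj (K := K) (by
        rw [map_mul, exists_up_eq, hε])
      let mf := Algebra.TensorProduct.map f (AlgHom.id F C)
      let mg := Algebra.TensorProduct.map g (AlgHom.id F C)
      have h1 : mf e0 * mf e0 = mf e0 := by rw [← map_mul, he0]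
      have h2 : mg e0 * mg e0 = mg e0 := by rw [← map_mul, he0]
      have hx : mf e0 - mg e0 = ∑ i, (f ⟨_, hmem k i⟩ - g ⟨_, hmem k i⟩) ⊗ₜ[F] B i := by
        simp only [e0, mf, mg, map_sum, Algebra.TensorProduct.map_tmul, AlgHom.id_apply,
          ← Finset.sum_sub_distrib, TensorProduct.sub_tmul]
      have hxx : (mf e0 - mg e0) * (mf e0 - mg e0) = 0 := by
        rw [hx, Finset.sum_mul_sum]
        refine Finset.sum_eq_zero fun i _ => Finset.sum_eq_zero fun j _ => ?_
        rw [Algebra.TensorProduct.tmul_mul_tmul, hII _ (hfg' _) _ (hfg' _),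
          TensorProduct.zero_tmul]
      have hx0 : mf e0 - mg e0 = 0 := by
        linear_combination (mf e0 - mg e0) * hxx - (mf e0 + 1 - 3 * mg e0) * h1
          + (mg e0 + 1 - 3 * mf e0) * h2
      rw [hx] at hx0
      intro i
      have h3 := congrArg (fun z => (Algebra.TensorProduct.basis R B).repr z i) hx0
      simp only [map_sum, map_zero, Finsupp.coe_zero, Pi.zero_apply] at h3
      rw [Finsupp.finsetSum_apply] at h3
      simp only [Algebra.TensorProduct.basis_repr_tmul, Finsupp.smul_apply,
        Finsupp.mapRange_apply, Module.Basis.repr_self] at h3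
      rw [Finset.sum_eq_single i] at h3
      · simpa [sub_eq_zero] using h3
      · intro j _ hj
        simp [Finsupp.single_apply, hj]
      · intro h; exact absurd (Finset.mem_univ _) h
    have hall : ∀ x (hx : x ∈ K0), f ⟨x, hx⟩ = g ⟨x, hx⟩ := by
      intro x hx
      refine IntermediateField.adjoin_induction F (p := fun x hx => f ⟨x, hx⟩ = g ⟨x, hx⟩)
        ?_ ?_ ?_ ?_ ?_ hx
      · rintro _ ⟨⟨k, i⟩, rfl⟩
        exact hgen k i
      · intro c
        exact (f.commutes c).trans (g.commutes c).symm
      · intro x y hx hy h1 h2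
        have e : (⟨x + y, add_mem hx hy⟩ : K0) = ⟨x, hx⟩ + ⟨y, hy⟩ := rfl
        rw [e, map_add, map_add, h1, h2]
      · intro x hx h1
        by_cases h0 : x = 0
        · have e : (⟨x⁻¹, inv_mem hx⟩ : K0) = 0 := Subtype.ext (by simp [h0])
          rw [e, map_zero, map_zero]
        · have e : (⟨x⁻¹, inv_mem hx⟩ : K0) * ⟨x, hx⟩ = 1 := Subtype.ext (inv_mul_cancel₀ h0)
          have ef := congrArg f e
          have eg := congrArg g e
          rw [map_mul, map_one] at ef eg
          rw [h1] at ef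
          calc f ⟨x⁻¹, inv_mem hx⟩ = f ⟨x⁻¹, inv_mem hx⟩ * (g ⟨x⁻¹, inv_mem hx⟩ * g ⟨x, hx⟩) := by
                rw [eg, mul_one]
            _ = (f ⟨x⁻¹, inv_mem hx⟩ * g ⟨x, hx⟩) * g ⟨x⁻¹, inv_mem hx⟩ := by ring
            _ = g ⟨x⁻¹, inv_mem hx⟩ := by rw [ef, one_mul]
      · intro x y hx hy h1 h2
        have e : (⟨x * y, mul_mem hx hy⟩ : K0) = ⟨x, hx⟩ * ⟨y, hy⟩ := rfl
        rw [e, map_mul, map_mul, h1, h2]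
    ext a
    exact hall a.1 a.2
  exact Algebra.FormallyUnramified.finite_of_free F K0

end PartG

/-- a form over `L` forces the idempotents to be defined over `L`. -/
theorem decomp_of_descends {F K A X M C : Type} [Field F] [Field K] [Algebra F K]
    [Ring A] [Algebra F A]
    [AddCommGroup X] [Module F X] [Module A X] [IsScalarTower F A X]
    [AddCommGroup M] [Module F M] [Module K M] [Module A M]
    [IsScalarTower F K M] [IsScalarTower F A M] [SMulCommClass K A M] [SMulCommClass A K M]
    [CommRing C] [Algebra F C] (π : Module.End A X →ₐ[F] C)
    (hπ : Function.Surjective π) [FiniteDimensional F X] [FiniteDimensional K M]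
    [FiniteDimensional F C] (hred : IsReduced (K ⊗[F] C))
    {n : ℕ} {ε : ℕ → K ⊗[F] C} {p : ℕ → (X →ₗ[A] M)} (hd : Decomp π n ε p)
    (L : IntermediateField F K) (hL : DescendsTo F K A M L) :
    ∀ k, ∃ z : L ⊗[F] C, up F L K C z = ε k := by
  obtain ⟨N, hN, hb⟩ := hL
  have t0 : IsScalarTower F L M := ⟨fun c l m => by
    rw [← algebraMap_smul K c (l • m)]
    show ((c • l : L) : K) • m = algebraMap F K c • (l : K) • m
    rw [← mul_smul, ← Algebra.smul_def]; rfl⟩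
  let sA : SMul A N := ⟨fun a x => ⟨a • x.1, hN a _ x.2⟩⟩
  let iA : Module A N := Function.Injective.module A N.subtype.toAddMonoidHom
    Subtype.val_injective (fun _ _ => rfl)
  have t1 : IsScalarTower F A N := ⟨fun c a x => Subtype.ext (smul_assoc c a x.1)⟩
  have t2 : SMulCommClass A L N := ⟨fun a l x => Subtype.ext (smul_comm a (l : K) x.1)⟩
  have hfin : FiniteDimensional L N := by
    let b := Module.Basis.ofVectorSpace L N
    have := Module.Finite.finite_basis (hb.basis b)
    exact Module.Finite.of_basis b
  have hredL : IsReduced (L ⊗[F] C) := isReduced_of_injective (up F L K C) up_inj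
  obtain ⟨n', ε', p', hd'⟩ := exists_decomp (L := L) (N := N) π hπ
  let ιA : N →ₗ[A] M :=
    { toFun := Subtype.val, map_add' := fun _ _ => rfl, map_smul' := fun _ _ => rfl }
  have h2 := hd'.baseChange π N.subtype ιA hπ hb (fun _ => rfl)
  intro k
  exact ⟨ε' k, h2.unique π hπ hd k⟩


/-- **Theorem 1.2.** Let `F` be a `C₁`-field, `A` a finite-dimensional
`F`-algebra of finite representation type, and `K/F` a field extension in which `F`
is perfectly closed.  Then every finitely generated `A_K`-module `M` has a minimal
field of definition `K₀` with `F ⊆ K₀ ⊆ K` and `[K₀ : F] < ∞`. -/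
theorem exists_minimal_field_of_definition_of_finiteRepType
    (F K A : Type) [Field F] [Field K] [Algebra F K]
    [Ring A] [Algebra F A] [FiniteDimensional F A]
    (hC1 : IsC1Field F) (hfrt : FiniteRepType A) (hpc : PerfectlyClosedIn F K)
    (M : Type) [AddCommGroup M] [Module F M] [Module K M] [Module A M]
    [IsScalarTower F K M] [IsScalarTower F A M] [SMulCommClass K A M]
    [Module.Finite K M] :
    ∃ K₀ : IntermediateField F K, FiniteDimensional F K₀ ∧
      DescendsTo F K A M K₀ ∧
      ∀ L : IntermediateField F K, DescendsTo F K A M L → K₀ ≤ L := by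
  have tc : SMulCommClass A K M := SMulCommClass.symm K A M
  obtain ⟨X, _, _, _, _, _, C, _, _, _, _, π, m, hG, hπ, hJ⟩ := exists_setup F A hC1 hfrt
  have hred : IsReduced (K ⊗[F] C) := isReduced_baseChange hC1 hpc
  obtain ⟨n, ε, p, hd⟩ := exists_decomp (L := K) (N := M) π hπ
  let B := Module.finBasis F C
  refine ⟨IntermediateField.adjoin F (Set.range fun x : Fin n × Fin (Module.finrank F C) =>
      (Algebra.TensorProduct.basis K B).repr (ε x.1) x.2), finite_adjoin B n ε hd.idem, ?_, ?_⟩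
  · have hmem : ∀ k i, (Algebra.TensorProduct.basis K B).repr (ε k) i ∈
        IntermediateField.adjoin F (Set.range fun x : Fin n × Fin (Module.finrank F C) =>
          (Algebra.TensorProduct.basis K B).repr (ε x.1) x.2) := by
      intro k i
      by_cases hk : k < n
      · exact IntermediateField.subset_adjoin F _ ⟨(⟨k, hk⟩, i), rfl⟩
      · rw [hd.vanish k (by omega), map_zero, Finsupp.zero_apply]
        exact zero_mem _
    exact descends_of_decomp π hπ hG m hJ hd _ (fun k => exists_up_eq B _ (ε k) (hmem k))
  · intro L hL
    rw [IntermediateField.adjoin_le_iff]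
    rintro _ ⟨⟨k, i⟩, rfl⟩
    obtain ⟨z, hz⟩ := decomp_of_descends π hπ hred hd L hL k
    simp only
    rw [← hz]
    exact coord_mem B L z i
end

section
/- Let E be the fraction field of ℚ[a,b]/(a² + b² + 1) and M the 2-dimensional module over the quaternion algebra A = (-1,-1)_ℚ base-changed to E, given by x ↦ [[a,b],[b,-a]], y ↦ [[b,-a],[-a,-b]]. Then M does not descend to any intermediate field ℚ ⊆ E₀ ⊆ E with trdeg(E₀/ℚ) = 0; consequently ed(M) = 1. -/
open Quaternion

/-- The 2-dimensional quaternionic representation `ρ` over `E` descends to the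
intermediate field `E₀ ⊆ E`: it is conjugate to a representation with entries
in `E₀`. -/
def RepDescendsTo (E : Type) [Field E] [Algebra ℚ E]
    (ρ : ℍ[ℚ] →ₐ[ℚ] Matrix (Fin 2) (Fin 2) E)
    (E₀ : IntermediateField ℚ E) : Prop :=
  ∃ (σ : ℍ[ℚ] →ₐ[ℚ] Matrix (Fin 2) (Fin 2) E₀) (P : (Matrix (Fin 2) (Fin 2) E)ˣ),
    ∀ q : ℍ[ℚ], ρ q = (P : Matrix (Fin 2) (Fin 2) E) * (σ q).map (algebraMap E₀ E) *
      ((P⁻¹ : (Matrix (Fin 2) (Fin 2) E)ˣ) : Matrix (Fin 2) (Fin 2) E)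

/-- The embedding `F(X) → E` sending `X` to a transcendental element. -/
theorem aux_hom {F E : Type} [Field F] [Field E] [Algebra F E] (a : E) (ha : Transcendental F a) :
    ∃ f : RatFunc F →+* E, f RatFunc.X = a :=
  ⟨((IntermediateField.val _).comp (RatFunc.algEquivOfTranscendental a ha).toAlgHom).toRingHom,
    RatFunc.algEquivOfTranscendental_X a ha⟩

theorem aux_bot (F E : Type) [Field F] [Field E] [Algebra F E] :
    Nonempty ((⊥ : IntermediateField F E) →+* F) :=
  ⟨(IntermediateField.botEquiv F E).toAlgHom.toRingHom⟩

theorem aux_top (F E : Type) [Field F] [Field E] [Algebra F E] :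
    ∃ f : E →+* (⊤ : IntermediateField F E), ∀ x, (f x : E) = x :=
  ⟨(IntermediateField.topEquiv (F := F) (E := E)).symm.toAlgHom.toRingHom, fun _ => rfl⟩

open Polynomial in
/-- No nonzero `q ∈ ℚ(X)` has `q² (1 + X²)` constant. -/
theorem aux_sq_poly (f g : ℚ[X]) (r : ℚ) (hf : f ≠ 0) (hg : g ≠ 0)
    (h : f ^ 2 * (1 + X ^ 2) = C r * g ^ 2) : False := by
  have hr : r ≠ 0 := by
    rintro rfl
    have h2 : (1 + X ^ 2 : ℚ[X]) ≠ 0 := by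
      intro h0
      have := congrArg (Polynomial.eval 0) h0
      simp at this
    simp [hf, h2] at h
  let φ := algebraMap ℚ ℂ
  have hf' : f.map φ ≠ 0 := (Polynomial.map_ne_zero_iff φ.injective).2 hf
  have hg' : g.map φ ≠ 0 := (Polynomial.map_ne_zero_iff φ.injective).2 hg
  have hr' : φ r ≠ 0 := by simpa using hr
  have h' := congrArg (Polynomial.map φ) h
  have hI : (C Complex.I : ℂ[X]) ^ 2 = -1 := by
    rw [← C_pow, Complex.I_sq]; simp
  have e : (1 + X ^ 2 : ℂ[X]) = (X - C Complex.I) * (X + C Complex.I) := by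
    linear_combination hI
  simp only [Polynomial.map_mul, Polynomial.map_pow, Polynomial.map_add, Polynomial.map_one,
    Polynomial.map_X, Polynomial.map_C, e] at h'
  have hX : (X + C Complex.I : ℂ[X]) ≠ 0 := (monic_X_add_C _).ne_zero
  have hX' : (X - C Complex.I : ℂ[X]) ≠ 0 := (monic_X_sub_C _).ne_zero
  have h3 := congrArg (rootMultiplicity Complex.I) h'
  rw [rootMultiplicity_mul (mul_ne_zero (pow_ne_zero _ hf') (mul_ne_zero hX' hX)),
    rootMultiplicity_mul (mul_ne_zero hX' hX),
    rootMultiplicity_mul (mul_ne_zero (C_ne_zero.2 hr') (pow_ne_zero _ hg')),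
    rootMultiplicity_X_sub_C_self, rootMultiplicity_C, pow_two, pow_two,
    rootMultiplicity_mul (mul_ne_zero hf' hf'), rootMultiplicity_mul (mul_ne_zero hg' hg'),
    rootMultiplicity_eq_zero (p := X + C Complex.I)] at h3
  · omega
  · simp [IsRoot, ← two_mul]

theorem aux_sq (q : RatFunc ℚ) (r : ℚ) (hq : q ≠ 0)
    (h : q ^ 2 * (1 + RatFunc.X ^ 2) = RatFunc.C r) : False := by
  refine aux_sq_poly q.num q.denom r (RatFunc.num_ne_zero hq) q.denom_ne_zero ?_
  apply RatFunc.algebraMap_injective ℚ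
  have hd : algebraMap (Polynomial ℚ) (RatFunc ℚ) q.denom ≠ 0 :=
    RatFunc.algebraMap_ne_zero q.denom_ne_zero
  have hqq := RatFunc.num_div_denom q
  rw [div_eq_iff hd] at hqq
  simp only [map_mul, map_pow, map_add, map_one, RatFunc.algebraMap_X, RatFunc.algebraMap_C, hqq]
  linear_combination (algebraMap (Polynomial ℚ) (RatFunc ℚ) q.denom) ^ 2 * h

theorem aux_const (p : RatFunc ℚ) (h : IsIntegral ℚ p) : ∃ c, p = RatFunc.C c := by
  by_contra hc
  apply RatFunc.transcendental_of_ne_C p hc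
  have h2 := h.isAlgebraic
  have e : (DivisionRing.toRatAlgebra : Algebra ℚ (RatFunc ℚ)) =
    RatFunc.instAlgebraOfPolynomial ℚ ℚ := Subsingleton.elim _ _
  rw [e] at h2
  exact h2

section
variable {E : Type} [Field E] [Algebra ℚ E] [Algebra (RatFunc ℚ) E]

theorem aux_decomp (b : E) (hb : b ^ 2 = algebraMap (RatFunc ℚ) E (-(1 + RatFunc.X ^ 2)))
    (hgen : IntermediateField.adjoin ℚ {algebraMap (RatFunc ℚ) E RatFunc.X, b} =
      (⊤ : IntermediateField ℚ E)) (x : E) :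
    ∃ p q : RatFunc ℚ, x = algebraMap _ E p + algebraMap _ E q * b := by
  have hx : x ∈ IntermediateField.adjoin ℚ {algebraMap (RatFunc ℚ) E RatFunc.X, b} := by
    rw [hgen]; trivial
  induction hx using IntermediateField.adjoin_induction with
  | mem x hx =>
    rcases hx with rfl | rfl
    · exact ⟨RatFunc.X, 0, by simp⟩
    · exact ⟨0, 1, by simp⟩
  | algebraMap r =>
    exact ⟨algebraMap ℚ _ r, 0, by rw [← IsScalarTower.algebraMap_apply]; simp⟩
  | add x y _ _ hx hy =>
    obtain ⟨p, q, rfl⟩ := hx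
    obtain ⟨p', q', rfl⟩ := hy
    exact ⟨p + p', q + q', by simp only [map_add]; ring⟩
  | mul x y _ _ hx hy =>
    obtain ⟨p, q, rfl⟩ := hx
    obtain ⟨p', q', rfl⟩ := hy
    refine ⟨p * p' + q * q' * (-(1 + RatFunc.X ^ 2)), p * q' + q * p', ?_⟩
    rw [map_add, map_mul _ (q * q'), ← hb]
    simp only [map_add, map_mul]
    ring
  | inv x _ hx =>
    obtain ⟨p, q, rfl⟩ := hx
    by_cases h0 : algebraMap _ E p + algebraMap _ E q * b = 0
    · exact ⟨0, 0, by simp [h0]⟩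
    by_cases h1 : algebraMap _ E p - algebraMap _ E q * b = 0
    · refine ⟨(2 * p)⁻¹, 0, ?_⟩
      have : algebraMap _ E p + algebraMap _ E q * b = 2 * algebraMap _ E p := by
        linear_combination -h1
      rw [this]; simp only [map_inv₀, map_mul, map_ofNat, map_zero, zero_mul, add_zero]
    · have hN : algebraMap _ E (p ^ 2 - q ^ 2 * (-(1 + RatFunc.X ^ 2))) =
          (algebraMap _ E p + algebraMap _ E q * b) * (algebraMap _ E p - algebraMap _ E q * b) := by
        rw [map_sub, map_mul, ← hb]; simp only [map_pow]; ring
      refine ⟨p / (p ^ 2 - q ^ 2 * (-(1 + RatFunc.X ^ 2))),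
        - q / (p ^ 2 - q ^ 2 * (-(1 + RatFunc.X ^ 2))), ?_⟩
      rw [map_div₀, map_div₀, hN]
      have := mul_ne_zero h0 h1
      rw [div_mul_eq_mul_div, ← add_div, eq_div_iff this, inv_mul_cancel_left₀ h0, map_neg]
      ring

open Polynomial in
theorem aux_closed (b : E) (hb : b ^ 2 = algebraMap (RatFunc ℚ) E (-(1 + RatFunc.X ^ 2)))
    (hgen : IntermediateField.adjoin ℚ {algebraMap (RatFunc ℚ) E RatFunc.X, b} =
      (⊤ : IntermediateField ℚ E)) (x : E) (hx : IsIntegral ℚ x) :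
    ∃ c : ℚ, x = algebraMap ℚ E c := by
  have := IsScalarTower.of_algebraMap_eq' (R := ℚ) (S := RatFunc ℚ) (A := E) (RingHom.ext_rat _ _)
  have hinj : Function.Injective (algebraMap (RatFunc ℚ) E) := (algebraMap (RatFunc ℚ) E).injective
  have hC : ∀ c : ℚ, RatFunc.C c = algebraMap ℚ (RatFunc ℚ) c := fun c => by simp
  have hbK : ∀ p : RatFunc ℚ, algebraMap _ E p ≠ b := by
    rintro p rfl
    rw [← map_pow] at hb
    have hb := hinj hb
    have hp : p ≠ 0 := by
      rintro rfl
      apply aux_sq 1 0 one_ne_zero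
      rw [map_zero]
      linear_combination hb
    apply aux_sq p⁻¹ (-1) (inv_ne_zero hp)
    have : 1 + RatFunc.X ^ 2 = -p ^ 2 := by linear_combination hb
    rw [this]
    field_simp
    simp
  obtain ⟨p, q, rfl⟩ := aux_decomp b hb hgen x
  by_cases hq : q = 0
  · subst hq
    simp only [map_zero, zero_mul, add_zero] at hx ⊢
    obtain ⟨c, rfl⟩ := aux_const p ((isIntegral_algebraMap_iff hinj).1 hx)
    exact ⟨c, by rw [hC, ← IsScalarTower.algebraMap_apply]⟩
  exfalso
  set x := algebraMap _ E p + algebraMap _ E q * b with hxdef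
  set N : RatFunc ℚ := p ^ 2 + q ^ 2 * (1 + RatFunc.X ^ 2) with hN
  let Q : (RatFunc ℚ)[X] := X ^ 2 + C (-(2 * p)) * X + C N
  have hQdeg : Q.natDegree = 2 := by
    simp only [Q]; compute_degree!
  have hQm : Q.Monic := by simp only [Q]; monicity!
  have hQx : aeval x Q = 0 := by
    have hNE : algebraMap _ E N = algebraMap _ E p ^ 2 - algebraMap _ E q ^ 2 * b ^ 2 := by
      rw [hb, hN]; simp only [map_add, map_mul, map_pow, map_neg]; ring
    simp only [Q, map_add, map_mul, map_pow, aeval_X, aeval_C, hNE, map_neg, hxdef, map_ofNat]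
    ring
  have hxK : x ∉ (algebraMap (RatFunc ℚ) E).range := by
    rintro ⟨s, hs⟩
    apply hbK ((s - p) / q)
    have hq' : algebraMap _ E q ≠ 0 := by simpa using hq
    rw [map_div₀, map_sub, hs, div_eq_iff hq', hxdef]; ring
  have hxi : IsIntegral (RatFunc ℚ) x := hx.tower_top
  have hmin : minpoly (RatFunc ℚ) x = Q := by
    refine (Polynomial.eq_of_monic_of_dvd_of_natDegree_le (minpoly.monic hxi) hQm
      (minpoly.dvd _ _ hQx) ?_).symm
    rw [hQdeg]
    exact (minpoly.two_le_natDegree_iff hxi).2 hxK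
  have hdvd : Q ∣ (minpoly ℚ x).map (algebraMap ℚ (RatFunc ℚ)) := by
    rw [← hmin]; exact minpoly.dvd_map_of_isScalarTower _ _ _
  have hl := integralClosure.mem_lifts_of_monic_of_dvd_map (RatFunc ℚ) (minpoly.monic hx) hQm hdvd
  rw [lifts_iff_coeff_lifts] at hl
  have hint : ∀ n, IsIntegral ℚ (Q.coeff n) := by
    intro n
    obtain ⟨y, hy⟩ := hl n
    rw [← hy]; exact y.2
  obtain ⟨c1, h1⟩ := aux_const _ (hint 1)
  obtain ⟨c0, h0⟩ := aux_const _ (hint 0)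
  have e1 : Q.coeff 1 = -(2 * p) := by simp [Q, coeff_C, coeff_X_pow]
  have e0 : Q.coeff 0 = N := by simp [Q]
  rw [e1] at h1
  rw [e0] at h0
  apply aux_sq q (c0 - c1 ^ 2 / 4) hq
  have h4 : (RatFunc.C (4:ℚ)) = 4 := by simp
  rw [map_sub, map_div₀, map_pow, ← h1, ← h0, h4, hN]
  ring
end

theorem aux_alg {E : Type} [Field E] [Algebra ℚ E]
    (a b : E) (hab : a ^ 2 + b ^ 2 = -1)
    (hgen : IntermediateField.adjoin ℚ {a, b} = (⊤ : IntermediateField ℚ E)) :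
    Algebra.IsAlgebraic (Algebra.adjoin ℚ {a}) E := by
  constructor
  intro x
  have hx : x ∈ IntermediateField.adjoin ℚ {a, b} := by
    rw [hgen]; trivial
  have haA : IsAlgebraic (Algebra.adjoin ℚ {a}) a :=
    isAlgebraic_algebraMap (⟨a, Algebra.self_mem_adjoin_singleton ℚ a⟩ : Algebra.adjoin ℚ {a})
  induction hx using IntermediateField.adjoin_induction with
  | mem x hx =>
    rcases hx with rfl | rfl
    · exact haA
    · refine IsAlgebraic.of_pow (n := 2) two_pos ?_
      have : x ^ 2 = -1 - a ^ 2 := by linear_combination hab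
      rw [this]
      exact (isAlgebraic_one.neg).sub (haA.pow 2)
  | algebraMap r =>
    rw [IsScalarTower.algebraMap_apply ℚ (Algebra.adjoin ℚ {a}) E]
    exact isAlgebraic_algebraMap _
  | add x y _ _ hx hy => exact hx.add hy
  | mul x y _ _ hx hy => exact hx.mul hy
  | inv x _ hx => exact hx.inv

/-- `ℍ[ℚ]` has no 2-dimensional representation over `ℚ`. -/
theorem aux_norep (σ : ℍ[ℚ] →ₐ[ℚ] Matrix (Fin 2) (Fin 2) ℚ) : False := by
  have hinj : Function.Injective σ := σ.toRingHom.injective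
  have hd : Module.finrank ℚ ℍ[ℚ] = Module.finrank ℚ (Matrix (Fin 2) (Fin 2) ℚ) := by
    rw [Quaternion.finrank_eq_four, Module.finrank_matrix]; simp
  have hsurj : Function.Surjective σ.toLinearMap :=
    (LinearMap.injective_iff_surjective_of_finrank_eq_finrank hd).1 hinj
  obtain ⟨u, hu⟩ := hsurj !![0, 1; 0, 0]
  have hu' : σ u = !![0, 1; 0, 0] := hu
  have h0 : σ (u * u) = σ 0 := by
    rw [map_mul, hu', map_zero]; ext i j; fin_cases i <;> fin_cases j <;> simp
  have := mul_self_eq_zero.1 (hinj h0)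
  rw [this, map_zero] at hu'
  have := congrFun (congrFun hu' 0) 1
  simp at this

/-- **Proposition 6.2(a).** Let `E = ℚ(a,b)` with `a` transcendental
over `ℚ` and `a² + b² = -1` (so `E` is the function field of the conic
`a² + b² + c² = 0`, i.e. the fraction field of `ℚ[a,b]/(a²+b²+1)`), and let `M` be
the 2-dimensional module over `A_E`, `A = (-1,-1)_ℚ`, given by
`i ↦ [[a,b],[b,-a]]`, `j ↦ [[b,-a],[-a,-b]]`.  Then `M` does not descend to any
intermediate field `ℚ ⊆ E₀ ⊆ E` of transcendence degree `0` (i.e. algebraic over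
`ℚ`); consequently `ed(M) = 1`: moreover `M` descends to some field of definition
of transcendence degree at most `1`. -/
theorem quaternion_module_essential_dimension_one
    (E : Type) [Field E] [Algebra ℚ E]
    (a b : E) (ha : Transcendental ℚ a) (hab : a ^ 2 + b ^ 2 = -1)
    (hgen : IntermediateField.adjoin ℚ {a, b} = (⊤ : IntermediateField ℚ E))
    (ρ : ℍ[ℚ] →ₐ[ℚ] Matrix (Fin 2) (Fin 2) E)
    (hρi : ρ ⟨0, 1, 0, 0⟩ = !![a, b; b, -a])
    (hρj : ρ ⟨0, 0, 1, 0⟩ = !![b, -a; -a, -b]) :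
    (∀ E₀ : IntermediateField ℚ E, RepDescendsTo E ρ E₀ → ¬ Algebra.IsAlgebraic ℚ E₀) ∧
      ∃ E₀ : IntermediateField ℚ E, RepDescendsTo E ρ E₀ ∧
        ∀ x y : E₀, ¬ AlgebraicIndependent ℚ ![x, y] := by
  constructor
  · rintro E₀ ⟨σ, -, -⟩ hE₀
    obtain ⟨f, hf⟩ := aux_hom a ha
    let _ : Algebra (RatFunc ℚ) E := f.toAlgebra
    have hX : algebraMap (RatFunc ℚ) E RatFunc.X = a := hf
    have hb : b ^ 2 = algebraMap (RatFunc ℚ) E (-(1 + RatFunc.X ^ 2)) := by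
      simp only [map_neg, map_add, map_one, map_pow, hX]
      linear_combination hab
    rw [← hX] at hgen
    have hbot : E₀ = ⊥ := by
      rw [eq_bot_iff]
      intro x hx
      have hxi : IsIntegral ℚ x :=
        (isIntegral_algebraMap_iff (algebraMap E₀ E).injective).2
          (hE₀.isAlgebraic (⟨x, hx⟩ : E₀)).isIntegral
      obtain ⟨c, rfl⟩ := aux_closed b hb hgen x hxi
      exact IntermediateField.algebraMap_mem _ c
    subst hbot
    obtain ⟨g⟩ := aux_bot ℚ E
    exact aux_norep ((g.mapMatrix).comp σ.toRingHom).toRatAlgHom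
  · obtain ⟨t, ht⟩ := aux_top ℚ E
    refine ⟨⊤, ⟨((t.mapMatrix).comp ρ.toRingHom).toRatAlgHom, 1, ?_⟩, ?_⟩
    · intro q
      ext i j
      simp [ht]
    · intro x y h
      have h2 := (h.map' (f := (algebraMap (⊤ : IntermediateField ℚ E) E).toRatAlgHom)
        (RingHom.injective _)).cardinalMk_le_trdeg
      have := aux_alg a b hab hgen
      have h1 : Algebra.trdeg ℚ E ≤ Cardinal.mk ({a} : Set E) :=
        Algebra.IsAlgebraic.trdeg_le_cardinalMk ℚ {a}
      have := h2.trans h1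
      simp at this
end

section
/- Let E be the fraction field of ℚ[a,b]/(a² + b² + 1) and M the 2-dimensional module over A_E, where A = (-1,-1)_ℚ, given by x ↦ [[a,b],[b,-a]], y ↦ [[b,-a],[-a,-b]]. Then M has no minimal field of definition: for every field of definition ℚ ⊆ E₁ ⊆ E of M there exists a field of definition E₃ properly contained in E₁. -/
open Quaternion

namespace QMod

lemma not_sq (f g : Polynomial ℚ) (q : ℚ) (hc : IsCoprime f g)
    (h : f ^ 2 * (1 + Polynomial.X ^ 2) = Polynomial.C q * g ^ 2) (hf : f ≠ 0) : False := by
  have hdeg : (1 + Polynomial.X ^ 2 : Polynomial ℚ).natDegree = 2 := by compute_degree!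
  have hne : (1 + Polynomial.X ^ 2 : Polynomial ℚ) ≠ 0 := by
    intro h0; rw [h0] at hdeg; simp at hdeg
  have hirr : Irreducible (1 + Polynomial.X ^ 2 : Polynomial ℚ) := by
    rw [Polynomial.irreducible_iff_roots_eq_zero_of_degree_le_three (by omega) (by omega)]
    rw [Multiset.eq_zero_iff_forall_notMem]
    intro x hx
    rw [Polynomial.mem_roots hne] at hx
    simp [Polynomial.IsRoot] at hx
    nlinarith [sq_nonneg x]
  have hp := hirr.prime
  have hq : q ≠ 0 := by
    rintro rfl
    simp [hf, hne] at h
  have h1 : (1 + Polynomial.X ^ 2 : Polynomial ℚ) ∣ g ^ 2 := by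
    have : (1 + Polynomial.X ^ 2 : Polynomial ℚ) ∣ Polynomial.C q * g ^ 2 := ⟨f ^ 2, by rw [← h]; ring⟩
    exact (Polynomial.isUnit_C.mpr hq.isUnit).dvd_mul_left.mp this
  obtain ⟨k, hk⟩ := hp.dvd_of_dvd_pow h1
  have h2 : f ^ 2 = (1 + Polynomial.X ^ 2) * (Polynomial.C q * k ^ 2) := by
    apply mul_right_cancel₀ hne
    rw [h, hk]; ring
  have h3 := hp.dvd_of_dvd_pow ⟨_, h2⟩
  exact hp.not_isUnit (hc.isUnit_of_dvd' h3 ⟨k, hk⟩)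

lemma ratfunc_not_sq (s : RatFunc ℚ) (q : ℚ)
    (h : s ^ 2 * (1 + RatFunc.X ^ 2) = algebraMap ℚ _ q) : s = 0 := by
  by_contra hs
  refine not_sq s.num s.denom q s.isCoprime_num_denom ?_ (by simpa using hs)
  apply RatFunc.algebraMap_injective ℚ
  have hd : algebraMap (Polynomial ℚ) (RatFunc ℚ) s.denom ≠ 0 := by simp [s.denom_ne_zero]
  have hn : s * algebraMap (Polynomial ℚ) (RatFunc ℚ) s.denom = algebraMap _ _ s.num := by
    conv_lhs => rw [← RatFunc.num_div_denom s]
    rw [RatFunc.num_div_denom s]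
    nth_rw 1 [← RatFunc.num_div_denom s]
    field_simp
  have e : (algebraMap (Polynomial ℚ) (RatFunc ℚ)) (Polynomial.C q) = algebraMap ℚ _ q := by
    rw [RatFunc.algebraMap_C]; simp
  simp only [map_mul, map_add, map_pow, map_one, RatFunc.algebraMap_X, e, ← h, ← hn]
  ring

lemma ratfunc_alg (x : RatFunc ℚ) (hx : IsAlgebraic ℚ x) : ∃ c : ℚ, x = algebraMap ℚ _ c := by
  by_contra h
  refine RatFunc.transcendental_of_ne_C (f := x) ?_ (by
    obtain ⟨p, hp, h0⟩ := hx
    refine ⟨p, hp, ?_⟩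
    rw [← h0]
    simp only [Polynomial.aeval_def]
    congr 1
    exact Subsingleton.elim _ _)
  rintro ⟨c, hc⟩
  exact h ⟨c, by rw [hc]; simp⟩

section
variable {E : Type} [Field E] [Algebra ℚ E]

lemma exists_phi (a : E) (ha : Transcendental ℚ a) :
    ∃ φ : RatFunc ℚ →ₐ[ℚ] E, φ RatFunc.X = a :=
  ⟨RingHom.toRatAlgHom ((algebraMap (IntermediateField.adjoin ℚ {a}) E).comp
    (RatFunc.algEquivOfTranscendental a ha : RatFunc ℚ →+* IntermediateField.adjoin ℚ {a})), by
    simp⟩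

lemma b_notMem (a b : E) (hab : a ^ 2 + b ^ 2 = -1)
    (φ : RatFunc ℚ →ₐ[ℚ] E) (hφ : φ RatFunc.X = a)
    (t : RatFunc ℚ) : φ t ≠ b := by
  intro h
  have ht : t ^ 2 = - (1 + RatFunc.X ^ 2) := by
    apply φ.toRingHom.injective
    change φ _ = φ _
    simp only [map_pow, map_neg, map_add, map_one, h, hφ]
    linear_combination hab
  have ht0 : t ≠ 0 := by
    rintro rfl
    have := ratfunc_not_sq 1 0 (by
      rw [zero_pow two_ne_zero] at ht
      rw [map_zero]; linear_combination ht)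
    simp at this
  have := ratfunc_not_sq t⁻¹ (-1) (by
    field_simp
    simp [ht])
  simp [ht0] at this

lemma indep (a b : E) (hab : a ^ 2 + b ^ 2 = -1)
    (φ : RatFunc ℚ →ₐ[ℚ] E) (hφ : φ RatFunc.X = a)
    (u v : RatFunc ℚ) (h : φ u + φ v * b = 0) : u = 0 ∧ v = 0 := by
  have hv : v = 0 := by
    by_contra hv
    apply b_notMem a b hab φ hφ (-u / v)
    have : φ v ≠ 0 := by simpa using hv
    rw [map_div₀, map_neg]
    field_simp
    linear_combination -h
  subst hv
  simpa using h

lemma exists_rep (a b : E) (hab : a ^ 2 + b ^ 2 = -1)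
    (φ : RatFunc ℚ →ₐ[ℚ] E) (hφ : φ RatFunc.X = a)
    (hgen : IntermediateField.adjoin ℚ {a, b} = (⊤ : IntermediateField ℚ E)) (c : E) :
    ∃ r s : RatFunc ℚ, c = φ r + φ s * b := by
  have hb : b * b = φ (-(1 + RatFunc.X ^ 2)) := by
    simp only [map_pow, map_neg, map_add, map_one, hφ]
    linear_combination hab
  have hc : c ∈ IntermediateField.adjoin ℚ {a, b} := by rw [hgen]; trivial
  induction hc using IntermediateField.adjoin_induction with
  | mem x hx =>
    rcases hx with rfl | rfl
    · exact ⟨RatFunc.X, 0, by simp [hφ]⟩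
    · exact ⟨0, 1, by simp⟩
  | algebraMap x => exact ⟨algebraMap ℚ _ x, 0, by simp⟩
  | add x y hx hy h1 h2 =>
    obtain ⟨r, s, rfl⟩ := h1
    obtain ⟨u, v, rfl⟩ := h2
    exact ⟨r + u, s + v, by simp; ring⟩
  | mul x y hx hy h1 h2 =>
    obtain ⟨r, s, rfl⟩ := h1
    obtain ⟨u, v, rfl⟩ := h2
    refine ⟨r * u + s * v * (-(1 + RatFunc.X ^ 2)), r * v + s * u, ?_⟩
    rw [map_add, map_mul _ (s * v), ← hb]
    simp only [map_add, map_mul]; ring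
  | inv x hx h1 =>
    obtain ⟨r, s, rfl⟩ := h1
    by_cases h0 : φ r + φ s * b = 0
    · exact ⟨0, 0, by simp [h0]⟩
    have h0' : φ r - φ s * b ≠ 0 := by
      intro h
      have := indep a b hab φ hφ r (-s) (by rw [map_neg]; linear_combination h)
      apply h0
      simp [this.1, neg_eq_zero.mp this.2]
    set N : RatFunc ℚ := r ^ 2 - s ^ 2 * (-(1 + RatFunc.X ^ 2)) with hN
    have hN' : φ N = (φ r + φ s * b) * (φ r - φ s * b) := by
      rw [hN, map_sub, map_mul, ← hb]; simp only [map_pow]; ring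
    refine ⟨r / N, - s / N, ?_⟩
    rw [map_div₀, map_div₀, hN', map_neg]
    field_simp
    ring

lemma alg_rat (a b : E) (hab : a ^ 2 + b ^ 2 = -1)
    (φ : RatFunc ℚ →ₐ[ℚ] E) (hφ : φ RatFunc.X = a)
    (hgen : IntermediateField.adjoin ℚ {a, b} = (⊤ : IntermediateField ℚ E)) (c : E)
    (hc : IsAlgebraic ℚ c) : ∃ q : ℚ, c = algebraMap ℚ E q := by
  have hb : b * b = φ (-(1 + RatFunc.X ^ 2)) := by
    simp only [map_pow, map_neg, map_add, map_one, hφ]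
    linear_combination hab
  obtain ⟨r, s, hrs⟩ := exists_rep a b hab φ hφ hgen c
  have key : ∀ p : Polynomial ℚ, ∃ u v : RatFunc ℚ,
      Polynomial.aeval (φ r + φ s * b) p = φ u + φ v * b ∧
      Polynomial.aeval (φ r - φ s * b) p = φ u - φ v * b := by
    intro p
    induction p using Polynomial.induction_on with
    | C x => exact ⟨algebraMap ℚ _ x, 0, by simp, by simp⟩
    | add p q h1 h2 =>
      obtain ⟨u, v, h1, h1'⟩ := h1
      obtain ⟨u', v', h2, h2'⟩ := h2
      refine ⟨u + u', v + v', ?_, ?_⟩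
      · rw [map_add, h1, h2]; simp only [map_add]; ring
      · rw [map_add, h1', h2']; simp only [map_add]; ring
    | monomial n x h =>
      obtain ⟨u, v, h1, h1'⟩ := h
      refine ⟨r * u + s * v * (-(1 + RatFunc.X ^ 2)), r * v + s * u, ?_, ?_⟩
      · rw [pow_succ, ← mul_assoc, map_mul, h1, Polynomial.aeval_X, map_add, map_mul _ (s * v), ← hb]
        simp only [map_add, map_mul]; ring
      · rw [pow_succ, ← mul_assoc, map_mul, h1', Polynomial.aeval_X, map_add, map_mul _ (s * v), ← hb]
        simp only [map_add, map_mul]; ring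
  have hc' : IsAlgebraic ℚ (φ r - φ s * b) := by
    obtain ⟨p, hp, hpc⟩ := hc
    obtain ⟨u, v, h1, h2⟩ := key p
    rw [← hrs, hpc] at h1
    obtain ⟨rfl, rfl⟩ := indep a b hab φ hφ u v h1.symm
    exact ⟨p, hp, by simpa using h2⟩
  have hr : IsAlgebraic ℚ r := by
    rw [← isAlgebraic_algHom_iff φ φ.injective]
    have : φ r = (c + (φ r - φ s * b)) * algebraMap ℚ E (1/2) := by
      rw [hrs]
      have : algebraMap ℚ E (1/2) = 1/2 := by simp
      rw [this]
      have : CharZero E := algebraRat.charZero E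
      field_simp
      ring
    rw [this]
    exact (hc.add hc').mul (isAlgebraic_algebraMap _)
  obtain ⟨q, rfl⟩ := ratfunc_alg r hr
  have hs : IsAlgebraic ℚ (s ^ 2 * (1 + RatFunc.X ^ 2)) := by
    rw [← isAlgebraic_algHom_iff φ φ.injective]
    have : φ (s ^ 2 * (1 + RatFunc.X ^ 2)) = -(c - algebraMap ℚ E q) ^ 2 := by
      rw [map_neg] at hb
      rw [hrs, map_mul, ← neg_eq_iff_eq_neg.mpr hb.symm.symm]
      simp only [AlgHom.commutes, map_pow]
      ring
    rw [this]
    exact ((hc.sub (isAlgebraic_algebraMap _)).pow 2).neg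
  obtain ⟨q', hq'⟩ := ratfunc_alg _ hs
  have := ratfunc_not_sq s q' hq'
  subst this
  exact ⟨q, by simpa using hrs⟩

end

lemma notMem_cube {K L : Type} [Field K] [Field L] [Algebra K L] (z : L) (hz : Transcendental K z) :
    z ∉ IntermediateField.adjoin K {z ^ 3} := by
  rw [IntermediateField.mem_adjoin_simple_iff]
  rintro ⟨r, s, h⟩
  have hz0 : z ≠ 0 := by rintro rfl; exact hz (isAlgebraic_zero)
  have hs : Polynomial.aeval (z ^ 3) s ≠ 0 := by
    intro h0; rw [h0, div_zero] at h; exact hz0 h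
  have hs0 : s ≠ 0 := by rintro rfl; simp at hs
  rw [eq_div_iff hs] at h
  have h2 : Polynomial.X * Polynomial.expand K 3 s = Polynomial.expand K 3 r := by
    apply (transcendental_iff_injective.mp hz)
    simpa [Polynomial.expand_aeval] using h
  have h3 := congrArg Polynomial.natDegree h2
  rw [Polynomial.natDegree_X_mul (by rwa [Ne, Polynomial.expand_eq_zero (by norm_num)]),
    Polynomial.natDegree_expand, Polynomial.natDegree_expand] at h3
  omega

lemma strict {E : Type} [Field E] [Algebra ℚ E] (a b : E) (ha : Transcendental ℚ a)
    (hab : a ^ 2 + b ^ 2 = -1)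
    (h1 : a ∈ IntermediateField.adjoin ℚ {a ^ 3 - 3 * a * b ^ 2, 3 * a ^ 2 * b - b ^ 3})
    (h2 : b ∈ IntermediateField.adjoin ℚ {a ^ 3 - 3 * a * b ^ 2, 3 * a ^ 2 * b - b ^ 3}) :
    False := by
  let L := AlgebraicClosure E
  have : CharZero E := algebraRat.charZero E
  have : CharZero L := algebraRat.charZero L
  let K := algebraicClosure ℚ L
  obtain ⟨i, hi⟩ := IsAlgClosed.exists_pow_nat_eq (-1 : L) (n := 2) (by norm_num)
  have hiK : i ∈ K := by
    rw [mem_algebraicClosure_iff]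
    exact IsAlgebraic.of_pow (n := 2) (by norm_num) (by rw [hi]; exact isAlgebraic_one.neg)
  let f : E →ₐ[ℚ] L := IsScalarTower.toAlgHom ℚ E L
  have hab' : f a ^ 2 + f b ^ 2 = -1 := by
    rw [← map_pow, ← map_pow, ← map_add, hab]; simp
  set z := f a + i * f b with hz
  have hzw : z * (f a - i * f b) = -1 := by
    rw [hz]; linear_combination hab' - f b ^ 2 * hi
  have hz0 : z ≠ 0 := by intro h; rw [h] at hzw; simp at hzw
  have hzinv : z⁻¹ = - (f a - i * f b) := by
    apply inv_eq_of_mul_eq_one_right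
    linear_combination -hzw
  have hzt : Transcendental ℚ z := by
    intro halg
    apply ha
    rw [← isAlgebraic_algHom_iff f f.injective]
    have : f a = (z - z⁻¹) * algebraMap ℚ L (1/2) := by
      have : algebraMap ℚ L (1/2) = 1/2 := by simp
      rw [this, hzinv, hz]; ring
    rw [this]
    exact (halg.sub halg.inv).mul (isAlgebraic_algebraMap _)
  have hzK : Transcendental K z := hzt.algebraicClosure
  apply notMem_cube z hzK
  set T := IntermediateField.adjoin K {z ^ 3} with hT
  have hiT : i ∈ T := T.algebraMap_mem ⟨i, hiK⟩
  have hzT : z ^ 3 ∈ T := IntermediateField.mem_adjoin_simple_self K _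
  have hz3 : z ^ 3 = f (a ^ 3 - 3 * a * b ^ 2) + i * f (3 * a ^ 2 * b - b ^ 3) := by
    simp only [map_sub, map_mul, map_pow, map_ofNat, hz]
    linear_combination (3 * f a * f b ^ 2 + i * f b ^ 3) * hi
  have hz3' : (z ^ 3)⁻¹ = - (f (a ^ 3 - 3 * a * b ^ 2) - i * f (3 * a ^ 2 * b - b ^ 3)) := by
    rw [← inv_pow, hzinv]
    simp only [map_sub, map_mul, map_pow, map_ofNat]
    linear_combination (-3 * f a * f b ^ 2 + i * f b ^ 3) * hi
  have h2T : (2 : L)⁻¹ ∈ T := T.inv_mem (by exact_mod_cast natCast_mem T 2)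
  have hi0 : i ≠ 0 := by rintro rfl; simp at hi
  have hle : IntermediateField.adjoin ℚ {a ^ 3 - 3 * a * b ^ 2, 3 * a ^ 2 * b - b ^ 3} ≤
      (T.restrictScalars ℚ).comap f := by
    rw [IntermediateField.adjoin_le_iff]
    rintro x (rfl | rfl)
    · change f _ ∈ T
      have : f (a ^ 3 - 3 * a * b ^ 2) = (z ^ 3 - (z ^ 3)⁻¹) * 2⁻¹ := by
        rw [hz3', hz3]; ring
      rw [this]
      exact mul_mem (sub_mem hzT (inv_mem hzT)) h2T
    · change f _ ∈ T
      have : f (3 * a ^ 2 * b - b ^ 3) = (z ^ 3 + (z ^ 3)⁻¹) * 2⁻¹ * i⁻¹ := by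
        rw [hz3', hz3, eq_mul_inv_iff_mul_eq₀ hi0]; ring
      rw [this]
      exact mul_mem (mul_mem (add_mem hzT (inv_mem hzT)) h2T) (inv_mem hiT)
  have e1 : f a ∈ T := hle h1
  have e2 : f b ∈ T := hle h2
  exact add_mem e1 (mul_mem hiT e2)

end QMod

namespace QMod

def qi : ℍ[ℚ] := ⟨0, 1, 0, 0⟩
def qj : ℍ[ℚ] := ⟨0, 0, 1, 0⟩
def qk : ℍ[ℚ] := ⟨0, 0, 0, 1⟩

@[simp] lemma qi_re : qi.re = 0 := rfl
@[simp] lemma qi_imI : qi.imI = 1 := rfl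
@[simp] lemma qi_imJ : qi.imJ = 0 := rfl
@[simp] lemma qi_imK : qi.imK = 0 := rfl
@[simp] lemma qj_re : qj.re = 0 := rfl
@[simp] lemma qj_imI : qj.imI = 0 := rfl
@[simp] lemma qj_imJ : qj.imJ = 1 := rfl
@[simp] lemma qj_imK : qj.imK = 0 := rfl
@[simp] lemma qk_re : qk.re = 0 := rfl
@[simp] lemma qk_imI : qk.imI = 0 := rfl
@[simp] lemma qk_imJ : qk.imJ = 0 := rfl
@[simp] lemma qk_imK : qk.imK = 1 := rfl

lemma exists_sol {F : Type} [Field F] [Algebra ℚ F] (σ : ℍ[ℚ] →ₐ[ℚ] Matrix (Fin 2) (Fin 2) F) :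
    ∃ a b : F, a ^ 2 + b ^ 2 = -1 := by
  set I := σ qi with hI
  set J := σ qj with hJ
  set K := σ qk with hK
  have hII : I * I = -1 := by
    rw [hI, ← map_mul, ← map_one σ, ← map_neg]; congr 1; ext <;> simp
  have hJJ : J * J = -1 := by
    rw [hJ, ← map_mul, ← map_one σ, ← map_neg]; congr 1; ext <;> simp
  have hKK : K * K = -1 := by
    rw [hK, ← map_mul, ← map_one σ, ← map_neg]; congr 1; ext <;> simp
  have hIJ : I * J + J * I = 0 := by
    rw [hI, hJ, ← map_mul, ← map_mul, ← map_add, ← map_zero σ]; congr 1; ext <;> simp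
  have hIK : I * K + K * I = 0 := by
    rw [hI, hK, ← map_mul, ← map_mul, ← map_add, ← map_zero σ]; congr 1; ext <;> simp
  have hJK : J * K + K * J = 0 := by
    rw [hJ, hK, ← map_mul, ← map_mul, ← map_add, ← map_zero σ]; congr 1; ext <;> simp
  obtain ⟨v, hv, hv0⟩ := Matrix.exists_mulVec_eq_zero_iff
    (M := !![I 0 0, J 0 0, K 0 0; I 1 0, J 1 0, K 1 0; 0, 0, 0]) |>.mpr (by
      simp [Matrix.det_fin_three])
  have e0 := congrFun hv0 0
  have e1 := congrFun hv0 1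
  simp [Matrix.mulVec, dotProduct, Fin.sum_univ_three] at e0 e1
  set N := v 0 • I + v 1 • J + v 2 • K with hN
  have hNN : N * N = -(v 0 ^ 2 + v 1 ^ 2 + v 2 ^ 2) • (1 : Matrix (Fin 2) (Fin 2) F) := by
    have : N * N = (v 0 ^ 2) • (I * I) + (v 1 ^ 2) • (J * J) + (v 2 ^ 2) • (K * K)
        + (v 0 * v 1) • (I * J + J * I) + (v 0 * v 2) • (I * K + K * I)
        + (v 1 * v 2) • (J * K + K * J) := by
      simp only [hN, add_mul, mul_add, smul_mul_assoc, mul_smul_comm, smul_smul, smul_add]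
      module
    rw [this, hII, hJJ, hKK, hIJ, hIK, hJK]
    module
  have hsum : v 0 ^ 2 + v 1 ^ 2 + v 2 ^ 2 = 0 := by
    have h00 := congrFun (congrFun hNN 0) 0
    have n0 : N 0 0 = 0 := by simp [hN]; linear_combination e0
    have n1 : N 1 0 = 0 := by simp [hN]; linear_combination e1
    rw [Matrix.mul_apply, Fin.sum_univ_two, n0, n1] at h00
    simp at h00
    linear_combination h00
  by_cases h2 : v 2 = 0
  · by_cases h1 : v 1 = 0
    · exfalso
      apply hv
      have h0 : v 0 = 0 := by simpa [h1, h2] using hsum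
      ext i; fin_cases i <;> simp [h0, h1, h2]
    · refine ⟨v 0 / v 1, v 2 / v 1, ?_⟩
      field_simp
      linear_combination hsum
  · refine ⟨v 0 / v 2, v 1 / v 2, ?_⟩
    field_simp
    linear_combination hsum

lemma exists_conj {E : Type} [Field E] [CharZero E] (a b c d : E) (h1 : a ^ 2 + b ^ 2 = -1)
    (h2 : c ^ 2 + d ^ 2 = -1) : ∃ P : (Matrix (Fin 2) (Fin 2) E)ˣ,
      !![a, b; b, -a] * P.1 = P.1 * !![c, d; d, -c] ∧
      !![b, -a; -a, -b] * P.1 = P.1 * !![d, -c; -c, -d] := by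
  by_cases h : a * c + b * d = 1
  · refine ⟨Matrix.nonsingInvUnit !![-(a*d-b*c), 1 + (a*c+b*d); -(1+(a*c+b*d)), -(a*d-b*c)] ?_, ?_, ?_⟩
    · rw [Matrix.det_fin_two_of, isUnit_iff_ne_zero]
      have : -(a*d-b*c) * -(a*d-b*c) - (1 + (a*c+b*d)) * -(1+(a*c+b*d)) = 4 := by
        linear_combination (c^2+d^2) * h1 - h2 + 2 * h
      rw [this]; norm_num
    · ext i j
      fin_cases i <;> fin_cases j <;>
        simp [Matrix.nonsingInvUnit, Matrix.mul_apply, Fin.sum_univ_two] <;> grind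
    · ext i j
      fin_cases i <;> fin_cases j <;>
        simp [Matrix.nonsingInvUnit, Matrix.mul_apply, Fin.sum_univ_two] <;> grind
  · refine ⟨Matrix.nonsingInvUnit !![1 - (a*c+b*d), -(a*d-b*c); (a*d-b*c), 1-(a*c+b*d)] ?_, ?_, ?_⟩
    · rw [Matrix.det_fin_two_of, isUnit_iff_ne_zero]
      have : (1 - (a*c+b*d)) * (1 - (a*c+b*d)) - -(a*d-b*c) * (a*d-b*c) = 2 * (1 - (a*c+b*d)) := by
        linear_combination (c^2+d^2) * h1 - h2
      rw [this]
      exact mul_ne_zero two_ne_zero (sub_ne_zero.mpr (Ne.symm h))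
    · ext i j
      fin_cases i <;> fin_cases j <;>
        simp [Matrix.nonsingInvUnit, Matrix.mul_apply, Fin.sum_univ_two] <;> grind
    · ext i j
      fin_cases i <;> fin_cases j <;>
        simp [Matrix.nonsingInvUnit, Matrix.mul_apply, Fin.sum_univ_two] <;> grind

lemma exists_sigma {F : Type} [Field F] [Algebra ℚ F] (c d : F) (h : c ^ 2 + d ^ 2 = -1) :
    ∃ σ : ℍ[ℚ] →ₐ[ℚ] Matrix (Fin 2) (Fin 2) F,
      σ qi = !![c, d; d, -c] ∧ σ qj = !![d, -c; -c, -d] := by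
  let B : QuaternionAlgebra.Basis (Matrix (Fin 2) (Fin 2) F) (-1 : ℚ) 0 (-1) :=
    { i := !![c, d; d, -c]
      j := !![d, -c; -c, -d]
      k := !![0, 1; -1, 0]
      i_mul_i := by
        ext i j; fin_cases i <;> fin_cases j <;> simp [Matrix.mul_apply, Fin.sum_univ_two] <;> grind
      j_mul_j := by
        ext i j; fin_cases i <;> fin_cases j <;> simp [Matrix.mul_apply, Fin.sum_univ_two] <;> grind
      i_mul_j := by
        ext i j; fin_cases i <;> fin_cases j <;> simp [Matrix.mul_apply, Fin.sum_univ_two] <;> grind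
      j_mul_i := by
        ext i j; fin_cases i <;> fin_cases j <;> simp [Matrix.mul_apply, Fin.sum_univ_two] <;> grind }
  refine ⟨B.liftHom, ?_, ?_⟩
  · change B.lift qi = _
    simp [QuaternionAlgebra.Basis.lift, B, qi]
  · change B.lift qj = _
    simp [QuaternionAlgebra.Basis.lift, B, qj]

lemma descends {E : Type} [Field E] [Algebra ℚ E]
    (a b : E) (hab : a ^ 2 + b ^ 2 = -1)
    (ρ : ℍ[ℚ] →ₐ[ℚ] Matrix (Fin 2) (Fin 2) E)
    (hρi : ρ qi = !![a, b; b, -a])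
    (hρj : ρ qj = !![b, -a; -a, -b])
    (F : IntermediateField ℚ E) (c d : F) (h : c ^ 2 + d ^ 2 = -1) : RepDescendsTo E ρ F := by
  have : CharZero E := algebraRat.charZero E
  obtain ⟨σ, hi, hj⟩ := exists_sigma c d h
  obtain ⟨P, hP1, hP2⟩ := exists_conj a b (c : E) (d : E) hab (by exact_mod_cast congrArg (algebraMap F E) h)
  refine ⟨σ, P, fun q => ?_⟩
  rw [Units.eq_mul_inv_iff_mul_eq]
  set τ : ℍ[ℚ] →ₐ[ℚ] Matrix (Fin 2) (Fin 2) E := RingHom.toRatAlgHom (((algebraMap F E).mapMatrix).comp (σ : ℍ[ℚ] →+* _)) with hτ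
  have hτq : ∀ q, (σ q).map (algebraMap F E) = τ q := fun q => rfl
  rw [hτq]
  have ti : τ qi = !![(c : E), d; d, -c] := by
    rw [← hτq, hi]; ext i j; fin_cases i <;> fin_cases j <;> simp
  have tj : τ qj = !![(d : E), -c; -c, -d] := by
    rw [← hτq, hj]; ext i j; fin_cases i <;> fin_cases j <;> simp
  rw [← hρi, ← ti] at hP1
  rw [← hρj, ← tj] at hP2
  have hq : q = algebraMap ℚ ℍ[ℚ] q.re + q.imI • qi + q.imJ • qj
      + q.imK • (qi * qj) := by
    ext <;> simp
  rw [hq]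
  simp only [map_add, map_smul, map_mul, AlgHom.commutes, add_mul, mul_add, smul_mul_assoc,
    mul_smul_comm, hP1, hP2]
  rw [mul_assoc (ρ _) (ρ _), hP2, ← mul_assoc (ρ _), hP1, Algebra.commutes, mul_assoc]

end QMod

/-- **Proposition 6.2(b).** Let `E = ℚ(a,b)` with `a` transcendental
over `ℚ` and `a² + b² = -1` (the fraction field of `ℚ[a,b]/(a²+b²+1)`), and let `M`
be the 2-dimensional module over `A_E`, `A = (-1,-1)_ℚ`, given by
`i ↦ [[a,b],[b,-a]]`, `j ↦ [[b,-a],[-a,-b]]`.  Then `M` has no minimal field of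
definition: every field of definition `ℚ ⊆ E₁ ⊆ E` of `M` properly contains another
field of definition `E₃`. -/
theorem quaternion_module_no_minimal_field_of_definition
    (E : Type) [Field E] [Algebra ℚ E]
    (a b : E) (ha : Transcendental ℚ a) (hab : a ^ 2 + b ^ 2 = -1)
    (hgen : IntermediateField.adjoin ℚ {a, b} = (⊤ : IntermediateField ℚ E))
    (ρ : ℍ[ℚ] →ₐ[ℚ] Matrix (Fin 2) (Fin 2) E)
    (hρi : ρ ⟨0, 1, 0, 0⟩ = !![a, b; b, -a])
    (hρj : ρ ⟨0, 0, 1, 0⟩ = !![b, -a; -a, -b]) :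
    ∀ E₁ : IntermediateField ℚ E, RepDescendsTo E ρ E₁ →
      ∃ E₃ : IntermediateField ℚ E, RepDescendsTo E ρ E₃ ∧ E₃ < E₁ := by
  rintro E₁ ⟨σ, -, -⟩
  obtain ⟨c, d, hcd⟩ := QMod.exists_sol σ
  have hcd' : (c : E) ^ 2 + (d : E) ^ 2 = -1 := by exact_mod_cast congrArg (algebraMap E₁ E) hcd
  obtain ⟨φ, hφ⟩ := QMod.exists_phi a ha
  have hc : Transcendental ℚ (c : E) := by
    intro hc
    have hd : IsAlgebraic ℚ (d : E) := by
      apply IsAlgebraic.of_pow (n := 2) (by norm_num)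
      have : (d : E) ^ 2 = -1 - (c : E) ^ 2 := by linear_combination hcd'
      rw [this]
      exact isAlgebraic_one.neg.sub (hc.pow 2)
    obtain ⟨p, hp⟩ := QMod.alg_rat a b hab φ hφ hgen _ hc
    obtain ⟨q, hq⟩ := QMod.alg_rat a b hab φ hφ hgen _ hd
    rw [hp, hq, ← map_pow, ← map_pow, ← map_add, ← map_one (algebraMap ℚ E), ← map_neg] at hcd'
    have := (algebraMap ℚ E).injective hcd'
    nlinarith [sq_nonneg p, sq_nonneg q]
  set E₃ : IntermediateField ℚ E := IntermediateField.adjoin ℚ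
    {(c : E) ^ 3 - 3 * c * (d : E) ^ 2, 3 * (c : E) ^ 2 * d - (d : E) ^ 3} with hE₃
  have m1 : (c : E) ^ 3 - 3 * c * (d : E) ^ 2 ∈ E₃ :=
    IntermediateField.subset_adjoin _ _ (Or.inl rfl)
  have m2 : 3 * (c : E) ^ 2 * d - (d : E) ^ 3 ∈ E₃ :=
    IntermediateField.subset_adjoin _ _ (Or.inr rfl)
  refine ⟨E₃, ?_, lt_of_le_of_ne ?_ ?_⟩
  · refine QMod.descends a b hab ρ hρi hρj E₃ ⟨_, m1⟩ ⟨_, m2⟩ ?_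
    apply Subtype.ext
    change ((c : E) ^ 3 - 3 * c * (d : E) ^ 2) ^ 2 + (3 * (c : E) ^ 2 * d - (d : E) ^ 3) ^ 2 = -1
    have : ((c : E) ^ 3 - 3 * c * (d : E) ^ 2) ^ 2 + (3 * (c : E) ^ 2 * d - (d : E) ^ 3) ^ 2
      = ((c : E) ^ 2 + (d : E) ^ 2) ^ 3 := by ring
    rw [this, hcd']
    norm_num
  · rw [hE₃, IntermediateField.adjoin_le_iff]
    rintro x (rfl | rfl)
    · exact (c ^ 3 - 3 * c * d ^ 2 : E₁).2
    · exact (3 * c ^ 2 * d - d ^ 3 : E₁).2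
  · intro heq
    refine QMod.strict (c : E) (d : E) hc hcd' ?_ ?_
    · rw [← hE₃, heq]; exact c.2
    · rw [← hE₃, heq]; exact d.2
end
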